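/- arXiv:0711.1753 — 5 statements merged into one kernel-verified Lean document; each statement's English description precedes it below -/
import Mathlib

section
/- The set {α ∈ ℝ : liminf_{n→∞} n · (log n) · ‖α n²‖ > 0} has Hausdorff dimension at least 2/3; in particular there exists a real number α with liminf_{n→∞} n · (log n) · ‖α n²‖ > 0 (answering a question of W. Schmidt in the negative). -/
namespace SquareFractionalParts

open Finset

section Characters

variable {p : ℕ} [Fact p.Prime]

theorem sum_stdAddChar_mul (x : ZMod p) :
    ∑ b : ZMod p, (ZMod.stdAddChar (b * x) : ℂ) = if x = 0 then (p : ℂ) else 0 := by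
  have := AddChar.sum_mulShift (R' := ℂ) x (ZMod.isPrimitive_stdAddChar p)
  simpa [ZMod.card] using this

theorem conj_stdAddChar (x : ZMod p) :
    (starRingEnd ℂ) (ZMod.stdAddChar x) = ZMod.stdAddChar (-x) :=
  (AddChar.map_neg_eq_conj _ _).symm

theorem norm_sq_sum_stdAddChar {ι : Type*} (s : Finset ι) (f : ι → ZMod p) :
    ((‖∑ i ∈ s, (ZMod.stdAddChar (f i) : ℂ)‖ ^ 2 : ℝ) : ℂ) =
      ∑ i ∈ s, ∑ j ∈ s, (ZMod.stdAddChar (f i - f j) : ℂ) := by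
  push_cast
  rw [← Complex.mul_conj', map_sum, sum_mul_sum]
  simp_rw [conj_stdAddChar, sub_eq_add_neg, AddChar.map_add_eq_mul]

theorem sum_norm_sq_stdAddChar (s : Finset (ZMod p)) :
    ∑ b : ZMod p, ‖∑ u ∈ s, (ZMod.stdAddChar (b * u) : ℂ)‖ ^ 2 = p * #s := by
  have : ((∑ b : ZMod p, ‖∑ u ∈ s, (ZMod.stdAddChar (b * u) : ℂ)‖ ^ 2 : ℝ) : ℂ) = p * #s := by
    rw [Complex.ofReal_sum]
    simp_rw [norm_sq_sum_stdAddChar, ← mul_sub]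
    rw [sum_comm]
    have : ∀ i ∈ s, ∑ b : ZMod p, ∑ j ∈ s, (ZMod.stdAddChar (b * (i - j)) : ℂ) = p := by
      intro i hi
      rw [sum_comm]
      simp_rw [sum_stdAddChar_mul, sub_eq_zero]
      rw [sum_ite_eq]
      simp [hi]
    rw [sum_congr rfl this]
    simp [mul_comm]
  exact_mod_cast this

/-- Fourier bound for a function summed over differences of two sets. -/
theorem norm_sum_sub_le (g : ZMod p → ℂ) (S : ℝ)
    (hg : ∀ b : ZMod p, ‖∑ n, g n * ZMod.stdAddChar (b * n)‖ ≤ S) (Y I : Finset (ZMod p)) :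
    ‖∑ u ∈ Y, ∑ i ∈ I, g (u - i)‖ ≤ S * √(#Y * #I) := by
  have hp : (0 : ℝ) < p := by exact_mod_cast (Fact.out : p.Prime).pos
  have key : (p : ℂ) * ∑ u ∈ Y, ∑ i ∈ I, g (u - i) =
      ∑ b : ZMod p, (∑ n, g n * ZMod.stdAddChar (b * n)) *
        ((starRingEnd ℂ) (∑ u ∈ Y, (ZMod.stdAddChar (b * u) : ℂ)) *
          ∑ i ∈ I, (ZMod.stdAddChar (b * i) : ℂ)) := by
    have h1 : ∀ u i : ZMod p, (p : ℂ) * g (u - i) =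
        ∑ b : ZMod p, ∑ n, g n * ZMod.stdAddChar (b * (n - (u - i))) := by
      intro u i
      rw [sum_comm]
      simp_rw [← mul_sum, sum_stdAddChar_mul, sub_eq_zero]
      simp [mul_comm]
    rw [mul_sum, sum_congr rfl fun u _ => mul_sum _ _ _]
    simp_rw [h1]
    rw [sum_congr rfl (fun u _ => sum_comm), sum_comm]
    refine sum_congr rfl fun b _ => ?_
    rw [map_sum, sum_mul_sum, mul_sum]
    refine sum_congr rfl fun u _ => ?_
    rw [mul_sum]
    refine sum_congr rfl fun i _ => ?_
    rw [sum_mul]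
    refine sum_congr rfl fun n _ => ?_
    rw [conj_stdAddChar, ← AddChar.map_add_eq_mul, mul_assoc, ← AddChar.map_add_eq_mul]
    congr 2
    ring
  have hS : 0 ≤ S := (norm_nonneg _).trans (hg 0)
  have h2 : (p : ℝ) * ‖∑ u ∈ Y, ∑ i ∈ I, g (u - i)‖ ≤
      S * ∑ b : ZMod p, ‖∑ u ∈ Y, (ZMod.stdAddChar (b * u) : ℂ)‖ *
        ‖∑ i ∈ I, (ZMod.stdAddChar (b * i) : ℂ)‖ := by
    have : (p : ℝ) * ‖∑ u ∈ Y, ∑ i ∈ I, g (u - i)‖ =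
      ‖(p : ℂ) * ∑ u ∈ Y, ∑ i ∈ I, g (u - i)‖ := by simp
    rw [this, key, mul_sum]
    refine norm_sum_le_of_le _ fun b _ => ?_
    rw [norm_mul, norm_mul, RCLike.norm_conj]
    exact mul_le_mul_of_nonneg_right (hg b) (by positivity)
  have h3 := Real.sum_mul_le_sqrt_mul_sqrt univ
    (fun b : ZMod p => ‖∑ u ∈ Y, (ZMod.stdAddChar (b * u) : ℂ)‖)
    (fun b : ZMod p => ‖∑ i ∈ I, (ZMod.stdAddChar (b * i) : ℂ)‖)
  rw [sum_norm_sq_stdAddChar, sum_norm_sq_stdAddChar, ← Real.sqrt_mul (by positivity)] at h3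
  have h4 : √((p : ℝ) * #Y * (p * #I)) = p * √(#Y * #I) := by
    rw [show (p : ℝ) * #Y * (p * #I) = p ^ 2 * (#Y * #I) by ring, Real.sqrt_mul (by positivity),
      Real.sqrt_sq hp.le]
  rw [h4] at h3
  have h5 := h2.trans (mul_le_mul_of_nonneg_left h3 hS)
  have : (p : ℝ) * ‖∑ u ∈ Y, ∑ i ∈ I, g (u - i)‖ ≤ p * (S * √(#Y * #I)) := by
    linarith
  exact le_of_mul_le_mul_left this hp

/-- The exponential sum over nonzero residues with phase `a / m ^ 2 + b * m`. -/
noncomputable def inverseSquareSum (a b : ZMod p) : ℂ :=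
  ∑ m : (ZMod p)ˣ, ZMod.stdAddChar (a * ((m⁻¹ : (ZMod p)ˣ) : ZMod p) ^ 2 + b * (m : ZMod p))

theorem inverseSquareSum_mul_unit (a b : ZMod p) (t : (ZMod p)ˣ) :
    inverseSquareSum (a * ((t⁻¹ : (ZMod p)ˣ) : ZMod p) ^ 2) (b * (t : ZMod p)) = inverseSquareSum a b := by
  unfold inverseSquareSum
  rw [← Equiv.sum_comp (Equiv.mulLeft t)
    (fun m : (ZMod p)ˣ => (ZMod.stdAddChar (a * ((m⁻¹ : (ZMod p)ˣ) : ZMod p) ^ 2 + b * (m : ZMod p)) : ℂ))]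
  refine sum_congr rfl fun m _ => ?_
  simp only [Equiv.coe_mulLeft, mul_inv, Units.val_mul]
  congr 1
  ring

theorem sum_norm_sq_two_variable {ι : Type*} [Fintype ι] [DecidableEq ι] (f g : ι → ZMod p) :
    ∑ a : ZMod p, ∑ b : ZMod p, ‖∑ i, (ZMod.stdAddChar (a * f i + b * g i) : ℂ)‖ ^ 2 =
      p ^ 2 * ∑ i, (#{j | f i = f j ∧ g i = g j} : ℝ) := by
  have : ((∑ a : ZMod p, ∑ b : ZMod p,
      ‖∑ i, (ZMod.stdAddChar (a * f i + b * g i) : ℂ)‖ ^ 2 : ℝ) : ℂ) =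
      p ^ 2 * ∑ i, (#{j | f i = f j ∧ g i = g j} : ℂ) := by
    rw [Complex.ofReal_sum]
    simp_rw [Complex.ofReal_sum, norm_sq_sum_stdAddChar]
    have h1 : ∀ (a b : ZMod p) (i j : ι),
        (ZMod.stdAddChar (a * f i + b * g i - (a * f j + b * g j)) : ℂ) =
        ZMod.stdAddChar (a * (f i - f j)) * ZMod.stdAddChar (b * (g i - g j)) := by
      intro a b i j
      rw [← AddChar.map_add_eq_mul]
      congr 1
      ring
    simp_rw [h1]
    have h2 : ∀ a : ZMod p, ∑ b : ZMod p, ∑ i, ∑ j,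
        (ZMod.stdAddChar (a * (f i - f j)) * ZMod.stdAddChar (b * (g i - g j)) : ℂ) =
        ∑ i, ∑ j, (ZMod.stdAddChar (a * (f i - f j)) : ℂ) *
          (if g i - g j = 0 then (p : ℂ) else 0) := by
      intro a
      rw [sum_comm]
      refine sum_congr rfl fun i _ => ?_
      rw [sum_comm]
      refine sum_congr rfl fun j _ => ?_
      rw [← mul_sum, sum_stdAddChar_mul]
    simp_rw [h2]
    rw [sum_comm, mul_sum]
    refine sum_congr rfl fun i _ => ?_
    rw [sum_comm]
    simp_rw [← sum_mul, sum_stdAddChar_mul, sub_eq_zero]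
    rw [card_filter, Nat.cast_sum, mul_sum]
    refine sum_congr rfl fun j _ => ?_
    by_cases h : f i = f j <;> by_cases h' : g i = g j <;> simp [h, h', sq]
  exact_mod_cast this

/-- At most four pairs of units share given values of `m₁⁻² + m₂⁻²` and `m₁ + m₂`. -/
theorem card_pairs_le_four (hp : p ≠ 2) (t s : ZMod p) :
    #{x : (ZMod p)ˣ × (ZMod p)ˣ |
      t = ((x.1⁻¹ : (ZMod p)ˣ) : ZMod p) ^ 2 + ((x.2⁻¹ : (ZMod p)ˣ) : ZMod p) ^ 2 ∧
      s = x.1 + x.2} ≤ 4 := by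
  have h2 : (2 : ZMod p) ≠ 0 := by
    have := ZMod.prime_ne_zero p 2 (by simpa using hp)
    simpa using this
  set A := ({x : (ZMod p)ˣ × (ZMod p)ˣ |
      t = ((x.1⁻¹ : (ZMod p)ˣ) : ZMod p) ^ 2 + ((x.2⁻¹ : (ZMod p)ˣ) : ZMod p) ^ 2 ∧
      s = x.1 + x.2} : Finset _) with hA
  have hroot : ∀ c d e : ZMod p, (c ≠ 0 ∨ d ≠ 0) →
      #{P : ZMod p | c * P ^ 2 + d * P + e = 0} ≤ 2 := by
    intro c d e hcd
    set f : Polynomial (ZMod p) :=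
      Polynomial.C c * Polynomial.X ^ 2 + Polynomial.C d * Polynomial.X + Polynomial.C e with hf
    have hf0 : f ≠ 0 := by
      intro h
      have h1 : f.coeff 2 = 0 := by rw [h]; simp
      have h2 : f.coeff 1 = 0 := by rw [h]; simp
      rw [hf] at h1 h2
      simp [Polynomial.coeff_C] at h1 h2
      tauto
    have hsub : ({P : ZMod p | c * P ^ 2 + d * P + e = 0} : Finset _) ⊆ f.roots.toFinset := by
      intro P hP
      simp only [mem_filter, mem_univ, true_and] at hP
      rw [Multiset.mem_toFinset, Polynomial.mem_roots hf0, Polynomial.IsRoot.def, hf]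
      simpa using hP
    calc _ ≤ #f.roots.toFinset := card_le_card hsub
      _ ≤ Multiset.card f.roots := Multiset.toFinset_card_le _
      _ ≤ f.natDegree := Polynomial.card_roots' f
      _ ≤ 2 := by rw [hf]; exact Polynomial.natDegree_quadratic_le
  have himg : #(A.image fun x => ((x.1 * x.2 : (ZMod p)ˣ) : ZMod p)) ≤ 2 := by
    refine (card_le_card ?_).trans (hroot t 2 (-s ^ 2) (Or.inr h2))
    intro P hP
    obtain ⟨⟨x, z⟩, hx, rfl⟩ := mem_image.1 hP
    simp only [hA, mem_filter, mem_univ, true_and] at hx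
    simp only [mem_filter, mem_univ, true_and, hx.1, hx.2, Units.val_mul]
    have e1 : ((x⁻¹ : (ZMod p)ˣ) : ZMod p) * x = 1 := Units.inv_mul x
    have e2 : ((z⁻¹ : (ZMod p)ˣ) : ZMod p) * z = 1 := Units.inv_mul z
    generalize ((x⁻¹ : (ZMod p)ˣ) : ZMod p) = x' at *
    generalize ((z⁻¹ : (ZMod p)ˣ) : ZMod p) = z' at *
    have e1' : (x' * x) ^ 2 = 1 := by rw [e1]; ring
    have e2' : (z' * z) ^ 2 = 1 := by rw [e2]; ring
    linear_combination (z : ZMod p) ^ 2 * e1' + (x : ZMod p) ^ 2 * e2'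
  have hfib := card_le_mul_card_image (s := A)
    (f := fun x => ((x.1 * x.2 : (ZMod p)ˣ) : ZMod p)) 2 (by
      intro P _
      refine le_trans ?_ (hroot 1 (-s) P (Or.inl one_ne_zero))
      refine card_le_card_of_injOn (fun x => (x.1 : ZMod p)) ?_ ?_
      · intro x hx
        simp only [hA, coe_filter, mem_filter, mem_univ, true_and, Set.mem_ofPred_eq] at hx ⊢
        rw [← hx.2, hx.1.2, Units.val_mul]
        ring
      · intro x hx z hz hxz
        simp only [hA, coe_filter, mem_filter, mem_univ, true_and, Set.mem_ofPred_eq] at hx hz hxz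
        have h1 : x.1 = z.1 := Units.ext hxz
        have h3 : (x.2 : ZMod p) = z.2 := by
          have := hx.1.2.symm.trans hz.1.2
          rw [hxz] at this
          exact add_left_cancel this
        exact Prod.ext h1 (Units.ext h3))
  omega

theorem sum_norm_inverseSquareSum_le (hp : p ≠ 2) :
    ∑ a : ZMod p, ∑ b : ZMod p, ‖inverseSquareSum a b‖ ^ 4 ≤ 4 * (p : ℝ) ^ 2 * (p - 1) ^ 2 := by
  have h1 : ∀ a b : ZMod p, ‖inverseSquareSum a b‖ ^ 4 =
      ‖∑ x : (ZMod p)ˣ × (ZMod p)ˣ, (ZMod.stdAddChar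
        (a * (((x.1⁻¹ : (ZMod p)ˣ) : ZMod p) ^ 2 + ((x.2⁻¹ : (ZMod p)ˣ) : ZMod p) ^ 2) +
          b * ((x.1 : ZMod p) + (x.2 : ZMod p))) : ℂ)‖ ^ 2 := by
    intro a b
    rw [show ‖inverseSquareSum a b‖ ^ 4 = ‖inverseSquareSum a b * inverseSquareSum a b‖ ^ 2 by
      rw [norm_mul]; ring]
    unfold inverseSquareSum
    rw [sum_mul_sum, Fintype.sum_prod_type]
    congr 2
    refine sum_congr rfl fun m _ => sum_congr rfl fun n _ => ?_
    rw [← AddChar.map_add_eq_mul]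
    congr 1
    ring
  simp_rw [h1]
  rw [sum_norm_sq_two_variable (ι := (ZMod p)ˣ × (ZMod p)ˣ)
    (fun x => ((x.1⁻¹ : (ZMod p)ˣ) : ZMod p) ^ 2 + ((x.2⁻¹ : (ZMod p)ˣ) : ZMod p) ^ 2)
    (fun x => (x.1 : ZMod p) + (x.2 : ZMod p))]
  have h2 : ∑ i : (ZMod p)ˣ × (ZMod p)ˣ, (#{j : (ZMod p)ˣ × (ZMod p)ˣ |
      ((i.1⁻¹ : (ZMod p)ˣ) : ZMod p) ^ 2 + ((i.2⁻¹ : (ZMod p)ˣ) : ZMod p) ^ 2 =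
      ((j.1⁻¹ : (ZMod p)ˣ) : ZMod p) ^ 2 + ((j.2⁻¹ : (ZMod p)ˣ) : ZMod p) ^ 2 ∧
      (i.1 : ZMod p) + (i.2 : ZMod p) = (j.1 : ZMod p) + (j.2 : ZMod p)} : ℝ) ≤
      ∑ i : (ZMod p)ˣ × (ZMod p)ˣ, (4 : ℝ) := by
    refine sum_le_sum fun i _ => ?_
    exact_mod_cast card_pairs_le_four hp _ _
  have h3 : (Fintype.card ((ZMod p)ˣ × (ZMod p)ˣ) : ℝ) = (p - 1) ^ 2 := by
    rw [Fintype.card_prod, ZMod.card_units_eq_totient, Nat.totient_prime Fact.out]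
    rw [Nat.cast_mul, Nat.cast_sub (Fact.out : p.Prime).one_le]
    push_cast; ring
  rw [sum_const, card_univ, nsmul_eq_mul, h3] at h2
  nlinarith [sq_nonneg (p : ℝ)]

/-- Kloosterman-style fourth moment bound. -/
theorem norm_inverseSquareSum_le (hp : p ≠ 2) {a : ZMod p} (ha : a ≠ 0) (b : ZMod p) :
    ‖inverseSquareSum a b‖ ^ 4 ≤ 8 * (p : ℝ) ^ 3 := by
  have hp2 := (Fact.out : p.Prime).two_le
  have h1 : (#(univ : Finset (ZMod p)ˣ) : ℝ) * ‖inverseSquareSum a b‖ ^ 4 ≤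
      2 * ∑ x : ZMod p × ZMod p, ‖inverseSquareSum x.1 x.2‖ ^ 4 := by
    set φ : (ZMod p)ˣ → ZMod p × ZMod p := fun t => (a * ((t⁻¹ : (ZMod p)ˣ) : ZMod p) ^ 2, b * (t : ZMod p)) with hφ
    have h2 : ∀ x : ZMod p × ZMod p, (#{t : (ZMod p)ˣ | φ t = x} : ℝ) *
        ‖inverseSquareSum a b‖ ^ 4 ≤ 2 * ‖inverseSquareSum x.1 x.2‖ ^ 4 := by
      intro x
      by_cases hx : ∃ t, φ t = x
      · obtain ⟨t, rfl⟩ := hx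
        have : inverseSquareSum (φ t).1 (φ t).2 = inverseSquareSum a b :=
          inverseSquareSum_mul_unit a b t
        rw [this]
        refine mul_le_mul_of_nonneg_right ?_ (by positivity)
        have : ({u : (ZMod p)ˣ | φ u = φ t} : Finset _) ⊆ {t, -t} := by
          intro u hu
          simp only [hφ, mem_filter, mem_univ, true_and, Prod.mk.injEq] at hu
          have h3 := mul_left_cancel₀ ha hu.1
          have h4 : u⁻¹ = t⁻¹ ∨ u⁻¹ = -t⁻¹ := by
            rcases sq_eq_sq_iff_eq_or_eq_neg.1 h3 with h | h
            · exact Or.inl (Units.ext h)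
            · exact Or.inr (Units.ext (by rw [h, Units.val_neg]))
          simp only [mem_insert, mem_singleton]
          rcases h4 with h | h
          · exact Or.inl (inv_injective h)
          · right
            rw [← inv_inv u, h, inv_neg, inv_inv]
        exact_mod_cast (card_le_card this).trans card_le_two
      · push Not at hx
        rw [filter_false_of_mem (fun t _ => hx t)]
        simp only [card_empty, Nat.cast_zero, zero_mul]
        positivity
    have h3 := sum_le_sum (s := univ) (fun x _ => h2 x)
    rw [← sum_mul, ← mul_sum, ← Nat.cast_sum,
      ← card_eq_sum_card_fiberwise (fun x _ => by simp)] at h3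
    exact h3
  have h2 := sum_norm_inverseSquareSum_le (p := p) hp
  rw [← Fintype.sum_prod_type' (fun a b => ‖inverseSquareSum a b‖ ^ 4)] at h2
  rw [card_univ, ZMod.card_units_eq_totient, Nat.totient_prime Fact.out,
    Nat.cast_sub (Fact.out : p.Prime).one_le, Nat.cast_one] at h1
  have hp' : (0 : ℝ) < p - 1 := by
    have : (2 : ℝ) ≤ p := by exact_mod_cast hp2
    linarith
  have h3 : ((p : ℝ) - 1) * ‖inverseSquareSum a b‖ ^ 4 ≤ (p - 1) * (8 * p ^ 2 * (p - 1)) := by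
    linarith
  have h4 := le_of_mul_le_mul_left h3 hp'
  nlinarith [sq_nonneg (p : ℝ)]

end Characters

section Counting

variable {p : ℕ} [Fact p.Prime]

theorem sum_indicator_inverse_square_le {S : ℝ}
    (hS : ∀ a b : ZMod p, a ≠ 0 → ‖inverseSquareSum a b‖ ≤ S) {h : ZMod p} (hh : h ≠ 0)
    (Y I Z J : Finset (ZMod p)) :
    (∑ u ∈ Y, ∑ i ∈ I, ∑ z ∈ Z, ∑ j ∈ J,
      (if u - i ≠ 0 ∧ z - j = h * ((u - i)⁻¹) ^ 2 then (1 : ℝ) else 0)) ≤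
      #Y * #I * #Z * #J / p + S * √(#Y * #I) * √(#Z * #J) := by
  have hp : (0 : ℝ) < p := by exact_mod_cast (Fact.out : p.Prime).pos
  have hp0 : (p : ℂ) ≠ 0 := by exact_mod_cast hp.ne'
  have hS0 : 0 ≤ S := (norm_nonneg _).trans (hS 1 0 one_ne_zero)
  set C : ℂ := ∑ u ∈ Y, ∑ i ∈ I, (if u - i ≠ 0 then (1 : ℂ) else 0) with hC
  have hCle : ‖C‖ ≤ #Y * #I := by
    rw [hC]
    calc _ ≤ ∑ u ∈ Y, ∑ i ∈ I, (1 : ℝ) := by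
          refine norm_sum_le_of_le _ fun u _ => norm_sum_le_of_le _ fun i _ => ?_
          split_ifs <;> simp
      _ = _ := by simp
  set c : ZMod p → ℂ := fun w => ∑ u ∈ Y, ∑ i ∈ I,
    (if u - i ≠ 0 ∧ w = h * ((u - i)⁻¹) ^ 2 then (1 : ℂ) else 0) - C / p with hc
  have hchat : ∀ a : ZMod p, ‖∑ w, c w * ZMod.stdAddChar (a * w)‖ ≤ S * √(#Y * #I) := by
    intro a
    have h1 : ∑ w, c w * ZMod.stdAddChar (a * w) =
        ∑ u ∈ Y, ∑ i ∈ I, (if u - i ≠ 0 then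
          (ZMod.stdAddChar (a * (h * ((u - i)⁻¹) ^ 2)) : ℂ) else 0) -
        C / p * (if a = 0 then (p : ℂ) else 0) := by
      simp only [hc, sub_mul, sum_sub_distrib, sum_mul]
      congr 1
      · rw [sum_comm]
        refine sum_congr rfl fun u _ => ?_
        rw [sum_comm]
        refine sum_congr rfl fun i _ => ?_
        by_cases hui : u - i = 0 <;> simp [hui]
      · rw [← mul_sum, ← sum_stdAddChar_mul]
        simp_rw [mul_comm]
    rw [h1]
    by_cases ha : a = 0
    · subst ha
      have : C / p * p = C := by field_simp
      simp only [zero_mul, AddChar.map_zero_eq_one, if_true, this]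
      rw [← hC, sub_self, norm_zero]
      positivity
    · rw [if_neg ha, mul_zero, sub_zero]
      refine norm_sum_sub_le
        (fun n => if n ≠ 0 then (ZMod.stdAddChar (a * (h * (n⁻¹) ^ 2)) : ℂ) else 0) S ?_ Y I
      intro b
      convert hS (a * h) b (mul_ne_zero ha hh) using 2
      unfold inverseSquareSum
      have h2 : ∀ f : ZMod p → ℂ, f 0 = 0 → ∑ n, f n = ∑ m : (ZMod p)ˣ, f m := by
        intro f hf
        rw [← sum_erase univ hf]
        symm
        refine sum_nbij (fun m : (ZMod p)ˣ => (m : ZMod p)) (fun m _ => by simp)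
          (fun m _ n _ hmn => Units.ext hmn) (fun n hn => ?_) (fun m _ => rfl)
        have hn0 : n ≠ 0 := by simpa using hn
        exact ⟨Units.mk0 n hn0, by simp⟩
      rw [h2 _ (by simp)]
      refine sum_congr rfl fun m _ => ?_
      rw [if_pos m.ne_zero, ← AddChar.map_add_eq_mul, Units.val_inv_eq_inv_val, mul_assoc]
  have h3 := norm_sum_sub_le c _ hchat Z J
  set N : ℝ := ∑ u ∈ Y, ∑ i ∈ I, ∑ z ∈ Z, ∑ j ∈ J,
      (if u - i ≠ 0 ∧ z - j = h * ((u - i)⁻¹) ^ 2 then (1 : ℝ) else 0) with hN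
  have h4 : ∑ z ∈ Z, ∑ j ∈ J, c (z - j) = N - #Z * #J * C / p := by
    simp only [hc, sum_sub_distrib, hN]
    congr 1
    · push_cast
      rw [sum_congr rfl fun z _ => sum_comm, sum_comm]
      refine sum_congr rfl fun u _ => ?_
      rw [sum_congr rfl fun z _ => sum_comm, sum_comm]
      refine sum_congr rfl fun i _ => sum_congr rfl fun z _ => sum_congr rfl fun j _ => ?_
      split_ifs <;> simp
    · simp only [sum_const, nsmul_eq_mul]
      ring
  rw [h4] at h3
  have h5 : ‖(#Z * #J * C / p : ℂ)‖ ≤ #Y * #I * #Z * #J / p := by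
    rw [norm_div, norm_mul, norm_mul]
    simp only [Complex.norm_natCast]
    refine div_le_div_of_nonneg_right ?_ hp.le
    calc (#Z * #J * ‖C‖ : ℝ) ≤ #Z * #J * (#Y * #I) := by gcongr
      _ = _ := by ring
  have h6 : ‖(N : ℂ)‖ ≤ ‖(N - #Z * #J * C / p : ℂ)‖ + ‖(#Z * #J * C / p : ℂ)‖ := by
    simpa using norm_add_le (N - #Z * #J * C / p : ℂ) (#Z * #J * C / p : ℂ)
  have h7 : N ≤ ‖(N : ℂ)‖ := by
    rw [Complex.norm_real]
    exact le_abs_self N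
  linarith

set_option maxHeartbeats 800000 in
/-- Among a block of integers few `n` solve `h = x * n ^ 2` with `x` in a short interval. -/
theorem card_inverse_square_block_le {S : ℝ}
    (hS : ∀ a b : ZMod p, a ≠ 0 → ‖inverseSquareSum a b‖ ≤ S) {h : ZMod p} (hh : h ≠ 0)
    {W l : ℕ} (hW0 : 0 < W) (hl0 : 0 < l) (hW : W ≤ p) (hl : l ≤ p) (M X : ℕ) (B : Finset ℕ)
    (hB : B ⊆ Ico M (M + W)) (hBn : ∀ n ∈ B, (n : ZMod p) ≠ 0)
    (hBx : ∀ n ∈ B, ∃ x ∈ Ico X (X + l), h = (x : ZMod p) * (n : ZMod p) ^ 2) :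
    (#B : ℝ) ≤ 4 * l * W / p + 4 * S := by
  classical
  have hinj : ∀ a K : ℕ, K ≤ p → ∀ x ∈ Ico a (a + K), ∀ y ∈ Ico a (a + K),
      (x : ZMod p) = y → x = y := by
    intro a K hK x hx y hy hxy
    rw [mem_Ico] at hx hy
    rw [ZMod.natCast_eq_natCast_iff] at hxy
    wlog hle : x ≤ y generalizing x y
    · exact (this y hy x hx hxy.symm (by omega)).symm
    have h1 := (Nat.modEq_iff_dvd' hle).1 hxy
    have := Nat.eq_zero_of_dvd_of_lt h1 (by omega)
    omega
  choose! x hxmem hx using hBx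
  set Y := (Ico M (M + 2 * W)).image (fun n : ℕ => (n : ZMod p)) with hY
  set I := (Ico 0 (0 + W)).image (fun n : ℕ => (n : ZMod p)) with hI
  set Z := (Ico X (X + 2 * l)).image (fun n : ℕ => (n : ZMod p)) with hZ
  set J := (Ico 0 (0 + l)).image (fun n : ℕ => (n : ZMod p)) with hJ
  have cY : (#Y : ℝ) ≤ 2 * W := by exact_mod_cast card_image_le.trans (by simp)
  have cI : (#I : ℝ) ≤ W := by exact_mod_cast card_image_le.trans (by simp)
  have cZ : (#Z : ℝ) ≤ 2 * l := by exact_mod_cast card_image_le.trans (by simp)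
  have cJ : (#J : ℝ) ≤ l := by exact_mod_cast card_image_le.trans (by simp)
  have hp : (0 : ℝ) < p := by exact_mod_cast (Fact.out : p.Prime).pos
  have hS0 : 0 ≤ S := (norm_nonneg _).trans (hS 1 0 one_ne_zero)
  have h1 := sum_indicator_inverse_square_le hS hh Y I Z J
  have h2 : (∑ u ∈ Y, ∑ i ∈ I, ∑ z ∈ Z, ∑ j ∈ J,
      (if u - i ≠ 0 ∧ z - j = h * ((u - i)⁻¹) ^ 2 then (1 : ℝ) else 0)) =
      #{t ∈ Y ×ˢ I ×ˢ Z ×ˢ J | t.1 - t.2.1 ≠ 0 ∧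
        t.2.2.1 - t.2.2.2 = h * ((t.1 - t.2.1)⁻¹) ^ 2} := by
    rw [card_filter]
    push_cast
    simp_rw [sum_product]
  have h3 : #(B ×ˢ Ico 0 (0 + W) ×ˢ Ico 0 (0 + l)) ≤
      #{t ∈ Y ×ˢ I ×ˢ Z ×ˢ J | t.1 - t.2.1 ≠ 0 ∧
        t.2.2.1 - t.2.2.2 = h * ((t.1 - t.2.1)⁻¹) ^ 2} := by
    refine card_le_card_of_injOn (fun t => (((t.1 + t.2.1 : ℕ) : ZMod p), (t.2.1 : ZMod p),
      ((x t.1 + t.2.2 : ℕ) : ZMod p), (t.2.2 : ZMod p))) ?_ ?_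
    · rintro ⟨n, i, j⟩ ht
      simp only [coe_product, Set.mem_prod, mem_coe] at ht
      obtain ⟨hn, hi, hj⟩ := ht
      have hnM := mem_Ico.1 (hB hn)
      have hxM := mem_Ico.1 (hxmem n hn)
      have hi' := mem_Ico.1 hi
      have hj' := mem_Ico.1 hj
      simp only [mem_coe, mem_filter, mem_product]
      refine ⟨⟨mem_image_of_mem _ (mem_Ico.2 ⟨by omega, by omega⟩), mem_image_of_mem _ hi,
        mem_image_of_mem _ (mem_Ico.2 ⟨by omega, by omega⟩), mem_image_of_mem _ hj⟩, ?_, ?_⟩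
      · push_cast
        rw [add_sub_cancel_right]
        exact hBn n hn
      · push_cast
        rw [add_sub_cancel_right, add_sub_cancel_right, hx n hn]
        have := hBn n hn
        field_simp
    · rintro ⟨n, i, j⟩ ht ⟨n', i', j'⟩ ht' heq
      simp only [coe_product, Set.mem_prod, mem_coe] at ht ht'
      simp only [Prod.mk.injEq] at heq
      obtain ⟨e1, e2, -, e4⟩ := heq
      push_cast at e1
      rw [e2] at e1
      have e1' := add_right_cancel e1
      rw [hinj 0 W hW i ht.2.1 i' ht'.2.1 e2, hinj 0 l hl j ht.2.2 j' ht'.2.2 e4,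
        hinj M W hW n (hB ht.1) n' (hB ht'.1) e1']
  have h4 : (#B : ℝ) * (W * l) ≤ #{t ∈ Y ×ˢ I ×ˢ Z ×ˢ J | t.1 - t.2.1 ≠ 0 ∧
        t.2.2.1 - t.2.2.2 = h * ((t.1 - t.2.1)⁻¹) ^ 2} := by
    have : #(B ×ˢ Ico 0 (0 + W) ×ˢ Ico 0 (0 + l)) = #B * (W * l) := by
      rw [card_product, card_product, Nat.card_Ico, Nat.card_Ico, Nat.zero_add, Nat.zero_add,
        Nat.sub_zero, Nat.sub_zero]
    rw [this] at h3
    exact_mod_cast h3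
  have hWl : (0 : ℝ) < W * l := by positivity
  have b1 : √((#Y : ℝ) * #I) ≤ 2 * W := by
    rw [Real.sqrt_le_left (by positivity)]
    calc (#Y : ℝ) * #I ≤ 2 * W * W := by gcongr
      _ ≤ (2 * W) ^ 2 := by linarith [sq_nonneg (W : ℝ), sq (W : ℝ), mul_pow 2 (W : ℝ) 2]
  have b2 : √((#Z : ℝ) * #J) ≤ 2 * l := by
    rw [Real.sqrt_le_left (by positivity)]
    calc (#Z : ℝ) * #J ≤ 2 * l * l := by gcongr
      _ ≤ (2 * l) ^ 2 := by linarith [sq_nonneg (l : ℝ), sq (l : ℝ), mul_pow 2 (l : ℝ) 2]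
  have b3 : (#Y * #I * #Z * #J / p : ℝ) ≤ 2 * W * W * (2 * l) * l / p := by gcongr
  have b4 : S * √((#Y : ℝ) * #I) * √((#Z : ℝ) * #J) ≤ S * (2 * W) * (2 * l) := by gcongr
  have h5 : (#B : ℝ) * (W * l) ≤ (4 * l * W / p + 4 * S) * (W * l) := by
    calc _ ≤ 2 * W * W * (2 * l) * l / p + S * (2 * W) * (2 * l) := by linarith
      _ = _ := by ring
  exact le_of_mul_le_mul_right h5 hWl

end Counting

theorem sum_Ico_one_div_le_one_add_log (N : ℕ) :
    ∑ j ∈ Ico 1 (N + 1), (1 : ℝ) / j ≤ 1 + Real.log N := by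
  have h := harmonic_le_one_add_log N
  rw [harmonic_eq_sum_Icc] at h
  push_cast at h
  simpa [one_div, Finset.Ico_add_one_right_eq_Icc] using h

theorem card_erase_zero_Icc_neg (H : ℕ) : #((Icc (-(H : ℤ)) H).erase 0) = 2 * H := by
  rw [card_erase_of_mem (by simp), Int.card_Icc]
  omega

theorem norm_inverseSquareSum_le_of_sizes {r y l : ℕ} [Fact r.Prime] (hy : 20 ≤ y)
    (hr : y ^ 100 < r) (hr' : r ≤ 4 * y ^ 100) (hl : y ^ 96 ≤ l) (a b : ZMod r) (ha : a ≠ 0) :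
    ‖inverseSquareSum a b‖ ≤ (l * (y ^ 80 : ℕ) / r : ℝ) := by
  have hr0 : (0 : ℝ) < r := by exact_mod_cast (Fact.out : r.Prime).pos
  have hyR : (20 : ℝ) ≤ y := by exact_mod_cast hy
  have hrR : (r : ℝ) ≤ 4 * y ^ 100 := by exact_mod_cast hr'
  have hlR : (y : ℝ) ^ 96 ≤ l := by exact_mod_cast hl
  have h2 : r ≠ 2 := by
    have : 20 ^ 100 ≤ y ^ 100 := Nat.pow_le_pow_left hy 100
    omega
  have h1 : (y : ℝ) ^ 76 / 4 ≤ l * (y ^ 80 : ℕ) / r := by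
    rw [div_le_div_iff₀ (by norm_num) hr0]
    push_cast
    calc (y : ℝ) ^ 76 * r ≤ (y : ℝ) ^ 76 * (4 * (y : ℝ) ^ 100) := by gcongr
      _ = (y : ℝ) ^ 96 * (y : ℝ) ^ 80 * 4 := by ring
      _ ≤ (l : ℝ) * (y : ℝ) ^ 80 * 4 := by gcongr
  refine le_trans ?_ h1
  refine le_of_pow_le_pow_left₀ (n := 4) (by norm_num) (by positivity) ?_
  refine (norm_inverseSquareSum_le h2 ha b).trans ?_
  calc 8 * (r : ℝ) ^ 3 ≤ 8 * (4 * (y : ℝ) ^ 100) ^ 3 := by gcongr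
    _ = 512 * (y : ℝ) ^ 300 := by ring
    _ ≤ (y : ℝ) ^ 4 / 256 * (y : ℝ) ^ 300 := by
      gcongr
      calc (512 : ℝ) ≤ 20 ^ 4 / 256 := by norm_num
        _ ≤ (y : ℝ) ^ 4 / 256 := by gcongr
    _ = ((y : ℝ) ^ 76 / 4) ^ 4 := by ring

/-- Few numerators `x` are approximated badly through a large `n`. -/
theorem card_bad_large_le {r y l X : ℕ} (hrp : r.Prime) (hy : 20 ≤ y)
    (hr : y ^ 100 < r) (hr' : r ≤ 4 * y ^ 100) (hl : y ^ 96 ≤ l) (hlr : l ≤ r) {κ : ℝ}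
    (hκ : 0 ≤ κ) (A : Finset ℕ) (hA : A ⊆ Ico X (X + l)) (hA0 : ∀ x ∈ A, 0 < x ∧ x < r)
    (hbad : ∀ x ∈ A, ∃ n : ℕ, y ^ 80 < n ∧ n < r ∧
      ∃ b : ℤ, |(n : ℝ) ^ 2 * x - b * r| * n < κ * r) :
    (#A : ℝ) ≤ 16 * κ * l * (1 + Real.log (4 * y ^ 20)) := by
  classical
  have := Fact.mk hrp
  have hr0 : (0 : ℝ) < r := by exact_mod_cast hrp.pos
  set W := y ^ 80 with hWdef
  have hW0 : 0 < W := by positivity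
  have hW0R : (0 : ℝ) < W := by exact_mod_cast hW0
  have hWr : W ≤ r := (Nat.pow_le_pow_right (by omega) (by norm_num)).trans hr.le
  have hl0 : 0 < l := lt_of_lt_of_le (by positivity) hl
  set H : ℕ → ℕ := fun j => ⌊κ * r / (j * W)⌋₊ with hH
  set B : ℕ → ℤ → Finset ℕ := fun j h => {n ∈ Ico (j * W) (j * W + W) | (n : ZMod r) ≠ 0 ∧
    ∃ x ∈ Ico X (X + l), (h : ZMod r) = (x : ZMod r) * (n : ZMod r) ^ 2} with hB
  have hcover : A ⊆ (Ico 1 (4 * y ^ 20 + 1)).biUnion fun j =>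
      (((Icc (-(H j : ℤ)) (H j)).erase 0).filter fun h : ℤ => (h : ZMod r) ≠ 0).biUnion fun h : ℤ =>
        (B j h).image fun n : ℕ => ((h : ZMod r) * ((n : ZMod r) ^ 2)⁻¹).val := by
    intro x hx
    obtain ⟨n, hn1, hn2, b, hb⟩ := hbad x hx
    have hn0 : 0 < n := by omega
    have hx0 := hA0 x hx
    have hnr : (n : ZMod r) ≠ 0 := by
      rw [Ne, ZMod.natCast_eq_zero_iff]
      exact Nat.not_dvd_of_pos_of_lt hn0 hn2
    have hxr : (x : ZMod r) ≠ 0 := by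
      rw [Ne, ZMod.natCast_eq_zero_iff]
      exact Nat.not_dvd_of_pos_of_lt hx0.1 hx0.2
    set h : ℤ := (n : ℤ) ^ 2 * x - b * r with hh
    have hhr : (h : ZMod r) = (x : ZMod r) * (n : ZMod r) ^ 2 := by
      rw [hh]; push_cast; simp [mul_comm]
    have hhne : (h : ZMod r) ≠ 0 := by
      rw [hhr]; exact mul_ne_zero hxr (pow_ne_zero 2 hnr)
    have hdiv := Nat.div_add_mod n W
    have hmod := Nat.mod_lt n hW0
    have hcomm : W * (n / W) = n / W * W := mul_comm _ _
    have hj1 : 1 ≤ n / W := (Nat.one_le_div_iff hW0).2 hn1.le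
    have hj2 : n / W < 4 * y ^ 20 := by
      rw [Nat.div_lt_iff_lt_mul hW0]
      calc n < 4 * y ^ 100 := by omega
        _ = 4 * y ^ 20 * W := by rw [hWdef]; ring
    have habs : |(h : ℝ)| * n < κ * r := by
      rw [hh]; push_cast; exact hb
    have hjW : ((n / W : ℕ) : ℝ) * W ≤ n := by exact_mod_cast Nat.div_mul_le_self n W
    have hH1 : h.natAbs ≤ H (n / W) := by
      rw [hH]
      refine Nat.le_floor ?_
      have hj1R : (1 : ℝ) ≤ (n / W : ℕ) := by exact_mod_cast hj1
      rw [le_div_iff₀ (by positivity), Nat.cast_natAbs, Int.cast_abs]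
      exact (mul_le_mul_of_nonneg_left hjW (abs_nonneg _)).trans habs.le
    simp only [mem_biUnion, mem_image, mem_filter, mem_erase]
    refine ⟨n / W, mem_Ico.2 ⟨hj1, by omega⟩, h, ⟨⟨?_, mem_Icc.2 (by omega)⟩, hhne⟩, n, ?_, ?_⟩
    · rintro h0
      rw [h0] at hhne
      simp at hhne
    · rw [hB, mem_filter]
      exact ⟨mem_Ico.2 (by omega), hnr, x, hA hx, hhr⟩
    · rw [hhr, mul_assoc, mul_inv_cancel₀ (pow_ne_zero 2 hnr), mul_one, ZMod.val_natCast,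
        Nat.mod_eq_of_lt hx0.2]
  have hBcard : ∀ j (h : ℤ), (h : ZMod r) ≠ 0 → (#(B j h) : ℝ) ≤ 8 * (l * W / r) := by
    intro j h hh
    have := card_inverse_square_block_le (p := r) (S := l * W / r)
      (fun a b ha => norm_inverseSquareSum_le_of_sizes hy hr hr' hl a b ha) hh hW0 hl0 hWr hlr
      (j * W) X (B j h) (filter_subset _ _) (fun n hn => (mem_filter.1 hn).2.1)
      (fun n hn => (mem_filter.1 hn).2.2)
    calc _ ≤ _ := this
      _ = _ := by ring
  have h1 : (#A : ℝ) ≤ ∑ j ∈ Ico 1 (4 * y ^ 20 + 1), (2 * (κ * r / ((j : ℕ) * W))) *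
      (8 * (l * W / r)) := by
    calc (#A : ℝ) ≤ ((∑ j ∈ Ico 1 (4 * y ^ 20 + 1),
          ∑ h ∈ ((Icc (-(H j : ℤ)) (H j)).erase 0).filter fun h : ℤ => (h : ZMod r) ≠ 0,
            #(B j h) : ℕ) : ℝ) := by
          refine Nat.cast_le.2 ((card_le_card hcover).trans ?_)
          exact card_biUnion_le.trans (sum_le_sum fun j _ =>
            card_biUnion_le.trans (sum_le_sum fun h _ => card_image_le))
      _ ≤ _ := by
          push_cast
          refine sum_le_sum fun j hj => ?_
          calc _ ≤ ∑ h ∈ ((Icc (-(H j : ℤ)) (H j)).erase 0).filter fun h : ℤ => (h : ZMod r) ≠ 0,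
                8 * (l * W / r : ℝ) :=
                sum_le_sum fun h hh => hBcard j h (mem_filter.1 hh).2
            _ ≤ (2 * H j : ℕ) * (8 * (l * W / r : ℝ)) := by
                rw [sum_const, nsmul_eq_mul]
                refine mul_le_mul_of_nonneg_right ?_ (by positivity)
                rw [← card_erase_zero_Icc_neg]
                exact_mod_cast card_filter_le _ _
            _ ≤ _ := by
                refine mul_le_mul_of_nonneg_right ?_ (by positivity)
                push_cast
                have := Nat.floor_le (show (0 : ℝ) ≤ κ * r / (j * W) by positivity)
                simp only [hH]
                linarith
  have h2 : ∑ j ∈ Ico 1 (4 * y ^ 20 + 1), (2 * (κ * r / ((j : ℕ) * W))) * (8 * (l * W / r)) =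
      16 * κ * l * ∑ j ∈ Ico 1 (4 * y ^ 20 + 1), (1 : ℝ) / (j : ℕ) := by
    rw [mul_sum]
    refine sum_congr rfl fun j hj => ?_
    have hj : (j : ℝ) ≠ 0 := by
      have := (mem_Ico.1 hj).1
      positivity
    field_simp
    ring
  rw [h2] at h1
  refine h1.trans (mul_le_mul_of_nonneg_left ?_ (by positivity))
  have := sum_Ico_one_div_le_one_add_log (4 * y ^ 20)
  push_cast at this
  exact this

theorem card_Icc_ceil_floor_le {u v : ℝ} (huv : u ≤ v) :
    (#(Icc ⌈u⌉ ⌊v⌋) : ℝ) ≤ v - u + 1 := by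
  rw [Int.card_Icc]
  have h1 := Int.floor_le v
  have h2 := Int.le_ceil u
  rcases le_total 0 (⌊v⌋ + 1 - ⌈u⌉) with h | h
  · have : ((⌊v⌋ + 1 - ⌈u⌉).toNat : ℝ) = ((⌊v⌋ + 1 - ⌈u⌉ : ℤ) : ℝ) := by
      exact_mod_cast Int.toNat_of_nonneg h
    rw [this]
    push_cast
    linarith
  · rw [Int.toNat_of_nonpos h, Nat.cast_zero]
    linarith

/-- Multiples of `θ` close to an integer, in a block no longer than the denominator. -/
theorem card_near_integer_block_le {θ ρ : ℝ} (hρ : 0 ≤ ρ) {a : ℤ} {d X : ℕ} (hd : 0 < d)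
    (hcop : IsCoprime (d : ℤ) a) (hθ : |θ * d - a| * d ≤ 1) (A : Finset ℕ)
    (hA : A ⊆ Ico X (X + d)) (hnear : ∀ x ∈ A, ∃ b : ℤ, |θ * x - b| < ρ) :
    (#A : ℝ) ≤ 2 * d * ρ + 3 := by
  have hd0 : (0 : ℝ) < d := by exact_mod_cast hd
  choose! b hb using hnear
  have h1 : #A ≤ #(Icc ⌈d * θ * X - (d * ρ + 1)⌉ ⌊d * θ * X + (d * ρ + 1)⌋) := by
    refine card_le_card_of_injOn (fun x => d * b x - a * ((x : ℤ) - X)) ?_ ?_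
    · intro x hx
      have hxI := mem_Ico.1 (hA hx)
      have e1 := abs_lt.1 (hb x hx)
      have e3 : |(θ * d - a) * ((x : ℝ) - X)| ≤ 1 := by
        rw [abs_mul]
        refine le_trans (mul_le_mul_of_nonneg_left ?_ (abs_nonneg _)) hθ
        have i1 : (X : ℝ) ≤ x := by exact_mod_cast hxI.1
        have i2 : (x : ℝ) < X + d := by exact_mod_cast hxI.2
        rw [abs_of_nonneg (by linarith)]
        linarith
      have e4 := abs_le.1 e3
      have e5 : (d : ℝ) * (θ * x - b x) < d * ρ := mul_lt_mul_of_pos_left e1.2 hd0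
      have e6 : (d : ℝ) * (-ρ) < d * (θ * x - b x) := mul_lt_mul_of_pos_left e1.1 hd0
      simp only [coe_Icc, Set.mem_Icc]
      refine ⟨Int.ceil_le.2 ?_, Int.le_floor.2 ?_⟩ <;> push_cast <;> nlinarith
    · intro x hx z hz hxz
      have hxI := mem_Ico.1 (hA hx)
      have hzI := mem_Ico.1 (hA hz)
      have e : (d : ℤ) ∣ a * ((x : ℤ) - z) := ⟨b x - b z, by
        simp only at hxz
        linear_combination -hxz⟩
      have e2 := hcop.dvd_of_dvd_mul_left e
      have e3 := Int.eq_zero_of_abs_lt_dvd e2 (by rw [abs_lt]; omega)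
      omega
  have h2 := card_Icc_ceil_floor_le (u := d * θ * X - (d * ρ + 1)) (v := d * θ * X + (d * ρ + 1))
    (by nlinarith)
  have h3 : (#A : ℝ) ≤ #(Icc ⌈d * θ * X - (d * ρ + 1)⌉ ⌊d * θ * X + (d * ρ + 1)⌋) := by
    exact_mod_cast h1
  linarith

/-- Multiples of `θ` close to an integer, in terms of a Dirichlet approximation. -/
theorem card_near_integer_le {θ ρ : ℝ} (hρ : 0 ≤ ρ) {a : ℤ} {d l X : ℕ} (hd : 0 < d)
    (hdl : d ≤ l) (hcop : IsCoprime (d : ℤ) a) (hθ : |θ * d - a| ≤ 1 / (l + 1)) (A : Finset ℕ)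
    (hA : A ⊆ Ico X (X + l)) (hnear : ∀ x ∈ A, ∃ b : ℤ, |θ * x - b| < ρ) :
    (#A : ℝ) ≤ 4 * l * ρ + 6 * l / d := by
  have hd0 : (0 : ℝ) < d := by exact_mod_cast hd
  have hdlR : (d : ℝ) ≤ l := by exact_mod_cast hdl
  have hθ' : |θ * d - a| * d ≤ 1 := by
    calc |θ * d - a| * d ≤ 1 / (l + 1) * (l + 1) := by
          gcongr
          linarith
      _ = 1 := by field_simp
  have hcover : A ⊆ (range (l / d + 1)).biUnion fun t => A ∩ Ico (X + t * d) (X + t * d + d) := by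
    intro x hx
    have hxI := mem_Ico.1 (hA hx)
    have h1 := Nat.div_add_mod (x - X) d
    have h2 := Nat.mod_lt (x - X) hd
    have h3 : (x - X) / d ≤ l / d := Nat.div_le_div_right (by omega)
    have h4 : d * ((x - X) / d) = (x - X) / d * d := mul_comm _ _
    exact mem_biUnion.2 ⟨(x - X) / d, mem_range.2 (by omega),
      mem_inter.2 ⟨hx, mem_Ico.2 (by omega)⟩⟩
  have h1 : (#A : ℝ) ≤ ∑ t ∈ range (l / d + 1), (2 * d * ρ + 3) := by
    calc (#A : ℝ) ≤ ((∑ t ∈ range (l / d + 1), #(A ∩ Ico (X + t * d) (X + t * d + d)) : ℕ) : ℝ) :=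
          Nat.cast_le.2 ((card_le_card hcover).trans card_biUnion_le)
      _ ≤ _ := by
          push_cast
          exact sum_le_sum fun t _ => card_near_integer_block_le hρ hd hcop hθ' _
            inter_subset_right fun x hx => hnear x (mem_inter.1 hx).1
  rw [sum_const, card_range, nsmul_eq_mul] at h1
  have h2 : ((l / d + 1 : ℕ) : ℝ) ≤ 2 * (l / d) := by
    push_cast
    have h3 : ((l / d : ℕ) : ℝ) ≤ l / d := Nat.cast_div_le
    have h4 : (1 : ℝ) ≤ l / d := by rwa [one_le_div hd0]
    linarith
  calc (#A : ℝ) ≤ 2 * (l / d) * (2 * d * ρ + 3) := h1.trans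
        (mul_le_mul_of_nonneg_right h2 (by positivity))
    _ = _ := by field_simp; ring

theorem card_primes_dvd_le_two {Q N : ℕ} (hN : 0 < N) (hNQ : N < Q ^ 3) (P : Finset ℕ)
    (hP : ∀ r ∈ P, r.Prime ∧ Q < r) (hdvd : ∀ r ∈ P, r ∣ N) : #P ≤ 2 := by
  by_contra! h
  have h1 : ∏ r ∈ P, r ∣ N := Finset.prod_primes_dvd N (fun r hr => (hP r hr).1.prime) hdvd
  have h2 : Q ^ #P ≤ ∏ r ∈ P, r := by
    rw [← prod_const]
    exact prod_le_prod' fun r hr => (hP r hr).2.le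
  have hQ : 0 < Q := by
    rcases Nat.eq_zero_or_pos Q with rfl | h0
    · simp at hNQ
    · exact h0
  have h3 : Q ^ 3 ≤ Q ^ #P := Nat.pow_le_pow_right hQ h
  have h4 := Nat.le_of_dvd hN h1
  omega

/-- Few primes `r` make `m / r` very close to an integer. -/
theorem card_primes_near_integer_le {Q K m : ℕ} (hKm : K < m) (hmQ : m + K < Q ^ 3)
    {ε : ℝ} (P : Finset ℕ) (hP : ∀ r ∈ P, r.Prime ∧ Q < r) (hε : ∀ r ∈ P, ε * r ≤ K)
    (hnear : ∀ r ∈ P, ∃ a : ℤ, |(m : ℝ) / r - a| ≤ ε) : #P ≤ 2 * (2 * K + 1) := by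
  classical
  choose! a ha using hnear
  have hcover : P ⊆ (Icc (-(K : ℤ)) K).biUnion fun k => {r ∈ P | (m : ℤ) - a r * r = k} := by
    intro r hr
    refine mem_biUnion.2 ⟨(m : ℤ) - a r * r, ?_, mem_filter.2 ⟨hr, rfl⟩⟩
    have hr0 : (0 : ℝ) < r := by exact_mod_cast (hP r hr).1.pos
    have h1 : |(m : ℝ) - a r * r| ≤ K := by
      have : (m : ℝ) - a r * r = (m / r - a r) * r := by field_simp
      rw [this, abs_mul, abs_of_pos hr0]
      exact (mul_le_mul_of_nonneg_right (ha r hr) hr0.le).trans (hε r hr)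
    rw [mem_Icc, ← abs_le]
    exact_mod_cast h1
  calc #P ≤ ∑ k ∈ Icc (-(K : ℤ)) K, #{r ∈ P | (m : ℤ) - a r * r = k} :=
        (card_le_card hcover).trans card_biUnion_le
    _ ≤ ∑ k ∈ Icc (-(K : ℤ)) K, 2 := by
        refine sum_le_sum fun k hk => ?_
        rw [mem_Icc] at hk
        refine card_primes_dvd_le_two (Q := Q) (N := ((m : ℤ) - k).toNat) (by omega) ?_ _
          (fun r hr => hP r (mem_filter.1 hr).1) ?_
        · have : ((m : ℤ) - k).toNat ≤ m + K := by omega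
          omega
        · intro r hr
          have h1 := (mem_filter.1 hr).2
          have h2 : (((m : ℤ) - k).toNat : ℤ) = a r * r := by
            rw [Int.toNat_of_nonneg (by omega)]
            omega
          rw [← Int.natCast_dvd_natCast, h2]
          exact dvd_mul_left _ _
    _ = 2 * (2 * K + 1) := by
        rw [sum_const, Int.card_Icc, smul_eq_mul]
        have : ((K : ℤ) + 1 - -(K : ℤ)).toNat = 2 * K + 1 := by omega
        rw [this, mul_comm]

theorem sum_inv_den_le {y l n : ℕ} (hy : 20 ≤ y) (hl : y ^ 96 ≤ l) (hl' : l ≤ y ^ 100)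
    (hn : y ^ 25 < n) (hn' : n ≤ y ^ 80) (P : Finset ℕ)
    (hP : ∀ r ∈ P, r.Prime ∧ y ^ 100 < r) (hP' : ∀ r ∈ P, r ≤ 4 * y ^ 100) (c : ℕ → ℚ)
    (hcl : ∀ r ∈ P, (c r).den ≤ l)
    (hc : ∀ r ∈ P, |(n : ℝ) ^ 2 / r * (c r).den - (c r).num| ≤ 1 / (l + 1)) :
    ∑ r ∈ P, (1 : ℝ) / (c r).den ≤ 2 * (2 * (4 * y ^ 4) + 1) * (1 + Real.log l) := by
  have hK : ∀ d ∈ Ico 1 (l + 1), #{r ∈ P | (c r).den = d} ≤ 2 * (2 * (4 * y ^ 4) + 1) := by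
    intro d hd
    rw [mem_Ico] at hd
    refine card_primes_near_integer_le (Q := y ^ 100) (m := n ^ 2 * d) (ε := 1 / (l + 1)) ?_ ?_ _
      (fun r hr => hP r (mem_filter.1 hr).1) ?_ ?_
    · calc 4 * y ^ 4 ≤ y ^ 21 * y ^ 4 := by
            refine Nat.mul_le_mul_right _ ?_
            calc 4 ≤ y ^ 1 := by rw [pow_one]; omega
              _ ≤ y ^ 21 := Nat.pow_le_pow_right (by omega) (by norm_num)
        _ = y ^ 25 := by ring
        _ < n := hn
        _ = n * 1 * 1 := by ring
        _ ≤ n * n * d := by gcongr <;> omega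
        _ = n ^ 2 * d := by ring
    · calc n ^ 2 * d + 4 * y ^ 4 ≤ (y ^ 80) ^ 2 * y ^ 100 + y ^ 260 := by
            gcongr
            · omega
            · calc 4 * y ^ 4 ≤ y ^ 256 * y ^ 4 := by
                    refine Nat.mul_le_mul_right _ ?_
                    calc 4 ≤ y ^ 1 := by rw [pow_one]; omega
                      _ ≤ y ^ 256 := Nat.pow_le_pow_right (by omega) (by norm_num)
                _ = y ^ 260 := by ring
        _ = 2 * y ^ 260 := by ring
        _ < y ^ 40 * y ^ 260 := by
            refine Nat.mul_lt_mul_of_pos_right ?_ (by positivity)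
            calc 2 < y ^ 1 := by rw [pow_one]; omega
              _ ≤ y ^ 40 := Nat.pow_le_pow_right (by omega) (by norm_num)
        _ = (y ^ 100) ^ 3 := by ring
    · intro r hr
      have h1 : (r : ℝ) ≤ 4 * y ^ 100 := by exact_mod_cast hP' r (mem_filter.1 hr).1
      have h2 : (y : ℝ) ^ 96 ≤ l := by exact_mod_cast hl
      push_cast
      rw [one_div_mul_eq_div, div_le_iff₀ (by positivity)]
      calc (r : ℝ) ≤ 4 * (y : ℝ) ^ 4 * (y : ℝ) ^ 96 := by rw [mul_assoc, ← pow_add]; exact h1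
        _ ≤ 4 * (y : ℝ) ^ 4 * (l + 1) := by gcongr; linarith
    · intro r hr
      obtain ⟨hrP, rfl⟩ := mem_filter.1 hr
      refine ⟨(c r).num, ?_⟩
      have := hc r hrP
      push_cast
      rwa [div_mul_eq_mul_div] at this
  have hmaps : ∀ r ∈ P, (c r).den ∈ Ico 1 (l + 1) := fun r hr =>
    mem_Ico.2 ⟨(c r).pos, Nat.lt_succ_of_le (hcl r hr)⟩
  rw [← sum_fiberwise_of_maps_to hmaps]
  calc _ ≤ ∑ d ∈ Ico 1 (l + 1), (2 * (2 * (4 * y ^ 4) + 1) : ℝ) * (1 / d) := by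
        refine sum_le_sum fun d hd => ?_
        rw [sum_congr rfl fun r hr => by rw [(mem_filter.1 hr).2], sum_const, nsmul_eq_mul]
        refine mul_le_mul_of_nonneg_right ?_ (by positivity)
        exact_mod_cast hK d hd
    _ ≤ _ := by
        rw [← mul_sum]
        exact mul_le_mul_of_nonneg_left (sum_Ico_one_div_le_one_add_log l) (by positivity)

/-- Few pairs `(x, r)` are approximated badly through `n` of medium size, on average over
primes `r`. -/
theorem sum_card_bad_middle_le {y l : ℕ} (hy : 20 ≤ y) (hl : y ^ 96 ≤ l) (hl' : l ≤ y ^ 100)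
    (P : Finset ℕ) (hP : ∀ r ∈ P, r.Prime ∧ y ^ 100 < r) (hP' : ∀ r ∈ P, r ≤ 4 * y ^ 100)
    {κ : ℝ} (hκ : 0 ≤ κ) (X : ℕ → ℕ) (A : ℕ → Finset ℕ)
    (hA : ∀ r ∈ P, A r ⊆ Ico (X r) (X r + l))
    (hbad : ∀ r ∈ P, ∀ x ∈ A r, ∃ n : ℕ, y ^ 25 < n ∧ n ≤ y ^ 80 ∧
      ∃ b : ℤ, |(n : ℝ) ^ 2 * x - b * r| * n < κ * r) :
    ∑ r ∈ P, (#(A r) : ℝ) ≤ #P * (4 * κ * l * (1 + Real.log (y ^ 80))) +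
      6 * l * y ^ 80 * (2 * (2 * (4 * y ^ 4) + 1) * (1 + Real.log l)) := by
  classical
  have hl0 : 0 < l := lt_of_lt_of_le (by positivity) hl
  choose c hc hcl using fun r n : ℕ =>
    Real.exists_rat_abs_sub_le_and_den_le ((n : ℝ) ^ 2 / r) hl0
  have hc' : ∀ r n : ℕ, |(n : ℝ) ^ 2 / r * (c r n).den - (c r n).num| ≤ 1 / (l + 1) := by
    intro r n
    have hd : (0 : ℝ) < (c r n).den := by exact_mod_cast (c r n).pos
    have e : (n : ℝ) ^ 2 / r * (c r n).den - (c r n).num =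
        ((n : ℝ) ^ 2 / r - c r n) * (c r n).den := by
      rw [sub_mul, Rat.cast_def, div_mul_cancel₀ _ hd.ne']
    rw [e, abs_mul, abs_of_pos hd]
    calc _ ≤ 1 / ((l + 1) * ((c r n).den : ℝ)) * (c r n).den := by gcongr; exact hc r n
      _ = _ := by field_simp
  have h1 : ∀ r ∈ P, (#(A r) : ℝ) ≤
      ∑ n ∈ Ioc (y ^ 25) (y ^ 80), (4 * l * (κ / n) + 6 * l / (c r n).den) := by
    intro r hr
    have hr0 : (0 : ℝ) < r := by exact_mod_cast (hP r hr).1.pos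
    have hcover : A r ⊆ (Ioc (y ^ 25) (y ^ 80)).biUnion fun n =>
        {x ∈ A r | ∃ b : ℤ, |(n : ℝ) ^ 2 / r * x - b| < κ / n} := by
      intro x hx
      obtain ⟨n, hn1, hn2, b, hb⟩ := hbad r hr x hx
      have hn0 : (0 : ℝ) < n := by exact_mod_cast (Nat.zero_le _).trans_lt hn1
      refine mem_biUnion.2 ⟨n, mem_Ioc.2 ⟨hn1, hn2⟩, mem_filter.2 ⟨hx, b, ?_⟩⟩
      have e : (n : ℝ) ^ 2 / r * x - b = ((n : ℝ) ^ 2 * x - b * r) / r := by field_simp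
      rw [e, abs_div, abs_of_pos hr0, div_lt_div_iff₀ hr0 hn0]
      exact hb
    calc (#(A r) : ℝ) ≤ ((∑ n ∈ Ioc (y ^ 25) (y ^ 80),
          #{x ∈ A r | ∃ b : ℤ, |(n : ℝ) ^ 2 / r * (x : ℕ) - b| < κ / n} : ℕ) : ℝ) :=
          Nat.cast_le.2 ((card_le_card hcover).trans card_biUnion_le)
      _ ≤ _ := by
          push_cast
          refine sum_le_sum fun n hn => ?_
          exact card_near_integer_le (by positivity) (c r n).pos (hcl r n)
            (Rat.isCoprime_num_den _).symm (hc' r n) _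
            ((filter_subset _ _).trans (hA r hr)) fun x hx => (mem_filter.1 hx).2
  have hharm : ∑ n ∈ Ioc (y ^ 25) (y ^ 80), (1 : ℝ) / n ≤ 1 + Real.log (y ^ 80) := by
    have h2 := sum_Ico_one_div_le_one_add_log (y ^ 80)
    push_cast at h2
    refine le_trans (sum_le_sum_of_subset_of_nonneg ?_ fun _ _ _ => by positivity) h2
    intro n hn
    rw [mem_Ioc] at hn
    rw [mem_Ico]
    omega
  calc ∑ r ∈ P, (#(A r) : ℝ) ≤ ∑ r ∈ P, ∑ n ∈ Ioc (y ^ 25) (y ^ 80),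
        (4 * l * (κ / n) + 6 * l / (c r n).den) := sum_le_sum h1
    _ = ∑ r ∈ P, 4 * κ * l * ∑ n ∈ Ioc (y ^ 25) (y ^ 80), (1 : ℝ) / n +
        6 * l * ∑ n ∈ Ioc (y ^ 25) (y ^ 80), ∑ r ∈ P, (1 : ℝ) / (c r n).den := by
        simp_rw [sum_add_distrib]
        congr 1
        · refine sum_congr rfl fun r _ => ?_
          rw [mul_sum]
          exact sum_congr rfl fun n _ => by ring
        · rw [sum_comm, mul_sum]
          refine sum_congr rfl fun n _ => ?_
          rw [mul_sum]
          exact sum_congr rfl fun r _ => by ring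
    _ ≤ _ := by
        refine add_le_add ?_ ?_
        · rw [sum_const, nsmul_eq_mul]
          gcongr
        · rw [mul_assoc (6 * (l : ℝ))]
          refine mul_le_mul_of_nonneg_left ?_ (by positivity)
          have h3 : ∀ n ∈ Ioc (y ^ 25) (y ^ 80), ∑ r ∈ P, (1 : ℝ) / (c r n).den ≤
              2 * (2 * (4 * y ^ 4) + 1) * (1 + Real.log l) := fun n hn =>
            sum_inv_den_le hy hl hl' (mem_Ioc.1 hn).1 (mem_Ioc.1 hn).2 P hP hP' (fun r => c r n)
              (fun r _ => hcl r n) fun r _ => hc' r n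
          refine (sum_le_sum h3).trans ?_
          rw [sum_const, nsmul_eq_mul, Nat.card_Ioc]
          refine mul_le_mul_of_nonneg_right ?_ ?_
          · exact_mod_cast Nat.sub_le _ _
          · have : 0 ≤ Real.log l := Real.log_natCast_nonneg l
            positivity

theorem card_square_residue_block_le {q p j : ℕ} (hq : q.Prime) (hpq : ¬ q ∣ p) (h : ℤ)
    (N : Finset ℕ) (hN : N ⊆ Ico (j * q) (j * q + q))
    (hsol : ∀ n ∈ N, ∃ b : ℤ, b * q - p * (n : ℤ) ^ 2 = h) : #N ≤ 2 := by
  classical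
  have := Fact.mk hq
  rcases N.eq_empty_or_nonempty with rfl | ⟨n₀, hn₀⟩
  · simp
  have hp0 : (p : ZMod q) ≠ 0 := by rwa [Ne, ZMod.natCast_eq_zero_iff]
  have hred : ∀ n ∈ N, -(p : ZMod q) * (n : ZMod q) ^ 2 = h := by
    intro n hn
    obtain ⟨b, rfl⟩ := hsol n hn
    simp
  calc #N ≤ #({(n₀ : ZMod q), -(n₀ : ZMod q)} : Finset (ZMod q)) := by
        refine card_le_card_of_injOn (fun n : ℕ => (n : ZMod q)) ?_ ?_
        · intro n hn
          have h1 := mul_left_cancel₀ (neg_ne_zero.2 hp0) ((hred n hn).trans (hred n₀ hn₀).symm)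
          simpa using sq_eq_sq_iff_eq_or_eq_neg.1 h1
        · intro m hm n hn hmn
          have hm' := mem_Ico.1 (hN hm)
          have hn' := mem_Ico.1 (hN hn)
          simp only at hmn
          rw [ZMod.natCast_eq_natCast_iff'] at hmn
          have e1 : m = q * j + (m - j * q) := by rw [mul_comm q j]; omega
          have e2 : n = q * j + (n - j * q) := by rw [mul_comm q j]; omega
          rw [e1, e2, Nat.mul_add_mod, Nat.mul_add_mod, Nat.mod_eq_of_lt (by omega),
            Nat.mod_eq_of_lt (by omega)] at hmn
          omega
    _ ≤ 2 := card_le_two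

theorem card_near_fraction_le {n r : ℕ} (hn : 0 < n) (hr : 0 < r) {κ : ℝ}
    (hκ : (n : ℝ) ^ 3 ≤ κ * r) (b : ℤ) (T : Finset ℕ)
    (hT : ∀ x ∈ T, |(n : ℝ) ^ 2 * x - b * r| * n < κ * r) :
    (#T : ℝ) ≤ 3 * (κ * r / n ^ 3) := by
  have hn0 : (0 : ℝ) < n := by exact_mod_cast hn
  have hr0 : (0 : ℝ) < r := by exact_mod_cast hr
  have h1 : #T ≤ #(Icc ⌈b * r / (n : ℝ) ^ 2 - κ * r / n ^ 3⌉
      ⌊b * r / (n : ℝ) ^ 2 + κ * r / n ^ 3⌋) := by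
    refine card_le_card_of_injOn (fun x : ℕ => (x : ℤ)) ?_ (fun x _ z _ h => by simpa using h)
    intro x hx
    have h2 : |(x : ℝ) - b * r / (n : ℝ) ^ 2| ≤ κ * r / n ^ 3 := by
      have e : (x : ℝ) - b * r / (n : ℝ) ^ 2 = ((n : ℝ) ^ 2 * x - b * r) * n / n ^ 3 := by
        field_simp
      rw [e, abs_div, abs_mul, abs_of_pos hn0, abs_of_pos (pow_pos hn0 3)]
      exact div_le_div_of_nonneg_right (hT x hx).le (by positivity)
    have h3 := abs_le.1 h2
    simp only [coe_Icc, Set.mem_Icc]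
    refine ⟨Int.ceil_le.2 ?_, Int.le_floor.2 ?_⟩ <;> push_cast <;> linarith
  have hpos : 1 ≤ κ * r / n ^ 3 := by rwa [one_le_div (pow_pos hn0 3)]
  have h2 := card_Icc_ceil_floor_le (u := b * r / (n : ℝ) ^ 2 - κ * r / n ^ 3)
    (v := b * r / (n : ℝ) ^ 2 + κ * r / n ^ 3) (by linarith)
  have h3 : (#T : ℝ) ≤ #(Icc ⌈b * r / (n : ℝ) ^ 2 - κ * r / n ^ 3⌉
      ⌊b * r / (n : ℝ) ^ 2 + κ * r / n ^ 3⌋) := by exact_mod_cast h1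
  linarith

/-- Few numerators `x` are approximated badly through a small `n`. -/
theorem card_bad_small_le {q p r M : ℕ} (hq : q.Prime) (hpq : ¬ q ∣ p) (hr : 0 < r) {δ κ : ℝ}
    (hδ : 0 < δ) (hκδ : 2 * κ ≤ δ * q ^ 3) (hκ : (M : ℝ) ^ 3 ≤ κ * r) (A : Finset ℕ)
    (hA : ∀ x ∈ A, (p / q : ℝ) + δ ≤ x / r ∧ (x / r : ℝ) ≤ p / q + 3 / 2 * δ)
    (hbad : ∀ x ∈ A, ∃ n : ℕ, q ≤ n ∧ n ≤ M ∧
      ∃ b : ℤ, |(n : ℝ) ^ 2 * x - b * r| * n < κ * r) :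
    (#A : ℝ) ≤ 48 * δ * κ * r * (1 + Real.log M) := by
  classical
  have hq0 : (0 : ℝ) < q := by exact_mod_cast hq.pos
  have hr0 : (0 : ℝ) < r := by exact_mod_cast hr
  have hκ0 : 0 ≤ κ * r := le_trans (by positivity) hκ
  set H : ℕ → ℕ := fun j => ⌊8 * δ * j ^ 2 * q ^ 3⌋₊ with hH
  set N : ℕ → ℤ → Finset ℕ := fun j h => {n ∈ Ico (j * q) (j * q + q) | n ≤ M ∧
    ∃ b : ℤ, b * q - p * (n : ℤ) ^ 2 = h} with hN
  set T : ℕ → ℤ → Finset ℕ := fun n h => {x ∈ A | ∃ b : ℤ, b * q - p * (n : ℤ) ^ 2 = h ∧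
    |(n : ℝ) ^ 2 * x - b * r| * n < κ * r} with hT
  have hcover : A ⊆ (Ico 1 (M + 1)).biUnion fun j : ℕ => (Icc 1 (H j)).biUnion fun h : ℕ =>
      (N j h).biUnion fun n => T n h := by
    intro x hx
    obtain ⟨n, hn1, hn2, b, hb⟩ := hbad x hx
    obtain ⟨hx1, hx2⟩ := hA x hx
    have hn0N : 0 < n := hq.pos.trans_le hn1
    have hn0 : (0 : ℝ) < n := by exact_mod_cast hn0N
    have hqn : (q : ℝ) ≤ n := by exact_mod_cast hn1
    have h1 : |(x / r : ℝ) - b / n ^ 2| < δ / 2 := by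
      have e : (x / r : ℝ) - b / n ^ 2 = ((n : ℝ) ^ 2 * x - b * r) * n / (r * n ^ 3) := by
        field_simp
      rw [e, abs_div, abs_mul, abs_of_pos hn0, abs_of_pos (mul_pos hr0 (pow_pos hn0 3)),
        div_lt_iff₀ (by positivity)]
      calc _ < κ * r := hb
        _ ≤ δ / 2 * q ^ 3 * r := by
          refine mul_le_mul_of_nonneg_right ?_ hr0.le
          linarith
        _ ≤ δ / 2 * (r * n ^ 3) := by
          rw [mul_assoc, mul_comm ((q : ℝ) ^ 3)]
          gcongr
    obtain ⟨h2, h3⟩ := abs_lt.1 h1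
    have h4 : δ / 2 < (b : ℝ) / n ^ 2 - p / q := by linarith
    have h5 : (b : ℝ) / n ^ 2 - p / q < 2 * δ := by linarith
    have e : (b : ℝ) / n ^ 2 - p / q = (b * q - p * n ^ 2) / (q * n ^ 2) := by field_simp
    rw [e] at h4 h5
    rw [div_lt_iff₀ (by positivity)] at h5
    have h6 : (0 : ℝ) < b * q - p * n ^ 2 := by
      have := (by linarith : (0 : ℝ) < (b * q - p * n ^ 2) / (q * n ^ 2))
      exact (div_pos_iff_of_pos_right (by positivity)).1 this
    have h7 : 0 < b * q - p * (n : ℤ) ^ 2 := by exact_mod_cast h6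
    obtain ⟨h, hh⟩ := Int.eq_ofNat_of_zero_le h7.le
    have hhR : (b : ℝ) * q - p * n ^ 2 = h := by exact_mod_cast hh
    have hdiv := Nat.div_add_mod n q
    have hmod := Nat.mod_lt n hq.pos
    have hcomm : q * (n / q) = n / q * q := mul_comm _ _
    have hj1 : 1 ≤ n / q := (Nat.one_le_div_iff hq.pos).2 hn1
    have hj2 : n / q ≤ M := (Nat.div_le_self n q).trans hn2
    have hnj : (n : ℝ) ≤ 2 * (n / q : ℕ) * q := by
      have : n ≤ 2 * (n / q) * q := by
        have : q ≤ n / q * q := Nat.le_mul_of_pos_left q hj1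
        have e : 2 * (n / q) * q = n / q * q + n / q * q := by ring
        omega
      exact_mod_cast this
    simp only [mem_biUnion]
    refine ⟨n / q, mem_Ico.2 ⟨hj1, by omega⟩, h, mem_Icc.2 ⟨by omega, ?_⟩, n,
      mem_filter.2 ⟨mem_Ico.2 (by omega), hn2, b, hh⟩, mem_filter.2 ⟨hx, b, hh, hb⟩⟩
    refine Nat.le_floor ?_
    rw [← hhR]
    refine h5.le.trans ?_
    calc 2 * δ * (q * (n : ℝ) ^ 2) ≤ 2 * δ * (q * (2 * (n / q : ℕ) * q) ^ 2) := by gcongr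
      _ = _ := by ring
  have hTcard : ∀ j ∈ Ico 1 (M + 1), ∀ h : ℕ, ∀ n ∈ N j h,
      (#(T n h) : ℝ) ≤ 3 * (κ * r / (j * q) ^ 3) := by
    intro j hj h n hn
    have hj0 : (0 : ℝ) < j := by exact_mod_cast (mem_Ico.1 hj).1
    obtain ⟨hnI, hnM, b, hb⟩ := mem_filter.1 hn
    have hjn : ((j : ℝ) * q) ≤ n := by exact_mod_cast (mem_Ico.1 hnI).1
    have hn0 : (0 : ℝ) < n := lt_of_lt_of_le (by positivity) hjn
    have hnMR : (n : ℝ) ≤ M := by exact_mod_cast hnM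
    have hb' : ∀ b' : ℤ, b' * q - p * (n : ℤ) ^ 2 = h → b' = b := by
      intro b' h'
      have : b' * q = b * q := by linarith
      exact mul_right_cancel₀ (by exact_mod_cast hq.ne_zero) this
    refine (card_near_fraction_le (by exact_mod_cast hn0) hr (κ := κ) ?_ b (T n h) ?_).trans ?_
    · exact (by gcongr : (n : ℝ) ^ 3 ≤ (M : ℝ) ^ 3).trans hκ
    · intro x hx
      obtain ⟨-, b', hb1, hb2⟩ := mem_filter.1 hx
      rwa [hb' b' hb1] at hb2
    · gcongr
  calc (#A : ℝ) ≤ ((∑ j ∈ Ico 1 (M + 1), ∑ h ∈ Icc 1 (H j), ∑ n ∈ N j h, #(T n h) : ℕ) : ℝ) := by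
        refine Nat.cast_le.2 ((card_le_card hcover).trans ?_)
        exact card_biUnion_le.trans (sum_le_sum fun j _ =>
          card_biUnion_le.trans (sum_le_sum fun h _ => card_biUnion_le))
    _ ≤ ∑ j ∈ Ico 1 (M + 1), 48 * δ * κ * r * ((1 : ℝ) / j) := by
        push_cast
        refine sum_le_sum fun j hj => ?_
        have hj0 : (0 : ℝ) < j := by exact_mod_cast (mem_Ico.1 hj).1
        calc _ ≤ ∑ h ∈ Icc 1 (H j), 2 * (3 * (κ * r / (j * q) ^ 3)) := by
              refine sum_le_sum fun h _ => ?_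
              refine (sum_le_sum fun n hn => hTcard j hj h n hn).trans ?_
              rw [sum_const, nsmul_eq_mul]
              refine mul_le_mul_of_nonneg_right ?_ (by positivity)
              exact_mod_cast card_square_residue_block_le hq hpq h (N j h)
                (filter_subset _ _) fun n hn => (mem_filter.1 hn).2.2
          _ ≤ 8 * δ * j ^ 2 * q ^ 3 * (2 * (3 * (κ * r / (j * q) ^ 3))) := by
              rw [sum_const, nsmul_eq_mul, Nat.card_Icc, Nat.add_sub_cancel]
              refine mul_le_mul_of_nonneg_right ?_ (by positivity)
              exact Nat.floor_le (by positivity)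
          _ = _ := by field_simp; ring
    _ ≤ _ := by
        rw [← mul_sum]
        refine mul_le_mul_of_nonneg_left (sum_Ico_one_div_le_one_add_log M) ?_
        rw [mul_assoc]
        positivity

/-- A weak form of Chebyshev's theorem on primes in `(Q, 4 * Q]`. -/
theorem eventually_le_card_primes_mul_log :
    ∀ᶠ Q : ℕ in Filter.atTop,
      (Q : ℝ) ≤ #((Ioc Q (4 * Q)).filter Nat.Prime) * Real.log (4 * Q) := by
  have h1 : ∀ᶠ x : ℝ in Filter.atTop, Real.log x ≤ (1 / 100) * x ^ (1 / 2 : ℝ) := by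
    filter_upwards [(isLittleO_log_rpow_atTop (r := 1 / 2) (by norm_num)).bound
      (c := 1 / 100) (by norm_num), Filter.eventually_ge_atTop 1] with x hx hx1
    rwa [Real.norm_of_nonneg (Real.log_nonneg hx1), Real.norm_of_nonneg (by positivity)] at hx
  filter_upwards [(tendsto_natCast_atTop_atTop (R := ℝ)).eventually
      (Filter.tendsto_id.const_mul_atTop (by norm_num : (0 : ℝ) < 4) |>.eventually h1),
    Filter.eventually_ge_atTop 100] with Q hQ hQ1
  simp only [id] at hQ
  rw [← Real.sqrt_eq_rpow] at hQ
  have hQr : (100 : ℝ) ≤ Q := by exact_mod_cast hQ1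
  have hlow := Chebyshev.theta_ge (4 * Q)
  have hup := Chebyshev.theta_le_log4_mul_x (x := Q) (by positivity)
  have hlog4 : Real.log 4 = 2 * Real.log 2 := by
    rw [show (4 : ℝ) = 2 ^ 2 by norm_num, Real.log_pow]; norm_num
  have hdiff : Chebyshev.theta ((4 * Q : ℕ) : ℝ) - Chebyshev.theta Q
      = ∑ p ∈ (Ioc Q (4 * Q)).filter Nat.Prime, Real.log p := by
    rw [Chebyshev.theta, Chebyshev.theta, Nat.floor_natCast, Nat.floor_natCast, sub_eq_iff_eq_add,
      ← sum_union]
    · rw [← filter_union, union_comm, Ioc_union_Ioc_eq_Ioc (by omega) (by omega)]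
    · exact disjoint_filter_filter (disjoint_left.2 fun a ha hb => by
        simp only [mem_Ioc] at ha hb; omega)
  have hsum : ∑ p ∈ (Ioc Q (4 * Q)).filter Nat.Prime, Real.log p
      ≤ #((Ioc Q (4 * Q)).filter Nat.Prime) * Real.log (4 * Q) := by
    rw [← nsmul_eq_mul]
    refine sum_le_card_nsmul _ _ _ fun p hp => ?_
    have hp' := mem_Ioc.1 (mem_filter.1 hp).1
    have : (p : ℝ) ≤ 4 * Q := by exact_mod_cast hp'.2
    exact Real.log_le_log (by exact_mod_cast (show 0 < p by omega)) this
  have hl1 : Real.log ((4 * Q : ℕ) + 1) ≤ Real.log (4 * Q) + 1 := by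
    have : ((4 * Q : ℕ) : ℝ) + 1 ≤ 4 * Q * Real.exp 1 := by
      push_cast
      nlinarith [Real.add_one_le_exp (1 : ℝ)]
    refine (Real.log_le_log (by positivity) this).trans ?_
    rw [Real.log_mul (by positivity) (by positivity), Real.log_exp]
  have hs := Real.sq_sqrt (show (0 : ℝ) ≤ 4 * Q by positivity)
  have hs0 := Real.sqrt_nonneg (4 * Q : ℝ)
  have hs1 : (1 : ℝ) ≤ √(4 * Q) := Real.one_le_sqrt.2 (by linarith)
  have hl2 := Real.log_two_gt_d9
  push_cast at hlow hl1 hdiff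
  rw [hlog4] at hup
  have hmul : √(4 * Q : ℝ) * Real.log (4 * Q) ≤ 1 / 100 * (4 * Q) := by nlinarith
  nlinarith

theorem eventually_const_mul_log_le (C : ℝ) {ε : ℝ} (hε : 0 < ε) :
    ∀ᶠ q : ℕ in Filter.atTop, C * Real.log q ≤ (q : ℝ) ^ ε := by
  have h := (isLittleO_log_rpow_atTop hε).bound (c := 1 / (|C| + 1)) (by positivity)
  filter_upwards [(tendsto_natCast_atTop_atTop (R := ℝ)).eventually h,
    Filter.eventually_ge_atTop 1] with q hq hq1
  have h0 : 0 ≤ Real.log q := Real.log_natCast_nonneg q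
  rw [Real.norm_of_nonneg h0, Real.norm_of_nonneg (by positivity), one_div,
    inv_mul_eq_div, le_div_iff₀ (by positivity)] at hq
  nlinarith [le_abs_self C]

theorem eventually_le_mul_card_primes {m : ℕ} (hm : 0 < m) :
    ∀ᶠ q : ℕ in Filter.atTop,
      ((q ^ m : ℕ) : ℝ) ≤ q * #((Ioc (q ^ m) (4 * q ^ m)).filter Nat.Prime) := by
  filter_upwards [(Filter.tendsto_pow_atTop hm.ne').eventually eventually_le_card_primes_mul_log,
    eventually_const_mul_log_le (2 * m) one_pos, Filter.eventually_ge_atTop 4] with q hq hq1 hq4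
  refine hq.trans ?_
  rw [mul_comm]
  gcongr
  rw [Real.rpow_one] at hq1
  have : (4 : ℝ) * (q ^ m : ℕ) ≤ (q : ℝ) ^ (2 * m) := by
    have h4 : 4 ≤ q ^ m := hq4.trans (Nat.le_self_pow hm.ne' q)
    have : 4 * q ^ m ≤ q ^ (2 * m) := by rw [two_mul, pow_add]; gcongr
    exact_mod_cast this
  refine (Real.log_le_log (by positivity) this).trans ?_
  rw [Real.log_pow]
  push_cast
  exact hq1

/-- Length scale of the intervals attached to a fraction with denominator `q`. -/
noncomputable def delta (q : ℕ) : ℝ := 1 / ((q : ℝ) ^ 3 * Real.log q)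

theorem one_le_log_of_three_le {q : ℕ} (hq : 3 ≤ q) : 1 ≤ Real.log q := by
  rw [Real.le_log_iff_exp_le (by positivity)]
  have h3 : (3 : ℝ) ≤ q := by exact_mod_cast hq
  linarith [Real.exp_one_lt_d9]

theorem delta_pos {q : ℕ} (hq : 3 ≤ q) : 0 < delta q := by
  have := one_le_log_of_three_le hq
  unfold delta; positivity

theorem delta_le {q : ℕ} (hq : 3 ≤ q) : delta q ≤ 1 / (q : ℝ) ^ 3 := by
  have := one_le_log_of_three_le hq
  have hq0 : (0 : ℝ) < q := by positivity
  unfold delta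
  gcongr
  nlinarith [pow_pos hq0 3]

theorem le_delta {q : ℕ} (hq : 3 ≤ q) : 1 / (q : ℝ) ^ 4 ≤ delta q := by
  have := one_le_log_of_three_le hq
  have hq0 : (0 : ℝ) < q := by positivity
  unfold delta
  gcongr
  rw [pow_succ _ 3]
  gcongr
  exact Real.log_le_self hq0.le

theorem delta_mul_le {q : ℕ} (hq : 20 ≤ q) : delta q * q ≤ 1 / 400 := by
  have hq0 : (20 : ℝ) ≤ q := by exact_mod_cast hq
  calc delta q * q ≤ 1 / (q : ℝ) ^ 3 * q := by gcongr; exact delta_le (by omega)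
    _ = 1 / (q : ℝ) ^ 2 := by field_simp
    _ ≤ 1 / 20 ^ 2 := by gcongr
    _ = 1 / 400 := by norm_num

/-- Numerators `x` for which `x / r` lies in the first half of the interval of `p / q`. -/
noncomputable def numerators (p q r : ℕ) : Finset ℕ :=
  Icc ⌈((p : ℝ) / q + delta q) * r⌉₊ ⌊((p : ℝ) / q + 3 / 2 * delta q) * r⌋₊

theorem mem_numerators {p q r x : ℕ} (hq : 3 ≤ q) (hr : 0 < r) :
    x ∈ numerators p q r ↔
      (p : ℝ) / q + delta q ≤ x / r ∧ (x : ℝ) / r ≤ p / q + 3 / 2 * delta q := by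
  have hr0 : (0 : ℝ) < r := by exact_mod_cast hr
  have := delta_pos hq
  rw [numerators, mem_Icc, Nat.ceil_le, Nat.le_floor_iff (by positivity), le_div_iff₀ hr0,
    div_le_iff₀ hr0]

theorem le_card_numerators {p q r : ℕ} (hq : 3 ≤ q) :
    delta q / 2 * r - 1 ≤ (#(numerators p q r) : ℝ) := by
  have := delta_pos hq
  rw [numerators, Nat.card_Icc]
  have h1 := Nat.ceil_lt_add_one
    (show 0 ≤ ((p : ℝ) / q + delta q) * r by positivity)
  have h2 := Nat.lt_floor_add_one (((p : ℝ) / q + 3 / 2 * delta q) * r)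
  have h4 : ((⌊((p : ℝ) / q + 3 / 2 * delta q) * r⌋₊ + 1 : ℕ) : ℝ)
      - (⌈((p : ℝ) / q + delta q) * r⌉₊ : ℕ)
      ≤ ((⌊((p : ℝ) / q + 3 / 2 * delta q) * r⌋₊ + 1 - ⌈((p : ℝ) / q + delta q) * r⌉₊ : ℕ) : ℝ) := by
    rw [sub_le_iff_le_add]
    exact_mod_cast Nat.sub_le_iff_le_add.1 le_rfl
  push_cast at h4 ⊢
  nlinarith

/-- Some square multiple of `x / r` is too close to an integer. -/
def HasGoodSquareApprox (κ : ℝ) (q x r : ℕ) : Prop :=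
  ∃ n : ℕ, q ≤ n ∧ n < r ∧ ∃ b : ℤ, |(n : ℝ) ^ 2 * x - b * r| * n < κ * r

/-- The primes used as denominators in the next generation. -/
def denominators (Q : ℕ) : Finset ℕ := (Ioc Q (4 * Q)).filter Nat.Prime

theorem mem_denominators {Q r : ℕ} : r ∈ denominators Q ↔ (Q < r ∧ r ≤ 4 * Q) ∧ r.Prime := by
  simp [denominators]

open Classical in
/-- Numerators `x` such that no square multiple of `x / r` is too close to an integer. -/
noncomputable def goodNumerators (κ : ℝ) (p q r : ℕ) : Finset ℕ :=
  (numerators p q r).filter fun x => ¬ HasGoodSquareApprox κ q x r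

theorem mem_goodNumerators {κ : ℝ} {p q r x : ℕ} :
    x ∈ goodNumerators κ p q r ↔ x ∈ numerators p q r ∧ ¬ HasGoodSquareApprox κ q x r := by
  simp [goodNumerators]

theorem numerators_pos_lt {p q r x : ℕ} (hq : 20 ≤ q) (hp : 0 < p) (hpq : p < q) (hr : 0 < r)
    (hx : x ∈ numerators p q r) : 0 < x ∧ x < r := by
  have hr0 : (0 : ℝ) < r := by exact_mod_cast hr
  obtain ⟨h1, h2⟩ := (mem_numerators (by omega) hr).1 hx
  have hd := delta_pos (q := q) (by omega)
  have hp0 : (0 : ℝ) < p := by exact_mod_cast hp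
  have hq0 : (0 : ℝ) < q := by exact_mod_cast (show 0 < q by omega)
  constructor
  · have : (0 : ℝ) < x / r := lt_of_lt_of_le (by positivity) h1
    have := (div_pos_iff_of_pos_right hr0).1 this
    exact_mod_cast this
  · have h3 := delta_mul_le hq
    have hpq' : (p : ℝ) + 1 ≤ q := by exact_mod_cast hpq
    have : (x : ℝ) / r < 1 := by
      refine h2.trans_lt ?_
      rw [← sub_pos]
      have : (0 : ℝ) < q * (1 - (p / q + 3 / 2 * delta q)) := by
        have : (q : ℝ) * (1 - (p / q + 3 / 2 * delta q)) = q - p - 3 / 2 * (delta q * q) := by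
          field_simp
          ring
        rw [this]; linarith
      exact (pos_iff_pos_of_mul_pos this).1 hq0
    rw [div_lt_one hr0] at this
    exact_mod_cast this

set_option maxHeartbeats 1600000 in
theorem sum_card_goodNumerators_ge {p q y : ℕ} (hq : q.Prime) (hq20 : 20 ≤ q) (hp : 0 < p)
    (hpq : p < q) (hy : q ≤ y)
    (hP : ((y ^ 100 : ℕ) : ℝ) ≤ q * #(denominators (y ^ 100))) :
    #(denominators (y ^ 100)) * (delta q * (y : ℝ) ^ 100) / 6 ≤
      ∑ r ∈ denominators (y ^ 100),
        (#(goodNumerators (1 / (200000 * Real.log y)) p q r) : ℝ) := by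
  classical
  set P := denominators (y ^ 100) with hPdef
  set κ : ℝ := 1 / (200000 * Real.log y) with hκdef
  set δ := delta q with hδdef
  set Q : ℝ := (y : ℝ) ^ 100 with hQdef
  have hy20 : 20 ≤ y := hq20.trans hy
  have hyr : (20 : ℝ) ≤ y := by exact_mod_cast hy20
  have hyq : (q : ℝ) ≤ y := by exact_mod_cast hy
  have hqr : (20 : ℝ) ≤ q := by exact_mod_cast hq20
  have hL : 1 ≤ Real.log y := one_le_log_of_three_le (by omega)
  have hLy : Real.log y ≤ y := Real.log_le_self (by positivity)
  have hLq : 1 ≤ Real.log q := one_le_log_of_three_le (by omega)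
  have hLqy : Real.log q ≤ Real.log y := Real.log_le_log (by positivity) hyq
  have hκ0 : 0 < κ := by positivity
  have hκL : κ * Real.log y = 1 / 200000 := by rw [hκdef]; field_simp
  have hκ1 : κ ≤ 1 / 200000 := by
    rw [hκdef]; gcongr; linarith
  have hδ : 0 < δ := delta_pos (by omega)
  have hδ1 : δ ≤ 1 / 8000 := by
    refine (delta_le (by omega)).trans ?_
    calc 1 / (q : ℝ) ^ 3 ≤ 1 / 20 ^ 3 := by gcongr
      _ = _ := by norm_num
  have hδQ : (y : ℝ) ^ 96 ≤ δ * Q := by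
    calc (y : ℝ) ^ 96 = 1 / (y : ℝ) ^ 4 * (y : ℝ) ^ 100 := by field_simp
      _ ≤ 1 / (q : ℝ) ^ 4 * (y : ℝ) ^ 100 := by gcongr
      _ ≤ δ * Q := by gcongr; exact le_delta (by omega)
  have hy96 : (20 : ℝ) ^ 96 ≤ (y : ℝ) ^ 96 := by gcongr
  have hbig : (1000 : ℝ) ≤ δ * Q := le_trans (by norm_num) (hy96.trans hδQ)
  set l : ℕ := ⌈2 * δ * Q⌉₊ + 1 with hldef
  have hl1 : 2 * δ * Q + 1 ≤ l := by
    rw [hldef]; push_cast; linarith [Nat.le_ceil (2 * δ * Q)]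
  have hl2 : (l : ℝ) ≤ 3 * (δ * Q) := by
    rw [hldef]; push_cast
    linarith [Nat.ceil_lt_add_one (show 0 ≤ 2 * δ * Q by positivity)]
  have hl96 : y ^ 96 ≤ l := by
    have : (y : ℝ) ^ 96 ≤ l := by linarith
    exact_mod_cast this
  have hQ0 : 0 < Q := by positivity
  have hl100 : l ≤ y ^ 100 := by
    have : (l : ℝ) ≤ (y : ℝ) ^ 100 := by rw [← hQdef]; nlinarith
    exact_mod_cast this
  have hPm : ∀ r ∈ P, (y ^ 100 < r ∧ r ≤ 4 * y ^ 100) ∧ r.Prime := fun r hr => mem_denominators.1 hr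
  set X : ℕ → ℕ := fun r => ⌈((p : ℝ) / q + δ) * r⌉₊ with hX
  have hnum : ∀ r ∈ P, numerators p q r ⊆ Ico (X r) (X r + l) := by
    intro r hr x hx
    have hr4 : (r : ℝ) ≤ 4 * Q := by rw [hQdef]; exact_mod_cast (hPm r hr).1.2
    rw [numerators, mem_Icc] at hx
    refine mem_Ico.2 ⟨hx.1, ?_⟩
    have h2 := (Nat.le_floor_iff (by positivity)).1 hx.2
    have h1 : ((p : ℝ) / q + δ) * r ≤ X r := Nat.le_ceil _
    have : (x : ℝ) < X r + l := by nlinarith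
    exact_mod_cast this
  set Bs : ℕ → Finset ℕ := fun r => (numerators p q r).filter fun x =>
    ∃ n : ℕ, q ≤ n ∧ n ≤ y ^ 25 ∧ ∃ b : ℤ, |(n : ℝ) ^ 2 * x - b * r| * n < κ * r with hBs
  set Bm : ℕ → Finset ℕ := fun r => (numerators p q r).filter fun x =>
    ∃ n : ℕ, y ^ 25 < n ∧ n ≤ y ^ 80 ∧ ∃ b : ℤ, |(n : ℝ) ^ 2 * x - b * r| * n < κ * r with hBm
  set Bl : ℕ → Finset ℕ := fun r => (numerators p q r).filter fun x =>
    ∃ n : ℕ, y ^ 80 < n ∧ n < r ∧ ∃ b : ℤ, |(n : ℝ) ^ 2 * x - b * r| * n < κ * r with hBl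
  have hcover : ∀ r, numerators p q r ⊆ goodNumerators κ p q r ∪ (Bs r ∪ (Bm r ∪ Bl r)) := by
    intro r x hx
    by_cases hb : HasGoodSquareApprox κ q x r
    · obtain ⟨n, hn1, hn2, hb⟩ := hb
      simp only [hBs, hBm, hBl, mem_union, mem_filter]
      right
      rcases le_or_gt n (y ^ 25) with h | h
      · exact Or.inl ⟨hx, n, hn1, h, hb⟩
      · rcases le_or_gt n (y ^ 80) with h' | h'
        · exact Or.inr (Or.inl ⟨hx, n, h, h', hb⟩)
        · exact Or.inr (Or.inr ⟨hx, n, h', hn2, hb⟩)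
    · exact mem_union_left _ (mem_filter.2 ⟨hx, hb⟩)
  have hcard : ∀ r, (#(numerators p q r) : ℝ) ≤
      #(goodNumerators κ p q r) + (#(Bs r) + (#(Bm r) + #(Bl r))) := by
    intro r
    have h1 := card_le_card (hcover r)
    have h2 := card_union_le (goodNumerators κ p q r) (Bs r ∪ (Bm r ∪ Bl r))
    have h3 := card_union_le (Bs r) (Bm r ∪ Bl r)
    have h4 := card_union_le (Bm r) (Bl r)
    exact_mod_cast (by omega : #(numerators p q r) ≤
      #(goodNumerators κ p q r) + (#(Bs r) + (#(Bm r) + #(Bl r))))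
  have hs : ∀ r ∈ P, (#(Bs r) : ℝ) ≤ 4992 / 200000 * (δ * Q) := by
    intro r hr
    obtain ⟨⟨hr1, hr2⟩, hrp⟩ := hPm r hr
    have hr1' : Q ≤ r := by rw [hQdef]; exact_mod_cast hr1.le
    have hr2' : (r : ℝ) ≤ 4 * Q := by rw [hQdef]; exact_mod_cast hr2
    have hr0 : 0 < r := hrp.pos
    refine (card_bad_small_le (M := y ^ 25) hq (Nat.not_dvd_of_pos_of_lt hp hpq) hr0 hδ (κ := κ)
      ?_ ?_ _ ?_ ?_).trans ?_
    · have : δ * (q : ℝ) ^ 3 = 1 / Real.log q := by rw [hδdef, delta]; field_simp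
      rw [this, le_div_iff₀ (by linarith)]
      nlinarith
    · have h24 : (200000 : ℝ) ≤ (y : ℝ) ^ 24 :=
        le_trans (by norm_num) (pow_le_pow_left₀ (by norm_num) hyr 24)
      have : (y : ℝ) ^ 75 * (200000 * Real.log y) ≤ Q := by
        calc (y : ℝ) ^ 75 * (200000 * Real.log y) ≤ (y : ℝ) ^ 75 * ((y : ℝ) ^ 24 * y) := by gcongr
          _ = Q := by rw [hQdef]; ring
      rw [hκdef, div_mul_eq_mul_div, one_mul, le_div_iff₀ (by positivity)]
      calc ((y ^ 25 : ℕ) : ℝ) ^ 3 * (200000 * Real.log y)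
          = (y : ℝ) ^ 75 * (200000 * Real.log y) := by push_cast; ring
        _ ≤ (r : ℝ) := this.trans hr1'
    · intro x hx
      exact (mem_numerators (by omega) hr0).1 (mem_filter.1 hx).1
    · intro x hx
      exact (mem_filter.1 hx).2
    · push_cast
      rw [Real.log_pow]
      push_cast
      have hκ25 : κ * (1 + 25 * Real.log y) ≤ 26 / 200000 := by nlinarith
      calc 48 * δ * κ * r * (1 + 25 * Real.log y)
          = 48 * δ * r * (κ * (1 + 25 * Real.log y)) := by ring
        _ ≤ 48 * δ * (4 * Q) * (26 / 200000) := by gcongr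
        _ = _ := by ring
  have hl : ∀ r ∈ P, (#(Bl r) : ℝ) ≤ 1104 / 200000 * (δ * Q) := by
    intro r hr
    obtain ⟨⟨hr1, hr2⟩, hrp⟩ := hPm r hr
    refine (card_bad_large_le hrp hy20 hr1 hr2 hl96 (hl100.trans hr1.le) hκ0.le (X := X r) _
      ((filter_subset _ _).trans (hnum r hr))
      (fun x hx => numerators_pos_lt hq20 hp hpq hrp.pos (mem_filter.1 hx).1)
      (fun x hx => (mem_filter.1 hx).2)).trans ?_
    rw [Real.log_mul (by norm_num) (by positivity), Real.log_pow]
    have h4 : Real.log 4 ≤ 2 := by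
      rw [Real.log_le_iff_le_exp (by norm_num)]
      have := Real.add_one_le_exp (1 : ℝ)
      rw [show (2 : ℝ) = 1 + 1 by norm_num, Real.exp_add]
      nlinarith
    push_cast
    have hκ20 : κ * (1 + (Real.log 4 + 20 * Real.log y)) ≤ 23 / 200000 := by nlinarith
    calc 16 * κ * l * (1 + (Real.log 4 + 20 * Real.log y))
        = 16 * l * (κ * (1 + (Real.log 4 + 20 * Real.log y))) := by ring
      _ ≤ 16 * (3 * (δ * Q)) * (23 / 200000) := by gcongr
      _ = _ := by ring
  have hPy : (y : ℝ) ^ 99 ≤ #P := by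
    have h1 : (y : ℝ) ^ 100 ≤ y * #P := by
      calc (y : ℝ) ^ 100 = ((y ^ 100 : ℕ) : ℝ) := by push_cast; ring
        _ ≤ q * #P := hP
        _ ≤ y * #P := by gcongr
    have hy0 : (0 : ℝ) < y := by linarith
    rw [pow_succ'] at h1
    exact le_of_mul_le_mul_left h1 hy0
  have hm : ∑ r ∈ P, (#(Bm r) : ℝ) ≤ (972 / 200000 + 1 / 100) * (#P * (δ * Q)) := by
    refine (sum_card_bad_middle_le hy20 hl96 hl100 P (fun r hr => ⟨(hPm r hr).2, (hPm r hr).1.1⟩)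
      (fun r hr => (hPm r hr).1.2) hκ0.le X Bm
      (fun r hr => (filter_subset _ _).trans (hnum r hr))
      (fun r hr x hx => (mem_filter.1 hx).2)).trans ?_
    have hκ80 : κ * (1 + 80 * Real.log y) ≤ 81 / 200000 := by nlinarith
    have hll : Real.log l ≤ 100 * y := by
      have : (l : ℝ) ≤ (y : ℝ) ^ 100 := by exact_mod_cast hl100
      have h0 : (0 : ℝ) < l := by linarith
      refine (Real.log_le_log h0 this).trans ?_
      rw [Real.log_pow]; push_cast; linarith
    have hll0 : 0 ≤ Real.log l := Real.log_natCast_nonneg l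
    have h14 : (6 * 3 * 2 * 9 * 101 * 100 : ℝ) ≤ (y : ℝ) ^ 14 :=
      le_trans (by norm_num) (pow_le_pow_left₀ (by norm_num) hyr 14)
    have hy4 : (1 : ℝ) ≤ (y : ℝ) ^ 4 := one_le_pow₀ (by linarith)
    have herr : 6 * (l : ℝ) * (y : ℝ) ^ 80 * (2 * (2 * (4 * (y : ℝ) ^ 4) + 1) * (1 + Real.log l))
        ≤ 1 / 100 * (#P * (δ * Q)) := by
      calc 6 * (l : ℝ) * (y : ℝ) ^ 80 * (2 * (2 * (4 * (y : ℝ) ^ 4) + 1) * (1 + Real.log l))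
          ≤ 6 * (3 * (δ * Q)) * (y : ℝ) ^ 80 * (2 * (9 * (y : ℝ) ^ 4) * (101 * y)) := by
            gcongr
            · linarith
            · linarith
        _ = 1 / 100 * ((6 * 3 * 2 * 9 * 101 * 100) * (y : ℝ) ^ 85 * (δ * Q)) := by ring
        _ ≤ 1 / 100 * ((y : ℝ) ^ 14 * (y : ℝ) ^ 85 * (δ * Q)) := by gcongr
        _ = 1 / 100 * ((y : ℝ) ^ 99 * (δ * Q)) := by ring
        _ ≤ 1 / 100 * (#P * (δ * Q)) := by gcongr
    have hmain : (#P : ℝ) * (4 * κ * l * (1 + Real.log ((y : ℝ) ^ 80)))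
        ≤ 972 / 200000 * (#P * (δ * Q)) := by
      rw [Real.log_pow]; push_cast
      calc (#P : ℝ) * (4 * κ * l * (1 + 80 * Real.log y))
          = #P * (4 * l * (κ * (1 + 80 * Real.log y))) := by ring
        _ ≤ #P * (4 * (3 * (δ * Q)) * (81 / 200000)) := by gcongr
        _ = _ := by ring
    linarith
  have hlow : ∀ r ∈ P, δ * Q * (1 / 4) ≤ (#(numerators p q r) : ℝ) := by
    intro r hr
    have hr1 : Q ≤ r := by rw [hQdef]; exact_mod_cast (hPm r hr).1.1.le
    have := le_card_numerators (p := p) (q := q) (r := r) (by omega)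
    rw [← hδdef] at this
    nlinarith
  have hsum := sum_le_sum fun r (hr : r ∈ P) => (hlow r hr).trans (hcard r)
  have hsum_s := sum_le_sum hs
  have hsum_l := sum_le_sum hl
  simp only [sum_add_distrib, sum_const, nsmul_eq_mul] at hsum hsum_s hsum_l
  have : 0 ≤ (#P : ℝ) * (δ * Q) := by positivity
  linarith

/-- The interval attached to the fraction `p / q`. -/
noncomputable def interval (p q : ℕ) : Set ℝ :=
  Set.Icc ((p : ℝ) / q + delta q) (p / q + 2 * delta q)

theorem interval_subset {p q x r : ℕ} (hq : 20 ≤ q) (hr : q ^ 4 ≤ r)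
    (hx : x ∈ numerators p q r) : interval x r ⊆ interval p q := by
  have hqr : (20 : ℝ) ≤ q := by exact_mod_cast hq
  have hr' : (q : ℝ) ^ 4 ≤ r := by exact_mod_cast hr
  have hrq : q ≤ r := (Nat.le_self_pow (by norm_num) q).trans hr
  obtain ⟨h1, h2⟩ := (mem_numerators (by omega) (by omega)).1 hx
  have hd := delta_pos (q := r) (by omega)
  have hd' : delta r ≤ delta q / 4 := by
    have h4 : (4 : ℝ) * q ^ 4 ≤ (r : ℝ) ^ 3 := by
      have : (4 : ℝ) ≤ (q : ℝ) ^ 4 := le_trans (by norm_num) (pow_le_pow_left₀ (by norm_num) hqr 4)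
      calc (4 : ℝ) * q ^ 4 ≤ (q : ℝ) ^ 4 * (q : ℝ) ^ 4 := by gcongr
        _ ≤ (q : ℝ) ^ 4 * (q : ℝ) ^ 4 * (q : ℝ) ^ 4 := le_mul_of_one_le_right (by positivity) (by linarith)
        _ = ((q : ℝ) ^ 4) ^ 3 := by ring
        _ ≤ (r : ℝ) ^ 3 := by gcongr
    calc delta r ≤ 1 / (r : ℝ) ^ 3 := delta_le (by omega)
      _ ≤ 1 / (4 * (q : ℝ) ^ 4) := by gcongr
      _ = 1 / (q : ℝ) ^ 4 / 4 := by field_simp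
      _ ≤ delta q / 4 := by gcongr; exact le_delta (by omega)
  intro α hα
  exact ⟨by linarith [hα.1], by linarith [hα.2]⟩

theorem mul_log_mul_le_two {p q : ℕ} (hq : 3 ≤ q) {α : ℝ} (hα : α ∈ interval p q) :
    (q : ℝ) * Real.log q * |α * q ^ 2 - round (α * (q : ℝ) ^ 2)| ≤ 2 := by
  have hL := one_le_log_of_three_le hq
  have hq0 : (0 : ℝ) < q := by positivity
  have hd := delta_pos hq
  have h1 : |α * q ^ 2 - round (α * (q : ℝ) ^ 2)| ≤ 2 * delta q * (q : ℝ) ^ 2 := by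
    refine (round_le _ ((p : ℤ) * q)).trans ?_
    have : α * (q : ℝ) ^ 2 - ((p : ℤ) * q : ℤ) = (α - p / q) * (q : ℝ) ^ 2 := by
      push_cast; field_simp
    rw [this, abs_of_nonneg]
    · gcongr; linarith [hα.2]
    · exact mul_nonneg (by linarith [hα.1]) (by positivity)
  calc (q : ℝ) * Real.log q * |α * q ^ 2 - round (α * (q : ℝ) ^ 2)|
      ≤ (q : ℝ) * Real.log q * (2 * delta q * (q : ℝ) ^ 2) := by gcongr
    _ = 2 := by unfold delta; field_simp

theorem le_mul_log_mul {κ : ℝ} {q x r n : ℕ} (hr : r.Prime)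
    (hrL : 4 ≤ Real.log r) (hx : 0 < x ∧ x < r) (hq : 3 ≤ q) (hn : q ≤ n) (hnr : n < r)
    (hgood : ¬ HasGoodSquareApprox κ q x r) {α : ℝ} (hα : α ∈ interval x r) :
    κ * Real.log q / 2 ≤ (n : ℝ) * Real.log n * |α * n ^ 2 - round (α * (n : ℝ) ^ 2)| := by
  set m := round (α * (n : ℝ) ^ 2) with hm
  have hr0 : (0 : ℝ) < r := by exact_mod_cast hr.pos
  have hn0 : (0 : ℝ) < n := by exact_mod_cast (show 0 < n by omega)
  have hnr' : (n : ℝ) ≤ r := by exact_mod_cast hnr.le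
  have h1 : κ * r ≤ |(n : ℝ) ^ 2 * x - m * r| * n := by
    by_contra! h
    exact hgood ⟨n, hn, hnr, m, h⟩
  have h2 : (1 : ℝ) ≤ |(n : ℝ) ^ 2 * x - m * r| := by
    have hne : (n : ℤ) ^ 2 * x - m * r ≠ 0 := by
      intro h
      have hdvd : (r : ℤ) ∣ ((n ^ 2 * x : ℕ) : ℤ) := ⟨m, by push_cast; linarith⟩
      rw [Int.natCast_dvd_natCast, hr.dvd_mul] at hdvd
      rcases hdvd with h | h
      · exact absurd (Nat.le_of_dvd (by omega) (hr.dvd_of_dvd_pow h)) (by omega)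
      · exact absurd (Nat.le_of_dvd hx.1 h) (by omega)
    exact_mod_cast Int.one_le_abs hne
  have hd : (n : ℝ) ^ 2 * (2 * delta r) * r ≤ 1 / 2 := by
    calc (n : ℝ) ^ 2 * (2 * delta r) * r ≤ (r : ℝ) ^ 2 * (2 * delta r) * r := by
          have := delta_pos (q := r) (by omega)
          gcongr
      _ = 2 / Real.log r := by unfold delta; field_simp
      _ ≤ 2 / 4 := by gcongr
      _ = 1 / 2 := by norm_num
  have h3 : |(n : ℝ) ^ 2 * x - m * r| ≤ |α * n ^ 2 - m| * r + 1 / 2 := by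
    have hsplit : (n : ℝ) ^ 2 * x - m * r
        = (α * n ^ 2 - m) * r - (n : ℝ) ^ 2 * (α - x / r) * r := by field_simp; ring
    have hab : |(n : ℝ) ^ 2 * (α - x / r) * r| ≤ 1 / 2 := by
      have hd0 := delta_pos (q := r) (by omega)
      have h0 : 0 ≤ α - x / r := by linarith [hα.1]
      rw [abs_of_nonneg (by positivity)]
      refine le_trans ?_ hd
      gcongr
      linarith [hα.2]
    rw [hsplit]
    refine (abs_sub _ _).trans ?_
    rw [abs_mul, abs_of_pos hr0]
    linarith
  have h4 : κ / 2 ≤ n * |α * n ^ 2 - m| := by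
    have : κ * r ≤ 2 * (|α * n ^ 2 - m| * r) * n := by nlinarith
    have : κ * r ≤ (2 * (n * |α * n ^ 2 - m|)) * r := by linarith
    linarith [le_of_mul_le_mul_right this hr0]
  have hLq : 1 ≤ Real.log q := one_le_log_of_three_le hq
  have hLn : Real.log q ≤ Real.log n :=
    Real.log_le_log (by exact_mod_cast (show 0 < q by omega)) (by exact_mod_cast hn)
  calc κ * Real.log q / 2 = κ / 2 * Real.log q := by ring
    _ ≤ (n * |α * n ^ 2 - m|) * Real.log n := by gcongr
    _ = _ := by ring

theorem card_le_of_separated {β : Type*} (S : Finset β) (f : β → ℝ) {η D : ℝ} (hη : 0 < η)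
    (hD : 0 ≤ D) (hsep : ∀ a ∈ S, ∀ b ∈ S, a ≠ b → η ≤ |f a - f b|)
    (hdiam : ∀ a ∈ S, ∀ b ∈ S, |f a - f b| ≤ D) : (#S : ℝ) ≤ D / η + 1 := by
  rcases S.eq_empty_or_nonempty with rfl | hS
  · simp; positivity
  obtain ⟨a₀, ha₀, hmin⟩ := S.exists_min_image f hS
  have hcard : #S ≤ #(range (⌊D / η⌋₊ + 1)) := by
    refine card_le_card_of_injOn (fun a => ⌊(f a - f a₀) / η⌋₊) ?_ ?_
    · intro a ha
      simp only [coe_range, Set.mem_Iio, Nat.lt_succ_iff]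
      apply Nat.floor_mono
      gcongr
      exact (le_abs_self _).trans (hdiam a ha a₀ ha₀)
    · intro a ha b hb hab
      by_contra hne
      have h1 := hsep a ha b hb hne
      have ha0 : 0 ≤ (f a - f a₀) / η := div_nonneg (sub_nonneg.2 (hmin a ha)) hη.le
      have hb0 : 0 ≤ (f b - f a₀) / η := div_nonneg (sub_nonneg.2 (hmin b hb)) hη.le
      have h2 := Nat.floor_le ha0
      have h3 := Nat.lt_floor_add_one ((f a - f a₀) / η)
      have h4 := Nat.floor_le hb0
      have h5 := Nat.lt_floor_add_one ((f b - f a₀) / η)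
      simp only at hab
      rw [hab] at h2 h3
      have h6 : |(f a - f a₀) / η - (f b - f a₀) / η| < 1 := abs_lt.2 ⟨by linarith, by linarith⟩
      rw [← sub_div, sub_sub_sub_cancel_right, abs_div, abs_of_pos hη, div_lt_one hη] at h6
      linarith
  rw [card_range] at hcard
  calc (#S : ℝ) ≤ ((⌊D / η⌋₊ + 1 : ℕ) : ℝ) := by exact_mod_cast hcard
    _ ≤ D / η + 1 := by push_cast; gcongr; exact Nat.floor_le (by positivity)

theorem le_abs_div_sub_div {x r x' r' : ℕ} (hr : 0 < r) (hr' : 0 < r')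
    (hne : x * r' ≠ x' * r) : 1 / ((r : ℝ) * r') ≤ |(x : ℝ) / r - x' / r'| := by
  have hr0 : (0 : ℝ) < r := by exact_mod_cast hr
  have hr0' : (0 : ℝ) < r' := by exact_mod_cast hr'
  have h : (1 : ℝ) ≤ |(x : ℝ) * r' - r * x'| := by
    have : (x : ℤ) * r' - r * x' ≠ 0 := by
      rw [sub_ne_zero]
      exact_mod_cast fun h => hne (by rw [h, mul_comm])
    exact_mod_cast Int.one_le_abs this
  rw [div_sub_div _ _ hr0.ne' hr0'.ne', abs_div, abs_of_pos (mul_pos hr0 hr0')]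
  gcongr

/-- Fractions with prime denominators in `(Q, 4 * Q]` whose intervals meet a set of diameter at
most `d`. -/
structure MeetsAll (Q : ℕ) (U : Set ℝ) (S : Finset ((_ : ℕ) × ℕ)) : Prop where
  mem : ∀ c ∈ S, c.1 ∈ denominators Q
  pos_lt : ∀ c ∈ S, 0 < c.2 ∧ c.2 < c.1
  meets : ∀ c ∈ S, (U ∩ interval c.2 c.1).Nonempty

namespace MeetsAll

variable {Q : ℕ} {U : Set ℝ} {d : ℝ} {S : Finset ((_ : ℕ) × ℕ)}

theorem abs_sub_le (h : MeetsAll Q U S) (hQ : 3 ≤ Q)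
    (hU : ∀ a ∈ U, ∀ b ∈ U, |a - b| ≤ d) :
    ∀ a ∈ S, ∀ b ∈ S, |(a.2 : ℝ) / a.1 - b.2 / b.1| ≤ d + 2 / (Q : ℝ) ^ 3 := by
  intro a ha b hb
  have key : ∀ c ∈ S, ∃ u ∈ U, 0 ≤ u - (c.2 : ℝ) / c.1 ∧ u - (c.2 : ℝ) / c.1 ≤ 2 / (Q : ℝ) ^ 3 := by
    intro c hc
    obtain ⟨u, hu, hui⟩ := h.meets c hc
    have hcQ := (mem_denominators.1 (h.mem c hc)).1.1
    have h3 : 3 ≤ c.1 := by omega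
    have hd := delta_pos h3
    have hd' : delta c.1 ≤ 1 / (Q : ℝ) ^ 3 := (delta_le h3).trans (by gcongr)
    refine ⟨u, hu, by linarith [hui.1], ?_⟩
    rw [show 2 / (Q : ℝ) ^ 3 = 2 * (1 / (Q : ℝ) ^ 3) by ring]
    linarith [hui.2]
  obtain ⟨u, hu, hu0, hu1⟩ := key a ha
  obtain ⟨v, hv, hv0, hv1⟩ := key b hb
  have huv := abs_le.1 (hU u hu v hv)
  exact abs_le.2 ⟨by linarith, by linarith⟩

theorem card_le (h : MeetsAll Q U S) (hQ : 100 ≤ Q) (hd : 0 ≤ d)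
    (hU : ∀ a ∈ U, ∀ b ∈ U, |a - b| ≤ d) : (#S : ℝ) ≤ 16 * (Q : ℝ) ^ 2 * d + 2 := by
  have hQr : (100 : ℝ) ≤ Q := by exact_mod_cast hQ
  have hQ0 : (0 : ℝ) < Q := by linarith
  refine (card_le_of_separated S (fun c => (c.2 : ℝ) / c.1) (η := 1 / (16 * (Q : ℝ) ^ 2))
    (by positivity) (by positivity) ?_ (h.abs_sub_le (by omega) hU)).trans ?_
  · intro a ha b hb hab
    obtain ⟨⟨ha1, ha2⟩, hap⟩ := mem_denominators.1 (h.mem a ha)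
    obtain ⟨⟨hb1, hb2⟩, hbp⟩ := mem_denominators.1 (h.mem b hb)
    have hne : a.2 * b.1 ≠ b.2 * a.1 := by
      intro heq
      have hdvd : a.1 ∣ a.2 * b.1 := heq ▸ dvd_mul_left _ _
      rcases hap.dvd_mul.1 hdvd with hx | hx
      · exact absurd (Nat.le_of_dvd (h.pos_lt a ha).1 hx) (by have := h.pos_lt a ha; omega)
      · have h1 := (Nat.prime_dvd_prime_iff_eq hap hbp).1 hx
        rw [← h1] at heq
        have h2 := Nat.eq_of_mul_eq_mul_right hap.pos heq
        exact hab (Sigma.ext h1 (heq_of_eq h2))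
    refine le_trans ?_ (le_abs_div_sub_div hap.pos hbp.pos hne)
    have ha3 : (a.1 : ℝ) ≤ 4 * Q := by exact_mod_cast ha2
    have hb3 : (b.1 : ℝ) ≤ 4 * Q := by exact_mod_cast hb2
    have ha0 : (0 : ℝ) < a.1 := by exact_mod_cast hap.pos
    have hb0 : (0 : ℝ) < b.1 := by exact_mod_cast hbp.pos
    apply one_div_le_one_div_of_le (by positivity)
    calc (a.1 : ℝ) * b.1 ≤ (4 * Q) * (4 * Q) := by gcongr
      _ = 16 * (Q : ℝ) ^ 2 := by ring
  · have : (d + 2 / (Q : ℝ) ^ 3) / (1 / (16 * (Q : ℝ) ^ 2)) = 16 * (Q : ℝ) ^ 2 * d + 32 / Q := by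
      field_simp; ring
    rw [this]
    have : 32 / (Q : ℝ) ≤ 1 := by rw [div_le_one hQ0]; linarith
    linarith

theorem card_le' (h : MeetsAll Q U S) (hQ : 100 ≤ Q) (hd : 0 ≤ d)
    (hU : ∀ a ∈ U, ∀ b ∈ U, |a - b| ≤ d) :
    (#S : ℝ) ≤ #(denominators Q) * (4 * Q * d + 2) := by
  classical
  have hQr : (100 : ℝ) ≤ Q := by exact_mod_cast hQ
  have hQ0 : (0 : ℝ) < Q := by linarith
  have hfib : ∀ r ∈ denominators Q, (#(S.filter fun c => c.1 = r) : ℝ) ≤ 4 * Q * d + 2 := by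
    intro r hr
    refine (card_le_of_separated (S.filter fun c => c.1 = r) (fun c => (c.2 : ℝ) / c.1)
      (η := 1 / (4 * (Q : ℝ))) (by positivity) (D := d + 2 / (Q : ℝ) ^ 3) (by positivity) ?_
      fun a ha b hb => h.abs_sub_le (by omega) hU a (mem_filter.1 ha).1 b (mem_filter.1 hb).1).trans
      ?_
    · intro a ha b hb hab
      obtain ⟨⟨hr1, hr2⟩, hrp⟩ := mem_denominators.1 hr
      have har := (mem_filter.1 ha).2
      have hbr := (mem_filter.1 hb).2
      have hr0 : (0 : ℝ) < r := by exact_mod_cast hrp.pos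
      have hr3 : (r : ℝ) ≤ 4 * Q := by exact_mod_cast hr2
      have hne : (a.2 : ℤ) - b.2 ≠ 0 := by
        intro heq
        exact hab (Sigma.ext (har.trans hbr.symm) (heq_of_eq (by omega)))
      have h1 : (1 : ℝ) ≤ |(a.2 : ℝ) - b.2| := by exact_mod_cast Int.one_le_abs hne
      simp only [har, hbr]
      rw [← sub_div, abs_div, abs_of_pos hr0]
      gcongr
    · have : (d + 2 / (Q : ℝ) ^ 3) / (1 / (4 * (Q : ℝ))) = 4 * Q * d + 8 / (Q : ℝ) ^ 2 := by
        field_simp; ring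
      rw [this]
      have : 8 / (Q : ℝ) ^ 2 ≤ 1 := by rw [div_le_one (by positivity)]; nlinarith
      linarith
  have hsum := card_eq_sum_card_fiberwise (f := fun c : (_ : ℕ) × ℕ => c.1) (s := S)
    (t := denominators Q) h.mem
  rw [hsum]
  push_cast
  exact (sum_le_sum hfib).trans (by rw [sum_const, nsmul_eq_mul])

end MeetsAll

/-- The `s`-dimensional mass of the pieces of a cover that meet the interval of `p / q` is at most
`q ^ (-τ)`. -/
def MassAtMost (U : ℕ → Set ℝ) (d : ℕ → ℝ) (s τ : ℝ) (p q : ℕ) : Prop :=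
  ∀ F : Finset ℕ, (∀ i ∈ F, (U i ∩ interval p q).Nonempty) → ∑ i ∈ F, d i ^ s ≤ (q : ℝ) ^ (-τ)

theorem rpow_mul_pow_six_le {q k : ℕ} {t : ℝ} (hq : 1 ≤ q) (ht : 6 ≤ 100 * k * (2 - t)) :
    (((q : ℝ) ^ k) ^ 100) ^ t * (q : ℝ) ^ 6 ≤ (((q : ℝ) ^ k) ^ 100) ^ 2 := by
  have hq1 : (1 : ℝ) ≤ q := by exact_mod_cast hq
  have hq0 : (0 : ℝ) < q := by linarith
  rw [← pow_mul, ← pow_mul, ← Real.rpow_natCast (q : ℝ) (k * 100), ← Real.rpow_mul hq0.le,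
    ← Real.rpow_natCast (q : ℝ) 6, ← Real.rpow_add hq0, ← Real.rpow_natCast]
  apply Real.rpow_le_rpow_of_exponent_le hq1
  push_cast
  linarith

set_option maxHeartbeats 1000000 in
theorem exists_child {s τ : ℝ} (hs0 : 0 < s) (hs1 : s ≤ 2 / 3) (hτ0 : 0 < τ) (hτ : τ ≤ 2)
    {k : ℕ} (hk : 0 < k) (hkτ : 6 ≤ 100 * k * (2 - τ)) {U : ℕ → Set ℝ} {d : ℕ → ℝ}
    (hd : ∀ i, 0 < d i) (hU : ∀ i, ∀ a ∈ U i, ∀ b ∈ U i, |a - b| ≤ d i) {p q : ℕ}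
    (hq : q.Prime) (hq0 : 20000 ≤ q) (hp : 0 < p) (hpq : p < q)
    (hP : (((q ^ k) ^ 100 : ℕ) : ℝ) ≤ q * #(denominators ((q ^ k) ^ 100)))
    (hlog : 216 * Real.log q ≤ (q : ℝ) ^ (τ / s - 3)) (hmass : MassAtMost U d s τ p q) :
    ∃ r ∈ denominators ((q ^ k) ^ 100),
      ∃ x ∈ goodNumerators (1 / (200000 * Real.log (q ^ k : ℕ))) p q r, MassAtMost U d s τ x r := by
  classical
  by_contra! hcon
  set P := denominators ((q ^ k) ^ 100) with hPdef
  clear_value P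
  set κ : ℝ := 1 / (200000 * Real.log (q ^ k : ℕ)) with hκ
  set Q : ℝ := ((q : ℝ) ^ k) ^ 100 with hQdef
  have hQcast : (((q ^ k) ^ 100 : ℕ) : ℝ) = Q := by rw [hQdef]; push_cast; rfl
  have hqk : q ≤ q ^ k := Nat.le_self_pow hk.ne' q
  have hqr : (20000 : ℝ) ≤ q := by exact_mod_cast hq0
  have hqpos : (0 : ℝ) < q := by linarith
  have hk4 : q ^ 4 ≤ (q ^ k) ^ 100 := by
    calc q ^ 4 ≤ (q ^ k) ^ 4 := by gcongr
      _ ≤ (q ^ k) ^ 100 := Nat.pow_le_pow_right (by omega) (by norm_num)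
  have hQq : (q : ℝ) ≤ Q := by
    rw [← hQcast]; exact_mod_cast (Nat.le_self_pow (by norm_num) q).trans hk4
  have hQpos : 0 < Q := by linarith
  have hQ1 : 1 ≤ Q := by linarith
  have hQnat : 100 ≤ (q ^ k) ^ 100 := by
    have : (100 : ℝ) ≤ (((q ^ k) ^ 100 : ℕ) : ℝ) := by rw [hQcast]; linarith
    exact_mod_cast this
  have hgood := sum_card_goodNumerators_ge hq (by omega) hp hpq hqk (hPdef ▸ hP)
  rw [← hPdef, ← hκ] at hgood
  push_cast at hgood
  rw [← hQdef] at hgood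
  obtain ⟨N, hcardP⟩ : ∃ N : ℝ, N = #P := ⟨_, rfl⟩
  rw [← hcardP] at hgood hP
  have hN0 : 0 ≤ N := hcardP ▸ Nat.cast_nonneg _
  have hs2 : 0 ≤ 1 - s := by linarith
  set C : Finset ((_ : ℕ) × ℕ) := P.sigma fun r => goodNumerators κ p q r with hC
  have hCcard : (#C : ℝ) = ∑ r ∈ P, (#(goodNumerators κ p q r) : ℝ) := by
    rw [hC, card_sigma]; push_cast; rfl
  have hCmem : ∀ c ∈ C, c.1 ∈ P ∧ c.2 ∈ numerators p q c.1 ∧ ¬ MassAtMost U d s τ c.2 c.1 := by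
    intro c hc
    obtain ⟨h1, h2⟩ := mem_sigma.1 hc
    exact ⟨h1, (mem_filter.1 h2).1, hcon c.1 h1 c.2 h2⟩
  have hCr : ∀ c ∈ C, Q < c.1 ∧ (c.1 : ℝ) ≤ 4 * Q ∧ c.1.Prime ∧ q ^ 4 ≤ c.1 := by
    intro c hc
    obtain ⟨⟨h1, h2⟩, h3⟩ := mem_denominators.1 (hPdef ▸ (hCmem c hc).1)
    rw [← hQcast]
    exact ⟨by exact_mod_cast h1, by exact_mod_cast h2, h3, hk4.trans h1.le⟩
  have hbad : ∀ c : (_ : ℕ) × ℕ, ∃ F : Finset ℕ, c ∈ C →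
      (∀ i ∈ F, (U i ∩ interval c.2 c.1).Nonempty) ∧ (c.1 : ℝ) ^ (-τ) < ∑ i ∈ F, d i ^ s := by
    intro c
    by_cases hc : c ∈ C
    · have := (hCmem c hc).2.2
      unfold MassAtMost at this
      push Not at this
      obtain ⟨F, hF⟩ := this
      exact ⟨F, fun _ => hF⟩
    · exact ⟨∅, fun h => absurd h hc⟩
  choose F hF using hbad
  set T := C.biUnion F with hT
  have hTmass : ∑ i ∈ T, d i ^ s ≤ (q : ℝ) ^ (-τ) := by
    refine hmass T fun i hi => ?_
    obtain ⟨c, hc, hic⟩ := mem_biUnion.1 hi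
    exact ((hF c hc).1 i hic).mono (Set.inter_subset_inter_right _
      (interval_subset (by omega) (hCr c hc).2.2.2 (hCmem c hc).2.1))
  have hdq : ∀ i ∈ T, d i ≤ (q : ℝ) ^ (-(τ / s)) := by
    intro i hi
    have h1 : d i ^ s ≤ (q : ℝ) ^ (-τ) :=
      (single_le_sum (f := fun i => d i ^ s) (fun j _ => Real.rpow_nonneg (hd j).le s) hi).trans
        hTmass
    have h2 := Real.rpow_le_rpow (Real.rpow_nonneg (hd i).le s) h1 (inv_nonneg.2 hs0.le)
    rw [Real.rpow_rpow_inv (hd i).le hs0.ne', ← Real.rpow_mul hqpos.le] at h2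
    rwa [show -(τ / s) = -τ * s⁻¹ by ring]
  set w : ℕ → ℝ := fun i => if d i < 1 / Q ^ 2 then (4 * Q) ^ τ * d i ^ s else 1 with hw
  have hw0 : ∀ i, 0 ≤ w i := by
    intro i
    have := Real.rpow_nonneg (hd i).le s
    rw [hw]; dsimp only
    split_ifs <;> positivity
  have hone : ∀ c ∈ C, 1 ≤ ∑ i ∈ F c, w i := by
    intro c hc
    by_cases hall : ∀ i ∈ F c, d i < 1 / Q ^ 2
    · have hsum : ∑ i ∈ F c, w i = (4 * Q) ^ τ * ∑ i ∈ F c, d i ^ s := by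
        rw [mul_sum]
        exact sum_congr rfl fun i hi => if_pos (hall i hi)
      obtain ⟨h1, h2, h3, -⟩ := hCr c hc
      have hc0 : (0 : ℝ) < c.1 := by exact_mod_cast h3.pos
      rw [hsum]
      calc (1 : ℝ) = (c.1 : ℝ) ^ τ * (c.1 : ℝ) ^ (-τ) := by
            rw [← Real.rpow_add hc0, add_neg_cancel, Real.rpow_zero]
        _ ≤ (4 * Q) ^ τ * ∑ i ∈ F c, d i ^ s := by
            gcongr
            exact (hF c hc).2.le
    · push Not at hall
      obtain ⟨i, hi, hdi⟩ := hall
      have : w i = 1 := if_neg hdi.not_gt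
      rw [← this]
      exact single_le_sum (fun j _ => hw0 j) hi
  set S : ℕ → Finset ((_ : ℕ) × ℕ) := fun i => C.filter fun c => i ∈ F c with hS
  have hcount : (#C : ℝ) ≤ ∑ i ∈ T, #(S i) * w i := by
    calc (#C : ℝ) = ∑ c ∈ C, (1 : ℝ) := by rw [sum_const, nsmul_eq_mul, mul_one]
      _ ≤ ∑ c ∈ C, ∑ i ∈ F c, w i := sum_le_sum hone
      _ = ∑ i ∈ T, ∑ c ∈ S i, w i := by
          refine sum_comm' fun c i => ?_
          simp only [hS, hT, mem_filter, mem_biUnion]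
          exact ⟨fun h => ⟨h, c, h⟩, fun h => h.1⟩
      _ = ∑ i ∈ T, #(S i) * w i := by simp only [sum_const, nsmul_eq_mul]
  set K : ℝ := 6 * Q * N * (q : ℝ) ^ (-(τ / s) * (1 - s)) + 18 * Q ^ (1 + s) + 288 * Q ^ τ
    with hK
  have hweight : ∀ i ∈ T, #(S i) * w i ≤ K * d i ^ s := by
    intro i hi
    have hmeets : MeetsAll ((q ^ k) ^ 100) (U i) (S i) :=
      { mem := fun c hc => hPdef ▸ (hCmem c (mem_filter.1 hc).1).1
        pos_lt := fun c hc => numerators_pos_lt (by omega) hp hpq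
          (hCr c (mem_filter.1 hc).1).2.2.1.pos (hCmem c (mem_filter.1 hc).1).2.1
        meets := fun c hc => (hF c (mem_filter.1 hc).1).1 i (mem_filter.1 hc).2 }
    have hN := hmeets.card_le hQnat (hd i).le (hU i)
    have hN' := hmeets.card_le' hQnat (hd i).le (hU i)
    rw [hQcast] at hN hN'
    rw [← hPdef, ← hcardP] at hN'
    have hds : 0 < d i ^ s := Real.rpow_pos_of_pos (hd i) s
    have hsplit : d i = d i ^ s * d i ^ (1 - s) := by
      rw [← Real.rpow_add (hd i), add_sub_cancel, Real.rpow_one]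
    have hKa : 0 ≤ 6 * Q * N * (q : ℝ) ^ (-(τ / s) * (1 - s)) * d i ^ s := by positivity
    have hKb : 0 ≤ 18 * Q ^ (1 + s) * d i ^ s := by positivity
    have hKc : 0 ≤ 288 * Q ^ τ * d i ^ s := by positivity
    rcases lt_or_ge (d i) (1 / Q ^ 2) with h1 | h1
    · have hwi : w i = (4 * Q) ^ τ * d i ^ s := if_pos h1
      have hS18 : (#(S i) : ℝ) ≤ 18 := by
        rw [lt_div_iff₀ (by positivity)] at h1
        linarith
      have h4 : (4 * Q) ^ τ ≤ 16 * Q ^ τ := by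
        rw [Real.mul_rpow (by norm_num) hQpos.le]
        gcongr
        calc (4 : ℝ) ^ τ ≤ 4 ^ (2 : ℝ) := Real.rpow_le_rpow_of_exponent_le (by norm_num) hτ
          _ = 16 := by norm_num
      have : #(S i) * w i ≤ 288 * Q ^ τ * d i ^ s := by
        calc #(S i) * w i ≤ 18 * (16 * Q ^ τ * d i ^ s) := by rw [hwi]; gcongr
          _ = _ := by ring
      rw [hK]; linarith
    · have hwi : w i = 1 := if_neg h1.not_gt
      rw [hwi, mul_one]
      rcases lt_or_ge (d i) (1 / Q) with h2 | h2
      · have hN2 : (#(S i) : ℝ) ≤ 18 * Q ^ 2 * d i := by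
          rw [div_le_iff₀ (by positivity)] at h1
          linarith
        have : Q ^ 2 * d i ≤ Q ^ (1 + s) * d i ^ s := by
          calc Q ^ 2 * d i = Q ^ 2 * (d i ^ s * d i ^ (1 - s)) := by rw [← hsplit]
            _ ≤ Q ^ 2 * (d i ^ s * (1 / Q) ^ (1 - s)) := by
                have hmono := Real.rpow_le_rpow (hd i).le h2.le hs2
                gcongr
            _ = Q ^ (1 + s) * d i ^ s := by
                rw [one_div, Real.inv_rpow hQpos.le, ← Real.rpow_neg hQpos.le, mul_comm (d i ^ s),
                  ← mul_assoc, ← Real.rpow_natCast, ← Real.rpow_add hQpos]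
                congr 2
                push_cast; ring
        rw [hK]; linarith
      · have hN2 : (#(S i) : ℝ) ≤ 6 * Q * N * d i := by
          rw [div_le_iff₀ hQpos] at h2
          have : 4 * Q * d i + 2 ≤ 6 * Q * d i := by linarith
          calc (#(S i) : ℝ) ≤ N * (4 * Q * d i + 2) := hN'
            _ ≤ N * (6 * Q * d i) := by gcongr
            _ = _ := by ring
        have : 6 * Q * N * d i ≤ 6 * Q * N * (q : ℝ) ^ (-(τ / s) * (1 - s)) * d i ^ s := by
          calc 6 * Q * N * d i = 6 * Q * N * (d i ^ s * d i ^ (1 - s)) := by rw [← hsplit]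
            _ ≤ 6 * Q * N * (d i ^ s * ((q : ℝ) ^ (-(τ / s))) ^ (1 - s)) := by
                have hmono := Real.rpow_le_rpow (hd i).le (hdq i hi)
                  hs2
                gcongr
            _ = _ := by rw [← Real.rpow_mul hqpos.le]; ring
        rw [hK]; linarith
  have hCK : (#C : ℝ) ≤ K * (q : ℝ) ^ (-τ) := by
    refine hcount.trans ((sum_le_sum hweight).trans ?_)
    rw [← mul_sum]
    gcongr
  have hδ := delta_pos (q := q) (by omega)
  have hPpos : (0 : ℝ) < N := by
    rw [hQcast] at hP
    exact (pos_iff_pos_of_mul_pos (hQpos.trans_le hP)).1 hqpos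
  have hqτ : (q : ℝ) ^ (-τ) ≤ 1 :=
    Real.rpow_le_one_of_one_le_of_nonpos (by linarith) (by linarith)
  have hPδ : Q ^ 2 ≤ (N * (delta q * Q)) * (q : ℝ) ^ 5 := by
    rw [hQcast] at hP
    have h4 := le_delta (q := q) (by omega)
    rw [div_le_iff₀ (by positivity)] at h4
    calc Q ^ 2 = 1 * (Q * Q) := by ring
      _ ≤ (delta q * (q : ℝ) ^ 4) * (Q * (q * N)) := by gcongr
      _ = _ := by ring
  have hpow : ∀ t : ℝ, 6 ≤ 100 * k * (2 - t) → Q ^ t * q ≤ N * (delta q * Q) := by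
    intro t ht
    have h1 := rpow_mul_pow_six_le (q := q) (by omega) ht
    rw [← hQdef] at h1
    have h2 : (Q ^ t * q) * (q : ℝ) ^ 5 ≤ (N * (delta q * Q)) * (q : ℝ) ^ 5 := by
      refine le_trans (le_of_eq ?_) (h1.trans hPδ)
      ring
    exact le_of_mul_le_mul_right h2 (by positivity)
  have hk1 : (1 : ℝ) ≤ k := by exact_mod_cast hk
  have hb : 18 * Q ^ (1 + s) ≤ N * (delta q * Q) / 36 := by
    have := hpow (1 + s) (by nlinarith)
    have h0 : 0 ≤ Q ^ (1 + s) := by positivity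
    nlinarith
  have hc : 288 * Q ^ τ ≤ N * (delta q * Q) / 36 := by
    have := hpow τ hkτ
    have h0 : 0 ≤ Q ^ τ := by positivity
    nlinarith
  have ha : 6 * Q * N * (q : ℝ) ^ (-(τ / s) * (1 - s)) * (q : ℝ) ^ (-τ)
      ≤ N * (delta q * Q) / 36 := by
    have hexp : (q : ℝ) ^ (-(τ / s) * (1 - s)) * (q : ℝ) ^ (-τ)
        = 1 / ((q : ℝ) ^ 3 * (q : ℝ) ^ (τ / s - 3)) := by
      rw [← Real.rpow_add hqpos, ← Real.rpow_natCast (q : ℝ) 3, ← Real.rpow_add hqpos, one_div,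
        ← Real.rpow_neg hqpos.le]
      congr 1
      push_cast
      field_simp
      ring
    have hL := one_le_log_of_three_le (q := q) (by omega)
    calc 6 * Q * N * (q : ℝ) ^ (-(τ / s) * (1 - s)) * (q : ℝ) ^ (-τ)
        = 6 * Q * N * (1 / ((q : ℝ) ^ 3 * (q : ℝ) ^ (τ / s - 3))) := by rw [← hexp]; ring
      _ ≤ 6 * Q * N * (1 / ((q : ℝ) ^ 3 * (216 * Real.log q))) := by gcongr
      _ = N * (delta q * Q) / 36 := by unfold delta; field_simp; norm_num
  have hKq : K * (q : ℝ) ^ (-τ) ≤ N * (delta q * Q) / 36 * 3 := by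
    rw [hK, add_mul, add_mul]
    have h1 : 18 * Q ^ (1 + s) * (q : ℝ) ^ (-τ) ≤ 18 * Q ^ (1 + s) :=
      mul_le_of_le_one_right (by positivity) hqτ
    have h2 : 288 * Q ^ τ * (q : ℝ) ^ (-τ) ≤ 288 * Q ^ τ :=
      mul_le_of_le_one_right (by positivity) hqτ
    linarith
  have : (0 : ℝ) < N * (delta q * Q) := by positivity
  rw [← hCcard] at hgood
  linarith

theorem exists_cover_of_hausdorffMeasure_eq_zero {A : Set ℝ} {s : ℝ} (hs : 0 < s)
    (hA : MeasureTheory.Measure.hausdorffMeasure s A = 0) {ε : ℝ} (hε : 0 < ε) :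
    ∃ (U : ℕ → Set ℝ) (d : ℕ → ℝ), A ⊆ ⋃ i, U i ∧ (∀ i, 0 < d i) ∧
      (∀ i, ∀ a ∈ U i, ∀ b ∈ U i, |a - b| ≤ d i) ∧ ∀ F : Finset ℕ, ∑ i ∈ F, d i ^ s ≤ ε := by
  rw [MeasureTheory.Measure.hausdorffMeasure_apply] at hA
  have h1 := (ENNReal.iSup_eq_zero.1 hA) 1
  have h1 := (ENNReal.iSup_eq_zero.1 h1) one_pos
  have h2 := h1.trans_lt (ENNReal.ofReal_pos.2 (half_pos hε))
  obtain ⟨U, h2⟩ := iInf_lt_iff.1 h2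
  obtain ⟨hU, h2⟩ := iInf_lt_iff.1 h2
  obtain ⟨hU1, h2⟩ := iInf_lt_iff.1 h2
  have hfin : ∀ i, Metric.ediam (U i) ≠ ⊤ := fun i => ((hU1 i).trans_lt ENNReal.one_lt_top).ne
  set D : ℕ → ℝ := fun i => (Metric.ediam (U i)).toReal with hD
  have hD0 : ∀ i, 0 ≤ D i := fun i => ENNReal.toReal_nonneg
  have hDs : ∀ i, 0 ≤ D i ^ s := fun i => Real.rpow_nonneg (hD0 i) s
  have hsum : ∀ F : Finset ℕ, ∑ i ∈ F, D i ^ s ≤ ε / 2 := by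
    intro F
    rw [← ENNReal.ofReal_le_ofReal_iff (half_pos hε).le, ENNReal.ofReal_sum_of_nonneg fun i _ => hDs i]
    refine le_trans (sum_le_sum fun i _ => ?_) ((ENNReal.sum_le_tsum F).trans h2.le)
    rw [← ENNReal.ofReal_rpow_of_nonneg (hD0 i) hs.le, ENNReal.ofReal_toReal (hfin i)]
    rcases (U i).eq_empty_or_nonempty with h | h
    · simp [h, ENNReal.zero_rpow_of_pos hs]
    · exact le_iSup (fun _ : (U i).Nonempty => Metric.ediam (U i) ^ s) h
  have hpos : ∀ i, 0 < D i ^ s + ε / 2 / 2 / 2 ^ i := fun i => by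
    have := hDs i; positivity
  refine ⟨U, fun i => (D i ^ s + ε / 2 / 2 / 2 ^ i) ^ s⁻¹, hU,
    fun i => Real.rpow_pos_of_pos (hpos i) _, ?_, ?_⟩
  · intro i a ha b hb
    have h3 : |a - b| ≤ D i := by
      rw [← Real.dist_eq, dist_edist]
      exact ENNReal.toReal_mono (hfin i) (Metric.edist_le_ediam_of_mem ha hb)
    refine h3.trans ?_
    rw [Real.le_rpow_inv_iff_of_pos (hD0 i) (hpos i).le hs]
    have : 0 < ε / 2 / 2 / 2 ^ i := by positivity
    linarith
  · intro F
    simp only [fun i => Real.rpow_inv_rpow (hpos i).le hs.ne', sum_add_distrib]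
    have h3 := (summable_geometric_two' (ε / 2)).sum_le_tsum F fun i _ => by positivity
    rw [tsum_geometric_two'] at h3
    linarith [hsum F]

theorem exists_le_lt_succ {u : ℕ → ℕ} {n : ℕ} (h0 : u 0 ≤ n) (h : ∃ j, n < u j) :
    ∃ j, u j ≤ n ∧ n < u (j + 1) := by
  obtain ⟨j, hj⟩ := h
  induction j with
  | zero => omega
  | succ j ih =>
    rcases lt_or_ge n (u j) with hn | hn
    · exact ih hn
    · exact ⟨j, hn, hj⟩

theorem exists_not_mem_cover {s τ : ℝ} (hs0 : 0 < s) (hs1 : s ≤ 2 / 3) (hτ0 : 0 < τ) (hτ : τ ≤ 2)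
    {k : ℕ} (hk : 0 < k) (hkτ : 6 ≤ 100 * k * (2 - τ)) {U : ℕ → Set ℝ} {d : ℕ → ℝ}
    (hd : ∀ i, 0 < d i) (hU : ∀ i, ∀ a ∈ U i, ∀ b ∈ U i, |a - b| ≤ d i) {q₀ : ℕ}
    (hq₀ : q₀.Prime) (hq20 : 20000 ≤ q₀)
    (hlarge : ∀ q, q₀ ≤ q → (((q ^ k) ^ 100 : ℕ) : ℝ) ≤ q * #(denominators ((q ^ k) ^ 100)) ∧
      216 * Real.log q ≤ (q : ℝ) ^ (τ / s - 3))
    (hmass : ∀ F : Finset ℕ, ∑ i ∈ F, d i ^ s ≤ (q₀ : ℝ) ^ (-τ)) :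
    ∃ α : ℝ, 0 < Filter.liminf (fun n : ℕ =>
      (n : ℝ) * Real.log n * |α * n ^ 2 - round (α * (n : ℝ) ^ 2)|) Filter.atTop ∧
      ∀ i, α ∉ U i := by
  let σ := {c : ℕ × ℕ // c.2.Prime ∧ q₀ ≤ c.2 ∧ 0 < c.1 ∧ c.1 < c.2 ∧ MassAtMost U d s τ c.1 c.2}
  have hstep : ∀ c : σ, ∃ c' : σ, c'.1.2 ∈ denominators ((c.1.2 ^ k) ^ 100) ∧
      c'.1.1 ∈ goodNumerators (1 / (200000 * Real.log (c.1.2 ^ k : ℕ))) c.1.1 c.1.2 c'.1.2 := by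
    rintro ⟨⟨p, q⟩, hq, hq0, hp, hpq, hm⟩
    obtain ⟨r, hr, x, hx, hm'⟩ := exists_child hs0 hs1 hτ0 hτ hk hkτ hd hU hq (hq20.trans hq0) hp
      hpq (hlarge q hq0).1 (hlarge q hq0).2 hm
    have hr' := mem_denominators.1 hr
    have hqr : q ≤ r := ((Nat.le_self_pow hk.ne' q).trans
      (Nat.le_self_pow (by norm_num) (q ^ k))).trans hr'.1.1.le
    have hx' := numerators_pos_lt (hq20.trans hq0 |>.trans' (by norm_num)) hp hpq hr'.2.pos
      (mem_goodNumerators.1 hx).1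
    exact ⟨⟨(x, r), hr'.2, hq0.trans hqr, hx'.1, hx'.2, hm'⟩, hr, hx⟩
  choose next hnext using hstep
  let c₀ : σ := ⟨(1, q₀), hq₀, le_rfl, one_pos, hq₀.one_lt, fun F _ => hmass F⟩
  let c : ℕ → σ := fun j => next^[j] c₀
  have hc : ∀ j, c (j + 1) = next (c j) := fun j => Function.iterate_succ_apply' next j c₀
  set q : ℕ → ℕ := fun j => (c j).1.2 with hq
  set p : ℕ → ℕ := fun j => (c j).1.1 with hp
  have hden : ∀ j, q (j + 1) ∈ denominators ((q j ^ k) ^ 100) := fun j => by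
    simp only [hq, hc]; exact (hnext (c j)).1
  have hnum : ∀ j, p (j + 1) ∈
      goodNumerators (1 / (200000 * Real.log (q j ^ k : ℕ))) (p j) (q j) (q (j + 1)) := fun j => by
    simp only [hq, hp, hc]; exact (hnext (c j)).2
  have hprime : ∀ j, (q j).Prime := fun j => (c j).2.1
  have hge : ∀ j, q₀ ≤ q j := fun j => (c j).2.2.1
  have hpq : ∀ j, 0 < p j ∧ p j < q j := fun j => ⟨(c j).2.2.2.1, (c j).2.2.2.2.1⟩
  have hmassj : ∀ j, MassAtMost U d s τ (p j) (q j) := fun j => (c j).2.2.2.2.2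
  have hgrow : ∀ j, q j ^ 4 < q (j + 1) := fun j => by
    refine lt_of_le_of_lt ?_ (mem_denominators.1 (hden j)).1.1
    rw [← pow_mul]
    exact Nat.pow_le_pow_right (hprime j).pos (by omega)
  have hmono : StrictMono q := strictMono_nat_of_lt_succ fun j =>
    (Nat.le_self_pow (by norm_num) (q j)).trans_lt (hgrow j)
  have hnest : ∀ j, interval (p (j + 1)) (q (j + 1)) ⊆ interval (p j) (q j) := fun j =>
    interval_subset (by have := hge j; omega) (hgrow j).le (mem_goodNumerators.1 (hnum j)).1
  obtain ⟨α, hα⟩ : (⋂ j, interval (p j) (q j)).Nonempty := by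
    refine IsCompact.nonempty_iInter_of_sequence_nonempty_isCompact_isClosed _ hnest
      (fun j => Set.nonempty_Icc.2 ?_) isCompact_Icc fun j => isClosed_Icc
    have := delta_pos (q := q j) (by have := hge j; omega)
    linarith
  rw [Set.mem_iInter] at hα
  have htop : Filter.Tendsto q Filter.atTop Filter.atTop := hmono.tendsto_atTop
  have hlower : ∀ᶠ n : ℕ in Filter.atTop, 1 / (400000 * (k : ℝ)) ≤
      (n : ℝ) * Real.log n * |α * n ^ 2 - round (α * (n : ℝ) ^ 2)| := by
    filter_upwards [Filter.eventually_ge_atTop (q 0)] with n hn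
    obtain ⟨j, hj, hj'⟩ := exists_le_lt_succ hn
      ((htop.eventually (Filter.eventually_gt_atTop n)).exists)
    have hq3 : 3 ≤ q j := by have := hge j; omega
    have hL := one_le_log_of_three_le hq3
    have hrL : 4 ≤ Real.log (q (j + 1)) := by
      have h1 : Real.log ((q j : ℝ) ^ 4) ≤ Real.log (q (j + 1)) :=
        Real.log_le_log (by positivity) (by exact_mod_cast (hgrow j).le)
      rw [Real.log_pow] at h1
      push_cast at h1
      linarith
    have hk0 : (0 : ℝ) < k := by exact_mod_cast hk
    refine le_trans (le_of_eq ?_) (le_mul_log_mul (hprime (j + 1)) hrL (hpq (j + 1)) hq3 hj hj'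
      (mem_goodNumerators.1 (hnum j)).2 (hα (j + 1)))
    push_cast
    rw [Real.log_pow]
    field_simp
    norm_num
  have hfreq : ∃ᶠ n : ℕ in Filter.atTop,
      (n : ℝ) * Real.log n * |α * n ^ 2 - round (α * (n : ℝ) ^ 2)| ≤ 2 :=
    htop.frequently (Filter.Frequently.of_forall fun j =>
      mul_log_mul_le_two (by have := hge j; omega) (hα j))
  refine ⟨α, lt_of_lt_of_le (by positivity) (Filter.le_liminf_of_le
    (Filter.IsCoboundedUnder.of_frequently_le hfreq) hlower), fun i hi => ?_⟩
  have hle : ∀ j, d i ^ s ≤ (q j : ℝ) ^ (-τ) := fun j => by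
    simpa using hmassj j {i} fun i' hi' => by
      rw [mem_singleton.1 hi']; exact ⟨α, hi, hα j⟩
  have hlim : Filter.Tendsto (fun j => (q j : ℝ) ^ (-τ)) Filter.atTop (nhds 0) :=
    (tendsto_rpow_neg_atTop hτ0).comp (tendsto_natCast_atTop_atTop.comp htop)
  exact (ge_of_tendsto' hlim hle).not_gt (Real.rpow_pos_of_pos (hd i) s)

theorem le_dimH :
    ENNReal.ofReal (2 / 3) ≤ dimH {α : ℝ | 0 < Filter.liminf (fun n : ℕ =>
      (n : ℝ) * Real.log n * |α * n ^ 2 - round (α * (n : ℝ) ^ 2)|) Filter.atTop} := by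
  by_contra! hlt
  obtain ⟨s, hs, hs'⟩ := ENNReal.lt_iff_exists_nnreal_btwn.1 hlt
  have hs0 : (0 : ℝ) < s := by
    have : (0 : ENNReal) < s := lt_of_le_of_lt zero_le hs
    exact_mod_cast this
  have hs1 : (s : ℝ) < 2 / 3 := by
    rw [← ENNReal.ofReal_coe_nnreal] at hs'
    exact (ENNReal.ofReal_lt_ofReal_iff (by norm_num)).1 hs'
  have hzero := hausdorffMeasure_of_dimH_lt hs
  set τ : ℝ := (3 * s + 2) / 2 with hτ
  obtain ⟨k, hk⟩ := exists_nat_gt (6 / (2 - τ))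
  have hτ2 : 0 < 2 - τ := by rw [hτ]; linarith
  have hk0 : (0 : ℝ) < k := lt_of_le_of_lt (by positivity) hk
  have hkpos : 0 < k := by exact_mod_cast hk0
  rw [div_lt_iff₀ hτ2] at hk
  have hexp : 0 < τ / s - 3 := by
    rw [sub_pos, lt_div_iff₀ hs0, hτ]; linarith
  obtain ⟨B, hB⟩ := Filter.eventually_atTop.1
    ((eventually_le_mul_card_primes (m := k * 100) (by omega)).and
      (eventually_const_mul_log_le 216 hexp))
  obtain ⟨q₀, hq₀, hprime⟩ := Nat.exists_infinite_primes (max B 20000)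
  obtain ⟨U, d, hcov, hd, hU, hsum⟩ := exists_cover_of_hausdorffMeasure_eq_zero hs0 hzero
    (Real.rpow_pos_of_pos (Nat.cast_pos.2 hprime.pos) (-τ) : (0 : ℝ) < (q₀ : ℝ) ^ (-τ))
  obtain ⟨α, hα, hnot⟩ := exists_not_mem_cover hs0 hs1.le (by rw [hτ]; linarith)
    (by linarith) hkpos (by nlinarith) hd hU hprime ((le_max_right _ _).trans hq₀)
    (fun q hq => by
      rw [← pow_mul]
      exact hB q ((le_max_left _ _).trans (hq₀.trans hq))) hsum
  obtain ⟨i, hi⟩ := Set.mem_iUnion.1 (hcov hα)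
  exact hnot i hi

end SquareFractionalParts

open Filter MeasureTheory

/-- The set `{α : liminf n · log n · ‖α n²‖ > 0}` has Hausdorff dimension at least `2/3`;
in particular some real `α` satisfies `liminf n · log n · ‖α n²‖ > 0`, answering a
question of W. Schmidt in the negative. -/
theorem small_fractional_parts_of_squares :
    ENNReal.ofReal (2 / 3) ≤
        dimH {α : ℝ | 0 < liminf (fun n : ℕ =>
          (n : ℝ) * Real.log n * |α * n ^ 2 - round (α * (n : ℝ) ^ 2)|) atTop} ∧
    ∃ α : ℝ, 0 < liminf (fun n : ℕ =>
          (n : ℝ) * Real.log n * |α * n ^ 2 - round (α * (n : ℝ) ^ 2)|) atTop := by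
  refine ⟨SquareFractionalParts.le_dimH, ?_⟩
  by_contra! h
  have hempty : {α : ℝ | 0 < liminf (fun n : ℕ =>
      (n : ℝ) * Real.log n * |α * n ^ 2 - round (α * (n : ℝ) ^ 2)|) atTop} = ∅ :=
    Set.eq_empty_of_forall_notMem fun α hα => (h α).not_gt hα
  have := SquareFractionalParts.le_dimH
  rw [hempty, dimH_empty, nonpos_iff_eq_zero, ENNReal.ofReal_eq_zero] at this
  norm_num at this
end

section
/- Let (t_n)_{n≥0} be an increasing sequence of real numbers with t_0 ≥ 1 such that t_{n+1}/t_n = 1 + γ/n + O(n^{-(1+ε1)}) as n → ∞, for some constants γ > 0 and ε1 > 0. Set h(n) = n^{1+1/γ} (log n)^{2/γ}, c = 60 · log(2 + 1/γ), and δ_n = 1/(c · n · log n) for n ≥ 2. Then there is a constant C > 0 such that for all sufficiently large n and all integers m ≥ h(n) one has t_m/t_n ≥ C · n · (log n)²; consequently, for all sufficiently large n and all integers m ≥ h(n), t_m/t_n ≥ 1/δ_n = c · n · log n. -/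
/-- A lower bound for `log (1 + y)` when `1 + y` is close to `1 + a`. -/
lemma Real.le_log_of_abs_sub_one_sub_le {r a e : ℝ} (hr : 1 ≤ r) (h : |r - 1 - a| ≤ e) :
    a - e - (a + e) ^ 2 ≤ Real.log r := by
  obtain ⟨h₁, h₂⟩ := abs_le.mp h
  have hlog : 1 - r⁻¹ ≤ Real.log r := Real.one_sub_inv_le_log_of_pos (by linarith)
  have hinv : r - 1 - (r - 1) ^ 2 ≤ 1 - r⁻¹ := by
    have hr₀ : r ≠ 0 := by linarith
    have key : 1 - r⁻¹ - (r - 1 - (r - 1) ^ 2) = (r - 1) ^ 3 * r⁻¹ := by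
      field_simp
      ring
    have : 0 ≤ (r - 1) ^ 3 * r⁻¹ :=
      mul_nonneg (pow_nonneg (by linarith) 3) (inv_nonneg.mpr (by linarith))
    linarith
  have hsq : (r - 1) ^ 2 ≤ (a + e) ^ 2 := pow_le_pow_left₀ (by linarith) (by linarith) 2
  linarith

/-- If the increments of `s` are bounded below by `-g` with `g` nonnegative and summable, then `s`
cannot drop by more than `∑' k, g k`. -/
lemma sub_tsum_le_of_forall_sub_le_succ {s g : ℕ → ℝ} (hg : Summable g) (hg₀ : ∀ k, 0 ≤ g k)
    {n₀ : ℕ} (hs : ∀ k, n₀ ≤ k → s k - g k ≤ s (k + 1)) {n m : ℕ} (hn : n₀ ≤ n) (hnm : n ≤ m) :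
    s n - ∑' k, g k ≤ s m := by
  have hsum : s n - ∑ k ∈ Finset.Ico n m, g k ≤ s m := by
    induction m, hnm using Nat.le_induction with
    | base => simp
    | succ m hnm ih =>
      rw [Finset.sum_Ico_succ_top hnm]
      linarith [hs m (hn.trans hnm)]
  linarith [hg.sum_le_tsum (Finset.Ico n m) fun k _ => hg₀ k]

/-- A sequence with `t (n + 1) / t n = 1 + γ / n + O(n ^ (-(1 + ε)))` grows at least like
`n ^ γ`. -/
lemma exists_mul_rpow_le_div_of_ratio_asymp {t : ℕ → ℝ} {γ ε C : ℝ} (hγ : 0 < γ) (hε : 0 < ε)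
    (hmono : Monotone t) (hpos : ∀ n, 0 < t n)
    (hasymp : ∀ n : ℕ, 1 ≤ n →
      |t (n + 1) / t n - 1 - γ / n| ≤ C * (n : ℝ) ^ (-(1 + ε))) :
    ∃ K : ℝ, 0 < K ∧ ∀ n m : ℕ, 1 ≤ n → n ≤ m → K * ((m : ℝ) / n) ^ γ ≤ t m / t n := by
  have hC : 0 ≤ C := by
    have := (abs_nonneg _).trans (hasymp 1 le_rfl)
    simpa using this
  set g : ℕ → ℝ := fun n => C * (n : ℝ) ^ (-(1 + ε)) + (γ + C) ^ 2 * (n : ℝ) ^ (-2 : ℝ)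
  have hg : Summable g :=
    ((Real.summable_nat_rpow.mpr (by linarith)).mul_left C).add
      ((Real.summable_nat_rpow.mpr (by norm_num)).mul_left _)
  have hg₀ : ∀ k, 0 ≤ g k := fun k => by positivity
  have hs : ∀ k : ℕ, 1 ≤ k → (Real.log (t k) - γ * Real.log k) - g k ≤
      Real.log (t (k + 1)) - γ * Real.log (k + 1 : ℕ) := by
    intro k hk
    have hk₁ : (1 : ℝ) ≤ k := by exact_mod_cast hk
    have hk₀ : (0 : ℝ) < k := by linarith
    have hr : 1 ≤ t (k + 1) / t k := (one_le_div (hpos k)).mpr (hmono k.le_succ)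
    have h₁ := Real.le_log_of_abs_sub_one_sub_le hr (hasymp k hk)
    rw [Real.log_div (hpos _).ne' (hpos _).ne'] at h₁
    have h₂ : Real.log (k + 1 : ℕ) - Real.log k ≤ 1 / k := by
      rw [← Real.log_div (by positivity) hk₀.ne']
      refine (Real.log_le_sub_one_of_pos (by positivity)).trans_eq ?_
      push_cast
      field_simp
      ring
    have h₃ : (γ / k + C * (k : ℝ) ^ (-(1 + ε))) ^ 2 ≤ (γ + C) ^ 2 * (k : ℝ) ^ (-2 : ℝ) := by
      have h₄ : (k : ℝ) ^ (-(1 + ε)) ≤ (k : ℝ)⁻¹ := by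
        rw [← Real.rpow_neg_one]
        exact Real.rpow_le_rpow_of_exponent_le hk₁ (by linarith)
      have h₅ : (k : ℝ) ^ (-2 : ℝ) = (k : ℝ)⁻¹ ^ 2 := by
        rw [Real.rpow_neg hk₀.le, inv_pow]
        norm_cast
      rw [h₅, ← mul_pow, add_mul, div_eq_mul_inv]
      gcongr
    have h₆ : γ * (Real.log (k + 1 : ℕ) - Real.log k) ≤ γ / k := by
      rw [div_eq_mul_one_div]
      gcongr
    simp only [g]
    linarith
  refine ⟨Real.exp (-∑' k, g k), Real.exp_pos _, fun n m hn hnm => ?_⟩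
  have hn₀ : (0 : ℝ) < n := by exact_mod_cast hn
  have hm₀ : (0 : ℝ) < m := by exact_mod_cast hn.trans hnm
  have key := sub_tsum_le_of_forall_sub_le_succ (s := fun k => Real.log (t k) - γ * Real.log k)
    hg hg₀ hs hn hnm
  rw [Real.rpow_def_of_pos (div_pos hm₀ hn₀), ← Real.exp_add,
    ← Real.le_log_iff_exp_le (div_pos (hpos m) (hpos n)),
    Real.log_div (hpos _).ne' (hpos _).ne', Real.log_div hm₀.ne' hn₀.ne']
  linarith


/-- Estimate (4): with `h n = n^{1+1/γ} (log n)^{2/γ}`, `c = 60 log(2 + 1/γ)` and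
`δ n = 1/(c n log n)`, there is `C > 0` such that for all sufficiently large `n` and all
integers `m ≥ h n` one has `t m / t n ≥ C n (log n)²`; consequently for all sufficiently
large `n` and all integers `m ≥ h n` one has `t m / t n ≥ 1/δ n = c n log n`. -/
theorem sequence_ratio_large
    (t : ℕ → ℝ) (γ ε₁ : ℝ) (hγ : 0 < γ) (hε₁ : 0 < ε₁)
    (hmono : StrictMono t) (ht0 : 1 ≤ t 0)
    (hasymp : ∃ C' : ℝ, ∀ n : ℕ, 1 ≤ n →
      |t (n + 1) / t n - 1 - γ / n| ≤ C' * (n : ℝ) ^ (-(1 + ε₁)))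
    (h : ℕ → ℝ) (hh : ∀ n, h n = (n : ℝ) ^ (1 + 1 / γ) * Real.log n ^ (2 / γ))
    (c : ℝ) (hc : c = 60 * Real.log (2 + 1 / γ))
    (δ : ℕ → ℝ) (hδ : ∀ n, δ n = 1 / (c * n * Real.log n)) :
    (∃ C : ℝ, 0 < C ∧ ∃ N : ℕ, ∀ n : ℕ, N ≤ n → ∀ m : ℕ, h n ≤ (m : ℝ) →
        C * ((n : ℝ) * Real.log n ^ 2) ≤ t m / t n) ∧
    (∃ N : ℕ, ∀ n : ℕ, N ≤ n → ∀ m : ℕ, h n ≤ (m : ℝ) →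
        1 / δ n ≤ t m / t n ∧ 1 / δ n = c * n * Real.log n) := by
  have hpos : ∀ n, 0 < t n := fun n =>
    zero_lt_one.trans_le (ht0.trans (hmono.monotone n.zero_le))
  obtain ⟨C', hC'⟩ := hasymp
  obtain ⟨K, hK, hKt⟩ :=
    exists_mul_rpow_le_div_of_ratio_asymp hγ hε₁ hmono.monotone hpos hC'
  have hlog : Filter.Tendsto (fun n : ℕ => Real.log n) Filter.atTop Filter.atTop :=
    Real.tendsto_log_atTop.comp tendsto_natCast_atTop_atTop
  have main : ∀ n : ℕ, 1 ≤ n → 1 ≤ Real.log n → ∀ m : ℕ, h n ≤ (m : ℝ) →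
      K * ((n : ℝ) * Real.log n ^ 2) ≤ t m / t n := by
    intro n hn hL m hm
    have hn₁ : (1 : ℝ) ≤ n := by exact_mod_cast hn
    have hn₀ : (0 : ℝ) < n := by linarith
    have hL₀ : 0 ≤ Real.log n := by linarith
    have hsplit : h n = n * ((n : ℝ) ^ (1 / γ) * Real.log n ^ (2 / γ)) := by
      rw [hh, Real.rpow_add hn₀, Real.rpow_one, mul_assoc]
    rw [hsplit] at hm
    have hnm : n ≤ m := by
      have h₁ : 1 ≤ (n : ℝ) ^ (1 / γ) * Real.log n ^ (2 / γ) :=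
        one_le_mul_of_one_le_of_one_le (Real.one_le_rpow hn₁ (by positivity))
          (Real.one_le_rpow hL (by positivity))
      exact_mod_cast (le_mul_of_one_le_right hn₀.le h₁).trans hm
    refine le_trans ?_ (hKt n m hn hnm)
    have hpow : (n : ℝ) * Real.log n ^ 2 =
        ((n : ℝ) ^ (1 / γ) * Real.log n ^ (2 / γ)) ^ γ := by
      rw [Real.mul_rpow (by positivity) (by positivity), ← Real.rpow_mul hn₀.le,
        ← Real.rpow_mul hL₀, div_mul_cancel₀ _ hγ.ne', div_mul_cancel₀ _ hγ.ne', Real.rpow_one,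
        Real.rpow_two]
    rw [hpow]
    gcongr
    rwa [le_div_iff₀' hn₀]
  refine ⟨⟨K, hK, ?_⟩, ?_⟩
  · obtain ⟨N, hN⟩ := Filter.eventually_atTop.mp
      ((Filter.eventually_ge_atTop 1).and (hlog.eventually_ge_atTop 1))
    exact ⟨N, fun n hn => main n (hN n hn).1 (hN n hn).2⟩
  · obtain ⟨N, hN⟩ := Filter.eventually_atTop.mp
      (((Filter.eventually_ge_atTop 1).and (hlog.eventually_ge_atTop 1)).and
        (hlog.eventually_ge_atTop (c / K)))
    refine ⟨N, fun n hn m hm => ?_⟩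
    obtain ⟨⟨hn₁, hL⟩, hcK⟩ := hN n hn
    have hδn : 1 / δ n = c * n * Real.log n := by rw [hδ, one_div_one_div]
    refine ⟨?_, hδn⟩
    rw [hδn]
    rw [div_le_iff₀' hK] at hcK
    calc c * n * Real.log n ≤ K * Real.log n * n * Real.log n := by gcongr
      _ = K * ((n : ℝ) * Real.log n ^ 2) := by ring
      _ ≤ t m / t n := main n hn₁ hL m hm
end

section
/- Let (t_n)_{n≥0} be an increasing sequence of real numbers with t_0 ≥ 1 such that t_{n+1}/t_n = 1 + γ/n + O(n^{-(1+ε1)}) as n → ∞, for some constants γ > 0 and ε1 > 0. Set h(x) = x^{1+1/γ} (log x)^{2/γ}, c = 60 · log(2 + 1/γ), and δ_n = 1/(c · n · log n). Fix ε2 > 0, let n_0 be sufficiently large, and define n_{j+1} = ⌈h(n_j)⌉. Then there exists a constant C such that for all 0 < v < 1 and all k ≥ 2, the k-th term satisfies t_{n_k}^v · δ_{n_{k-1}} / (t_{n_{k-1}} · δ_{n_k}^v) ≤ C · n_{k-1}^ω, where ω = ((1 + 1/γ + ε2)·v − 1)(γ + 1). -/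
/-- The quadratic error bound for the logarithm on the nonnegative half-line. -/
lemma abs_log_one_add_sub_self_le_sq {x : ℝ} (hx : 0 ≤ x) : |Real.log (1 + x) - x| ≤ x ^ 2 := by
  have h1 : Real.log (1 + x) ≤ x := by
    have := Real.log_le_sub_one_of_pos (show 0 < 1 + x by linarith)
    linarith
  have h2 : 1 - (1 + x)⁻¹ ≤ Real.log (1 + x) := Real.one_sub_inv_le_log_of_pos (by linarith)
  have h3 : x - x ^ 2 ≤ 1 - (1 + x)⁻¹ := by
    rw [← sub_nonneg]
    have : 1 - (1 + x)⁻¹ - (x - x ^ 2) = x ^ 3 / (1 + x) := by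
      have : 1 + x ≠ 0 := by positivity
      field_simp
      ring
    rw [this]
    positivity
  rw [abs_le]
  constructor <;> nlinarith [sq_nonneg x]

/-- A positive increasing sequence whose consecutive ratios are `1 + γ / n` up to a summable error
grows like `n ^ γ`, up to constant factors. -/
lemma exists_rpow_bounds_of_ratio {t : ℕ → ℝ} {γ ε C : ℝ} (hγ : 0 < γ) (hε : 0 < ε)
    (hmono : StrictMono t) (hpos : ∀ n, 0 < t n)
    (hratio : ∀ n : ℕ, 1 ≤ n →
      |t (n + 1) / t n - 1 - γ / n| ≤ C * (n : ℝ) ^ (-(1 + ε))) :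
    ∃ A B : ℝ, 0 < A ∧ 0 < B ∧
      ∀ n : ℕ, 1 ≤ n → A * (n : ℝ) ^ γ ≤ t n ∧ t n ≤ B * (n : ℝ) ^ γ := by
  have hC : 0 ≤ C := by
    have h := (abs_nonneg _).trans (hratio 1 le_rfl)
    simpa using h
  let u : ℕ → ℝ := fun n => Real.log (t (n + 1)) - γ * Real.log ((n + 1 : ℕ) : ℝ)
  let d : ℕ → ℝ := fun n => C * (n : ℝ) ^ (-(1 + ε)) + ((γ + C) ^ 2 + γ) * (n : ℝ) ^ (-2 : ℝ)
  have hd : Summable d :=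
    ((Real.summable_nat_rpow.2 (by linarith)).mul_left _).add
      ((Real.summable_nat_rpow.2 (by norm_num)).mul_left _)
  have hstep : ∀ n, dist (u n) (u n.succ) ≤ d (n + 1) := by
    intro n
    obtain ⟨m, hm⟩ : ∃ m, m = n + 1 := ⟨_, rfl⟩
    have hm1 : 1 ≤ m := by omega
    have hmR : (1 : ℝ) ≤ m := by exact_mod_cast hm1
    have hm0 : (0 : ℝ) < m := by linarith
    set x := t (m + 1) / t m - 1 with hx
    have hx0 : 0 ≤ x := by
      have := (one_le_div (hpos m)).2 (hmono (Nat.lt_succ_self m)).le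
      simp only [hx]; linarith
    have hr := hratio m hm1
    have hpow : (m : ℝ) ^ (-(1 + ε)) ≤ 1 / m := by
      rw [one_div, ← Real.rpow_neg_one]
      exact Real.rpow_le_rpow_of_exponent_le hmR (by linarith)
    have hxle : x ≤ (γ + C) / m := by
      have h1 := (abs_le.1 hr).2
      have h2 := mul_le_mul_of_nonneg_left hpow hC
      have h3 : (γ + C) / m = γ / m + C * (1 / m) := by ring
      linarith
    have hx2 : x ^ 2 ≤ (γ + C) ^ 2 * (m : ℝ) ^ (-2 : ℝ) := by
      have h := pow_le_pow_left₀ hx0 hxle 2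
      rw [Real.rpow_neg hm0.le, Real.rpow_two]
      rwa [div_pow, div_eq_mul_inv] at h
    have hl1 := abs_log_one_add_sub_self_le_sq hx0
    have hl2 := abs_log_one_add_sub_self_le_sq (show (0 : ℝ) ≤ 1 / m by positivity)
    have hinv : (1 / (m : ℝ)) ^ 2 = (m : ℝ) ^ (-2 : ℝ) := by
      rw [Real.rpow_neg hm0.le, Real.rpow_two]; simp
    rw [hinv] at hl2
    have e1 : Real.log (1 + x) = Real.log (t (m + 1)) - Real.log (t m) := by
      rw [← Real.log_div (hpos _).ne' (hpos _).ne']; congr 1; simp [hx]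
    have e2 : Real.log (1 + 1 / (m : ℝ)) = Real.log ((m + 1 : ℕ) : ℝ) - Real.log m := by
      rw [← Real.log_div (by positivity) hm0.ne']; congr 1; push_cast; field_simp
    have e3 : dist (u n) (u n.succ) =
        |(Real.log (1 + x) - x) + (x - γ / m) - γ * (Real.log (1 + 1 / (m : ℝ)) - 1 / m)| := by
      rw [dist_comm, Real.dist_eq, e1, e2]
      simp only [u, hm, Nat.succ_eq_add_one]
      congr 1; ring
    rw [e3, ← hm]
    have habs := abs_sub ((Real.log (1 + x) - x) + (x - γ / m))
      (γ * (Real.log (1 + 1 / (m : ℝ)) - 1 / m))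
    have habs' := abs_add_le (Real.log (1 + x) - x) (x - γ / m)
    rw [abs_mul, abs_of_pos hγ] at habs
    have := mul_le_mul_of_nonneg_left hl2 hγ.le
    simp only [d]
    linarith
  have hcauchy : CauchySeq u :=
    cauchySeq_of_dist_le_of_summable _ hstep ((summable_nat_add_iff 1).2 hd)
  obtain ⟨R, hR⟩ := hcauchy.isBounded_range.exists_norm_le
  refine ⟨Real.exp (-R), Real.exp R, Real.exp_pos _, Real.exp_pos _, fun n hn => ?_⟩
  obtain ⟨m, rfl⟩ : ∃ m, n = m + 1 := ⟨n - 1, by omega⟩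
  have hb := abs_le.1 (hR (u m) ⟨m, rfl⟩)
  have hmp : (0 : ℝ) < ((m + 1 : ℕ) : ℝ) := by positivity
  have ht : t (m + 1) = Real.exp (u m) * ((m + 1 : ℕ) : ℝ) ^ γ := by
    rw [Real.rpow_def_of_pos hmp, ← Real.exp_add, ← Real.exp_log (hpos (m + 1))]
    simp only [u]
    congr 1; ring
  rw [ht]
  constructor
  · gcongr; exact hb.1
  · gcongr; exact hb.2

/-- For `m` large, passing from `m` to `n = ⌈m ^ (1 + 1/γ) (log m) ^ (2/γ)⌉` does not decrease,
and `n ^ (γ + 1) log n` exceeds `m ^ ((1 + 1/γ) (γ + 1))` by at most an arbitrarily small power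
of `m`. -/
lemma eventually_ceil_step_bounds {γ ε : ℝ} (hγ : 0 < γ) (hε : 0 < ε) :
    ∀ᶠ m : ℕ in Filter.atTop, ∀ n : ℕ,
      n = ⌈(m : ℝ) ^ (1 + 1 / γ) * Real.log m ^ (2 / γ)⌉₊ →
      m ≤ n ∧ (n : ℝ) ^ (γ + 1) * Real.log n ≤
        2 ^ (γ + 1) * (2 + 3 / γ) * (m : ℝ) ^ ((1 + 1 / γ + ε) * (γ + 1)) := by
  have hlog : ∀ᶠ m : ℕ in Filter.atTop,
      Real.log m ^ (2 / γ * (γ + 1) + 1) ≤ (m : ℝ) ^ (ε * (γ + 1)) := by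
    have h := (isLittleO_log_rpow_rpow_atTop (s := ε * (γ + 1)) (2 / γ * (γ + 1) + 1)
      (by positivity)).bound one_pos
    filter_upwards [tendsto_natCast_atTop_atTop.eventually h,
      Filter.eventually_ge_atTop 1] with m hm hm1
    have : (1 : ℝ) ≤ m := by exact_mod_cast hm1
    rw [one_mul, Real.norm_of_nonneg (Real.rpow_nonneg (Real.log_nonneg this) _),
      Real.norm_of_nonneg (by positivity)] at hm
    exact hm
  have hone : ∀ᶠ m : ℕ in Filter.atTop, 1 ≤ Real.log m :=
    (Real.tendsto_log_atTop.comp tendsto_natCast_atTop_atTop).eventually_ge_atTop 1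
  filter_upwards [hlog, hone, Filter.eventually_ge_atTop 2] with m hpow hl hm2 n hn
  have hm : (2 : ℝ) ≤ m := by exact_mod_cast hm2
  have hm0 : (0 : ℝ) < m := by linarith
  have hl0 : 0 < Real.log m := by linarith
  set H := (m : ℝ) ^ (1 + 1 / γ) * Real.log m ^ (2 / γ) with hH
  have hmH : (m : ℝ) ≤ H := by
    have h1 : (m : ℝ) ≤ (m : ℝ) ^ (1 + 1 / γ) :=
      Real.self_le_rpow_of_one_le (by linarith) (by simp [hγ.le])
    have h2 : 1 ≤ Real.log m ^ (2 / γ) := Real.one_le_rpow hl (by positivity)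
    exact h1.trans (le_mul_of_one_le_right (by positivity) h2)
  have hHn : H ≤ n := hn ▸ Nat.le_ceil H
  have hn2 : (n : ℝ) ≤ 2 * H := by
    have := Nat.ceil_lt_add_one (show 0 ≤ H by linarith)
    rw [← hn] at this
    linarith
  have hn0 : (0 : ℝ) < n := by linarith
  refine ⟨by exact_mod_cast hmH.trans hHn, ?_⟩
  have hlogn : Real.log n ≤ (2 + 3 / γ) * Real.log m := by
    have h1 : Real.log n ≤ Real.log (2 * H) := Real.log_le_log hn0 hn2
    rw [Real.log_mul two_ne_zero (by linarith), hH, Real.log_mul (by positivity) (by positivity),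
      Real.log_rpow hm0, Real.log_rpow hl0] at h1
    have h2 : Real.log 2 ≤ Real.log m := Real.log_le_log two_pos hm
    have h3 : Real.log (Real.log m) ≤ Real.log m := Real.log_le_self hl0.le
    have h4 := mul_le_mul_of_nonneg_left h3 (show 0 ≤ 2 / γ by positivity)
    have h5 : (2 + 3 / γ) * Real.log m =
        Real.log m + ((1 + 1 / γ) * Real.log m + 2 / γ * Real.log m) := by ring
    linarith
  calc (n : ℝ) ^ (γ + 1) * Real.log n
      ≤ (2 * H) ^ (γ + 1) * ((2 + 3 / γ) * Real.log m) := by gcongr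
    _ = 2 ^ (γ + 1) * (2 + 3 / γ) * (m : ℝ) ^ ((1 + 1 / γ) * (γ + 1)) *
          Real.log m ^ (2 / γ * (γ + 1) + 1) := by
        rw [Real.mul_rpow two_pos.le (by linarith), hH, Real.mul_rpow (by positivity)
          (by positivity), ← Real.rpow_mul hm0.le, ← Real.rpow_mul hl0.le,
          Real.rpow_add_one hl0.ne' (2 / γ * (γ + 1))]
        ring
    _ ≤ 2 ^ (γ + 1) * (2 + 3 / γ) * (m : ℝ) ^ ((1 + 1 / γ) * (γ + 1)) *
          (m : ℝ) ^ (ε * (γ + 1)) := by gcongr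
    _ = _ := by
        rw [mul_assoc, ← Real.rpow_add hm0]
        congr 2; ring


/-- The term estimate for the series (9): with `h x = x^{1+1/γ} (log x)^{2/γ}`,
`c = 60 log(2+1/γ)`, `δ n = 1/(c n log n)` and `n_{j+1} = ⌈h n_j⌉` starting from a
sufficiently large `n₀`, there is a constant `C` such that for all `0 < v < 1` and
`k ≥ 2` one has
`t_{n_k}^v δ_{n_{k-1}} / (t_{n_{k-1}} δ_{n_k}^v) ≤ C n_{k-1}^ω` where
`ω = ((1+1/γ+ε₂) v - 1)(γ+1)`. -/
theorem series_term_estimate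
    (t : ℕ → ℝ) (γ ε₁ ε₂ : ℝ) (hγ : 0 < γ) (hε₁ : 0 < ε₁) (hε₂ : 0 < ε₂)
    (hmono : StrictMono t) (ht0 : 1 ≤ t 0)
    (hasymp : ∃ C' : ℝ, ∀ n : ℕ, 1 ≤ n →
      |t (n + 1) / t n - 1 - γ / n| ≤ C' * (n : ℝ) ^ (-(1 + ε₁)))
    (c : ℝ) (hc : c = 60 * Real.log (2 + 1 / γ))
    (δ : ℕ → ℝ) (hδ : ∀ n, δ n = 1 / (c * n * Real.log n)) :
    ∃ N : ℕ, ∀ n₀ : ℕ, N ≤ n₀ → ∀ s : ℕ → ℕ, s 0 = n₀ →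
      (∀ j : ℕ, s (j + 1) = ⌈(s j : ℝ) ^ (1 + 1 / γ) * Real.log (s j) ^ (2 / γ)⌉₊) →
      ∃ C : ℝ, ∀ v : ℝ, 0 < v → v < 1 → ∀ k : ℕ, 2 ≤ k →
        t (s k) ^ v * δ (s (k - 1)) / (t (s (k - 1)) * δ (s k) ^ v) ≤
          C * (s (k - 1) : ℝ) ^ (((1 + 1 / γ + ε₂) * v - 1) * (γ + 1)) := by
  obtain ⟨C', hC'⟩ := hasymp
  have hpos : ∀ n, 0 < t n := fun n =>
    (zero_lt_one.trans_le ht0).trans_le (hmono.monotone (Nat.zero_le n))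
  obtain ⟨A, B, hA, hB, hAB⟩ := exists_rpow_bounds_of_ratio hγ hε₁ hmono hpos hC'
  obtain ⟨N, hN⟩ := Filter.eventually_atTop.1 (eventually_ceil_step_bounds hγ hε₂)
  have hc0 : 0 < c := by
    have : 0 < 1 / γ := by positivity
    rw [hc]
    exact mul_pos (by norm_num) (Real.log_pos (by linarith))
  refine ⟨max N 3, fun n₀ hn₀ s hs0 hs => ?_⟩
  have hge : ∀ j, max N 3 ≤ s j := by
    intro j
    induction j with
    | zero => rwa [hs0]
    | succ j ih => exact ih.trans (hN (s j) (le_of_max_le_left ih) _ (hs j)).1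
  set K := max 1 (B * c * (2 ^ (γ + 1) * (2 + 3 / γ))) with hK
  have hK1 : 1 ≤ K := le_max_left _ _
  refine ⟨K / (A * c), fun v hv0 hv1 k hk => ?_⟩
  obtain ⟨j, rfl⟩ : ∃ j, k = j + 1 := ⟨k - 1, by omega⟩
  rw [Nat.add_sub_cancel]
  obtain ⟨-, hstep⟩ := hN (s j) (le_of_max_le_left (hge j)) _ (hs j)
  have hm3 : 3 ≤ s j := le_of_max_le_right (hge j)
  have hn3 : 3 ≤ s (j + 1) := le_of_max_le_right (hge (j + 1))
  generalize s j = m at *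
  generalize s (j + 1) = n at *
  have hm : (3 : ℝ) ≤ m := by exact_mod_cast hm3
  have hn : (3 : ℝ) ≤ n := by exact_mod_cast hn3
  have hm0 : (0 : ℝ) < m := by linarith
  have hn0 : (0 : ℝ) < n := by linarith
  have hlm : 1 ≤ Real.log m := by
    rw [Real.le_log_iff_exp_le hm0]
    linarith [Real.exp_one_lt_d9]
  have hln : 0 < Real.log n := Real.log_pos (by linarith)
  have hX : t n * (c * n * Real.log n) ≤ K * (m : ℝ) ^ ((1 + 1 / γ + ε₂) * (γ + 1)) := by
    calc t n * (c * n * Real.log n)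
        ≤ B * (n : ℝ) ^ γ * (c * n * Real.log n) := by
          gcongr; exact (hAB n (by omega)).2
      _ = B * c * ((n : ℝ) ^ (γ + 1) * Real.log n) := by
          rw [Real.rpow_add_one hn0.ne']; ring
      _ ≤ B * c * (2 ^ (γ + 1) * (2 + 3 / γ) * (m : ℝ) ^ ((1 + 1 / γ + ε₂) * (γ + 1))) := by
          gcongr
      _ = B * c * (2 ^ (γ + 1) * (2 + 3 / γ)) * (m : ℝ) ^ ((1 + 1 / γ + ε₂) * (γ + 1)) := by
          ring
      _ ≤ _ := by gcongr; exact le_max_right _ _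
  have hXv : (t n * (c * n * Real.log n)) ^ v ≤
      K * (m : ℝ) ^ ((1 + 1 / γ + ε₂) * (γ + 1) * v) := by
    have htn := hpos n
    calc (t n * (c * n * Real.log n)) ^ v
        ≤ (K * (m : ℝ) ^ ((1 + 1 / γ + ε₂) * (γ + 1))) ^ v := by gcongr
      _ = K ^ v * (m : ℝ) ^ ((1 + 1 / γ + ε₂) * (γ + 1) * v) := by
          rw [Real.mul_rpow (by positivity) (by positivity), ← Real.rpow_mul hm0.le]
      _ ≤ _ := by
          gcongr
          exact Real.rpow_le_self_of_one_le hK1 hv1.le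
  have hY : A * c * (m : ℝ) ^ (γ + 1) ≤ t m * (c * m * Real.log m) := by
    have htm := hpos m
    calc A * c * (m : ℝ) ^ (γ + 1) = A * (m : ℝ) ^ γ * (c * m * 1) := by
          rw [Real.rpow_add_one hm0.ne']; ring
      _ ≤ t m * (c * m * Real.log m) := by
          gcongr; exact (hAB m (by omega)).1
  have hterm : t n ^ v * δ m / (t m * δ n ^ v) =
      (t n * (c * n * Real.log n)) ^ v / (t m * (c * m * Real.log m)) := by
    have hq : 0 < c * n * Real.log n := by positivity
    rw [hδ, hδ, one_div, one_div, Real.inv_rpow hq.le, Real.mul_rpow (hpos n).le hq.le]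
    have := Real.rpow_pos_of_pos hq v
    have := hpos m
    field_simp
  rw [hterm]
  calc (t n * (c * n * Real.log n)) ^ v / (t m * (c * m * Real.log m))
      ≤ K * (m : ℝ) ^ ((1 + 1 / γ + ε₂) * (γ + 1) * v) / (A * c * (m : ℝ) ^ (γ + 1)) := by
        gcongr
    _ = K / (A * c) * (m : ℝ) ^ (((1 + 1 / γ + ε₂) * v - 1) * (γ + 1)) := by
        rw [mul_div_mul_comm, ← Real.rpow_sub hm0]
        congr 2; ring
end

section
/- (Lemma 1) Let (t_n)_{n≥0} be an increasing sequence of real numbers with t_0 ≥ 1 such that t_{n+1}/t_n = 1 + γ/n + O(n^{-(1+ε1)}) as n → ∞, for some constants γ > 0 and ε1 > 0. Set h(x) = x^{1+1/γ} (log x)^{2/γ}, c = 60 · log(2 + 1/γ), δ_n = 1/(c · n · log n), E_n = ⋃_{a=0}^{⌈t_n⌉} [a/t_n − δ_n/t_n, a/t_n + δ_n/t_n] ∩ [0,1], l_n = ⌊log₂(2 t_n/δ_n)⌋, and A_n = the union of all dyadic intervals [b/2^{l_n}, (b+1)/2^{l_n}] (b ∈ ℤ) that intersect E_n. Then for all sufficiently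 large n the following holds: for every dyadic interval J = [a/2^{l_n}, (a+1)/2^{l_n}] ⊆ [0,1] (a ∈ ℤ) and every integer m ≥ h(n), the Lebesgue measure of J ∩ A_m satisfies μ(J ∩ A_m) ≤ 5 δ_m · μ(J). -/
open MeasureTheory

/-- A set covered by the `2δ/T`-neighbourhoods of the points of `T⁻¹ℤ` meets an interval of length
`L` in measure at most `5δL`, provided `20 ≤ TL` and `0 ≤ δ ≤ 1`. -/
theorem volume_Icc_inter_le_of_near_lattice {T δ L x : ℝ} (hT : 0 < T) (hδ0 : 0 ≤ δ) (hδ1 : δ ≤ 1)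
    (hL : 20 ≤ T * L) {A : Set ℝ} (hA : ∀ y ∈ A, ∃ a : ℤ, |y - a / T| ≤ 2 * (δ / T)) :
    volume (Set.Icc x (x + L) ∩ A) ≤ ENNReal.ofReal (5 * δ * L) := by
  set F : Finset ℤ := Finset.Icc ⌈T * x - 2 * δ⌉ ⌊T * (x + L) + 2 * δ⌋
  have hsub : Set.Icc x (x + L) ∩ A ⊆
      ⋃ a ∈ F, Set.Icc ((a : ℝ) / T - 2 * (δ / T)) (a / T + 2 * (δ / T)) := by
    rintro y ⟨⟨hy1, hy2⟩, hyA⟩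
    obtain ⟨a, ha⟩ := hA y hyA
    obtain ⟨h1, h2⟩ := abs_le.mp ha
    have e1 : T * (a / T) = a := by field_simp
    have e2 : T * (δ / T) = δ := by field_simp
    have m1 := mul_le_mul_of_nonneg_left h1 hT.le
    have m2 := mul_le_mul_of_nonneg_left h2 hT.le
    have m3 := mul_le_mul_of_nonneg_left hy1 hT.le
    have m4 := mul_le_mul_of_nonneg_left hy2 hT.le
    simp only [Set.mem_iUnion, Set.mem_Icc]
    refine ⟨a, Finset.mem_Icc.mpr ⟨Int.ceil_le.mpr ?_, Int.le_floor.mpr ?_⟩, ?_, ?_⟩ <;> nlinarith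
  have hcard : (F.card : ℝ) ≤ T * L + 4 * δ + 1 := by
    have h1 := Int.le_ceil (T * x - 2 * δ)
    have h2 := Int.floor_le (T * (x + L) + 2 * δ)
    have h3 : (F.card : ℝ) = (F.card : ℤ) := by norm_cast
    rw [h3, Int.card_Icc, Int.toNat_eq_max]
    push_cast
    apply max_le <;> nlinarith
  calc volume (Set.Icc x (x + L) ∩ A)
      ≤ volume (⋃ a ∈ F, Set.Icc ((a : ℝ) / T - 2 * (δ / T)) (a / T + 2 * (δ / T))) :=
        measure_mono hsub
    _ ≤ ∑ a ∈ F, volume (Set.Icc ((a : ℝ) / T - 2 * (δ / T)) (a / T + 2 * (δ / T))) :=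
        measure_biUnion_finset_le _ _
    _ = ENNReal.ofReal (F.card * (4 * (δ / T))) := by
        rw [ENNReal.ofReal_mul (by positivity), ENNReal.ofReal_natCast, ← nsmul_eq_mul]
        rw [← Finset.sum_const]
        refine Finset.sum_congr rfl fun a _ => ?_
        rw [Real.volume_Icc]
        congr 1
        ring
    _ ≤ ENNReal.ofReal (5 * δ * L) := by
        apply ENNReal.ofReal_le_ofReal
        calc (F.card : ℝ) * (4 * (δ / T)) ≤ (5 / 4 * (T * L)) * (4 * (δ / T)) := by
              gcongr
              linarith
          _ = 5 * δ * L := by field_simp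

/-- If `t (k + 1) / t k = 1 + γ / k + O(k ^ (-(1 + ε)))`, then `t m / t n` is bounded below by a
constant multiple of `(m / n) ^ γ`. -/
theorem exists_mul_rpow_le_of_ratio {t : ℕ → ℝ} {γ ε : ℝ} (hγ : 0 < γ) (hε : 0 < ε)
    (hmono : Monotone t) (ht0 : 0 < t 0)
    (hasymp : ∃ C : ℝ, ∀ n : ℕ, 1 ≤ n →
      |t (n + 1) / t n - 1 - γ / n| ≤ C * (n : ℝ) ^ (-(1 + ε))) :
    ∃ K : ℝ, 0 < K ∧ ∀ n m : ℕ, 1 ≤ n → n ≤ m → K * ((m : ℝ) / n) ^ γ ≤ t m / t n := by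
  obtain ⟨C, hC⟩ := hasymp
  have htpos : ∀ k, 0 < t k := fun k => ht0.trans_le (hmono (Nat.zero_le k))
  have hC0 : 0 ≤ C := by simpa using (abs_nonneg _).trans (hC 1 le_rfl)
  set w : ℕ → ℝ := fun k => C * (k : ℝ) ^ (-(1 + ε)) + (γ + C) ^ 2 * (k : ℝ) ^ (-2 : ℝ) with hw
  have hw0 : ∀ k, 0 ≤ w k := fun k => by positivity
  have hsum : Summable w :=
    ((Real.summable_nat_rpow.mpr (by linarith)).mul_left C).add
      ((Real.summable_nat_rpow.mpr (by norm_num)).mul_left _)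
  have hstep : ∀ k : ℕ, 1 ≤ k →
      γ * Real.log (k + 1 : ℕ) - γ * Real.log k - w k ≤ Real.log (t (k + 1)) - Real.log (t k) := by
    intro k hk
    have hk0 : (0 : ℝ) < k := by exact_mod_cast hk
    have hk1 : (1 : ℝ) ≤ k := by exact_mod_cast hk
    obtain ⟨h1, h2⟩ := abs_le.mp (hC k hk)
    set q := t (k + 1) / t k with hq
    have hq1 : 1 ≤ q := (one_le_div (htpos k)).mpr (hmono (Nat.le_succ k))
    have hp : (k : ℝ) ^ (-(1 + ε)) ≤ 1 / k := by
      rw [one_div, ← Real.rpow_neg_one]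
      exact Real.rpow_le_rpow_of_exponent_le hk1 (by linarith)
    have hp2 : (k : ℝ) ^ (-2 : ℝ) = (1 / k) ^ 2 := by
      rw [Real.rpow_neg hk0.le, show (2 : ℝ) = (2 : ℕ) by norm_num, Real.rpow_natCast]
      simp
    have hu : q - 1 ≤ (γ + C) * (1 / k) := by
      have := mul_le_mul_of_nonneg_left hp hC0
      have e : γ / k = γ * (1 / k) := by ring
      linarith
    have hu2 : (q - 1) ^ 2 ≤ (γ + C) ^ 2 * (k : ℝ) ^ (-2 : ℝ) := by
      rw [hp2, ← mul_pow]
      exact pow_le_pow_left₀ (by linarith) hu 2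
    have hlog : q - 1 - (q - 1) ^ 2 ≤ Real.log q := by
      refine le_trans ?_ (Real.one_sub_inv_le_log_of_pos (by linarith))
      have : 1 - q⁻¹ - (q - 1 - (q - 1) ^ 2) = (q - 1) ^ 3 / q := by
        field_simp
        ring
      have : 0 ≤ (q - 1) ^ 3 / q := div_nonneg (pow_nonneg (by linarith) 3) (by linarith)
      linarith
    have hlogk : Real.log (k + 1 : ℕ) - Real.log k ≤ 1 / k := by
      rw [← Real.log_div (by positivity) hk0.ne']
      refine (Real.log_le_sub_one_of_pos (by positivity)).trans_eq ?_
      push_cast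
      field_simp
      ring
    rw [← Real.log_div (htpos _).ne' (htpos _).ne', ← hq]
    have := mul_le_mul_of_nonneg_left hlogk hγ.le
    have e : γ / k = γ * (1 / k) := by ring
    simp only [hw]
    linarith
  have hind : ∀ n m : ℕ, 1 ≤ n → n ≤ m →
      γ * Real.log m - γ * Real.log n - ∑ k ∈ Finset.Ico n m, w k
        ≤ Real.log (t m) - Real.log (t n) := by
    intro n m hn hnm
    induction m, hnm using Nat.le_induction with
    | base => simp
    | succ k hk ih =>
      rw [Finset.sum_Ico_succ_top hk]
      have := hstep k (hn.trans hk)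
      linarith
  refine ⟨Real.exp (-∑' k, w k), Real.exp_pos _, fun n m hn hnm => ?_⟩
  have hn0 : (0 : ℝ) < n := by exact_mod_cast hn
  have hm0 : (0 : ℝ) < m := by exact_mod_cast hn.trans hnm
  have h1 := hind n m hn hnm
  have h2 : ∑ k ∈ Finset.Ico n m, w k ≤ ∑' k, w k := hsum.sum_le_tsum _ fun k _ => hw0 k
  rw [Real.rpow_def_of_pos (by positivity), ← Real.exp_add,
    ← Real.le_log_iff_exp_le (div_pos (htpos _) (htpos _)), Real.log_div hm0.ne' hn0.ne',
    Real.log_div (htpos _).ne' (htpos _).ne']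
  linarith

/-- The dyadic scale `⌊log₂ (2x)⌋` satisfies `x < 2 ^ ⌊log₂ (2x)⌋ ≤ 2x`. -/
theorem two_zpow_floor_logb_two_mul {x : ℝ} (hx : 0 < x) :
    x < 2 ^ ⌊Real.logb 2 (2 * x)⌋ ∧ (2 : ℝ) ^ ⌊Real.logb 2 (2 * x)⌋ ≤ 2 * x := by
  have h1 := Int.floor_le (Real.logb 2 (2 * x))
  have h2 := Int.lt_floor_add_one (Real.logb 2 (2 * x))
  rw [Real.le_logb_iff_rpow_le one_lt_two (by positivity), Real.rpow_intCast] at h1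
  rw [Real.logb_lt_iff_lt_rpow one_lt_two (by positivity), Real.rpow_add two_pos,
    Real.rpow_intCast, Real.rpow_one] at h2
  exact ⟨by linarith, h1⟩

/-- **Lemma 1.** With `δ n = 1/(c n log n)`, `c = 60 log(2+1/γ)`,
`E n = ⋃_{a=0}^{⌈t n⌉} [a/t n − δ n/t n, a/t n + δ n/t n] ∩ [0,1]`,
`l n = ⌊log₂(2 t n / δ n)⌋`, and `A n` the union of all dyadic intervals
`[b/2^{l n}, (b+1)/2^{l n}]` meeting `E n`: for all sufficiently large `n`, every dyadic
interval `J = [a/2^{l n}, (a+1)/2^{l n}] ⊆ [0,1]` and every integer `m ≥ h n` satisfy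
`μ(J ∩ A m) ≤ 5 δ m · μ(J)`. -/
theorem lemma_one
    (t : ℕ → ℝ) (γ ε₁ : ℝ) (hγ : 0 < γ) (hε₁ : 0 < ε₁)
    (hmono : StrictMono t) (ht0 : 1 ≤ t 0)
    (hasymp : ∃ C' : ℝ, ∀ n : ℕ, 1 ≤ n →
      |t (n + 1) / t n - 1 - γ / n| ≤ C' * (n : ℝ) ^ (-(1 + ε₁)))
    (h : ℕ → ℝ) (hh : ∀ n, h n = (n : ℝ) ^ (1 + 1 / γ) * Real.log n ^ (2 / γ))
    (c : ℝ) (hc : c = 60 * Real.log (2 + 1 / γ))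
    (δ : ℕ → ℝ) (hδ : ∀ n, δ n = 1 / (c * n * Real.log n))
    (E : ℕ → Set ℝ) (hE : ∀ n, E n =
      (⋃ a ∈ Finset.range (⌈t n⌉₊ + 1),
        Set.Icc ((a : ℝ) / t n - δ n / t n) ((a : ℝ) / t n + δ n / t n)) ∩ Set.Icc 0 1)
    (l : ℕ → ℤ) (hl : ∀ n, l n = ⌊Real.logb 2 (2 * t n / δ n)⌋)
    (A : ℕ → Set ℝ) (hA : ∀ n, A n = ⋃ b : ℤ,
      ⋃ (_ : (Set.Icc ((b : ℝ) / 2 ^ l n) (((b : ℝ) + 1) / 2 ^ l n) ∩ E n).Nonempty),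
        Set.Icc ((b : ℝ) / 2 ^ l n) (((b : ℝ) + 1) / 2 ^ l n)) :
    ∃ N : ℕ, ∀ n : ℕ, N ≤ n → ∀ a : ℤ,
      Set.Icc ((a : ℝ) / 2 ^ l n) (((a : ℝ) + 1) / 2 ^ l n) ⊆ Set.Icc 0 1 →
      ∀ m : ℕ, h n ≤ (m : ℝ) →
        volume (Set.Icc ((a : ℝ) / 2 ^ l n) (((a : ℝ) + 1) / 2 ^ l n) ∩ A m) ≤
          ENNReal.ofReal (5 * δ m) *
            volume (Set.Icc ((a : ℝ) / 2 ^ l n) (((a : ℝ) + 1) / 2 ^ l n)) := by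
  have hcpos : 1 ≤ c := by
    have h1 : Real.log 2 ≤ Real.log (2 + 1 / γ) :=
      Real.log_le_log two_pos (by have := one_div_pos.mpr hγ; linarith)
    have := Real.log_two_gt_d9
    linarith
  have htpos : ∀ k, 0 < t k := fun k =>
    (zero_lt_one.trans_le ht0).trans_le (hmono.monotone (Nat.zero_le k))
  have hlog1 : ∀ k : ℕ, 3 ≤ k → 1 ≤ Real.log k := fun k hk => by
    rw [Real.le_log_iff_exp_le (by positivity)]
    have : (3 : ℝ) ≤ k := by exact_mod_cast hk
    linarith [Real.exp_one_lt_d9]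
  have hδpos : ∀ k : ℕ, 3 ≤ k → 0 < δ k ∧ δ k ≤ 1 := fun k hk => by
    have h1 := hlog1 k hk
    have h2 : (1 : ℝ) ≤ k := by exact_mod_cast (by omega : 1 ≤ k)
    have h3 : 1 ≤ c * k * Real.log k := one_le_mul_of_one_le_of_one_le
      (one_le_mul_of_one_le_of_one_le hcpos h2) h1
    rw [hδ]
    exact ⟨by positivity, (div_le_one (by positivity)).mpr h3⟩
  obtain ⟨K, hK, hKt⟩ := exists_mul_rpow_le_of_ratio hγ hε₁ hmono.monotone
    (zero_lt_one.trans_le ht0) hasymp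
  obtain ⟨N, hN⟩ := Filter.eventually_atTop.mp
    ((Real.tendsto_log_atTop.comp tendsto_natCast_atTop_atTop).eventually_ge_atTop (40 * c / K))
  refine ⟨max N 3, fun n hn a _ m hm => ?_⟩
  have hn3 : 3 ≤ n := (le_max_right _ _).trans hn
  have hnlog := hlog1 n hn3
  have hnN : 40 * c / K ≤ Real.log n := hN n ((le_max_left _ _).trans hn)
  rw [div_le_iff₀ hK] at hnN
  have hn1 : (1 : ℝ) ≤ n := by exact_mod_cast (by omega : 1 ≤ n)
  have hn0 : (0 : ℝ) < n := by linarith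
  have hmn : (n : ℝ) ^ (1 / γ) * Real.log n ^ (2 / γ) ≤ m / n := by
    rw [le_div_iff₀ hn0]
    rw [hh, Real.rpow_add hn0, Real.rpow_one] at hm
    linarith
  have hnm : n ≤ m := by
    have h1 : 1 ≤ (n : ℝ) ^ (1 / γ) * Real.log n ^ (2 / γ) :=
      one_le_mul_of_one_le_of_one_le (Real.one_le_rpow hn1 (by positivity))
        (Real.one_le_rpow hnlog (by positivity))
    have := (le_div_iff₀ hn0).mp (h1.trans hmn)
    exact_mod_cast (by linarith : (n : ℝ) ≤ m)
  have hratio : K * (n * Real.log n ^ 2) ≤ t m / t n := by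
    refine le_trans ?_ (hKt n m (by omega) hnm)
    gcongr
    refine le_trans (le_of_eq ?_) (Real.rpow_le_rpow (by positivity) hmn hγ.le)
    rw [Real.mul_rpow (by positivity) (by positivity), ← Real.rpow_mul hn0.le,
      ← Real.rpow_mul (by linarith), one_div_mul_cancel hγ.ne', div_mul_cancel₀ _ hγ.ne',
      Real.rpow_one, Real.rpow_two]
  obtain ⟨hδn, -⟩ := hδpos n hn3
  obtain ⟨hδm, hδm1⟩ := hδpos m (hn3.trans hnm)
  obtain ⟨-, hln⟩ := two_zpow_floor_logb_two_mul (div_pos (htpos n) hδn)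
  obtain ⟨hlm, -⟩ := two_zpow_floor_logb_two_mul (div_pos (htpos m) hδm)
  rw [← mul_div_assoc, ← hl] at hln hlm
  have hpn : (0 : ℝ) < 2 ^ l n := by positivity
  have hpm : (0 : ℝ) < 2 ^ l m := by positivity
  have hlen : 20 ≤ t m * (1 / 2 ^ l n) := by
    rw [mul_one_div, le_div_iff₀ hpn]
    have h1 : 40 * (c * n * Real.log n) ≤ t m / t n := by
      refine le_trans ?_ hratio
      have := mul_le_mul_of_nonneg_right hnN (mul_nonneg hn0.le (by linarith : 0 ≤ Real.log n))
      nlinarith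
    rw [le_div_iff₀ (htpos n)] at h1
    have h2 : 2 * t n / δ n = 2 * t n * (c * n * Real.log n) := by
      rw [hδ, div_div_eq_mul_div, div_one]
    rw [h2] at hln
    nlinarith
  have hD : 1 / 2 ^ l m ≤ δ m / t m := by
    rw [← one_div_div (t m)]
    exact one_div_le_one_div_of_le (div_pos (htpos m) hδm) hlm.le
  have hnear : ∀ y ∈ A m, ∃ b : ℤ, |y - b / t m| ≤ 2 * (δ m / t m) := by
    intro y hy
    rw [hA] at hy
    simp only [Set.mem_iUnion] at hy
    obtain ⟨b, ⟨z, hz, hzE⟩, hy⟩ := hy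
    rw [hE] at hzE
    simp only [Set.mem_inter_iff, Set.mem_iUnion] at hzE
    obtain ⟨⟨i, -, hi⟩, -⟩ := hzE
    rw [Set.mem_Icc, add_div] at hz hy
    rw [Set.mem_Icc] at hi
    refine ⟨i, abs_le.mpr ?_⟩
    push_cast
    constructor <;> linarith
  have key := volume_Icc_inter_le_of_near_lattice (x := a / 2 ^ l n) (htpos m) hδm.le hδm1
    hlen hnear
  rw [← add_div] at key
  refine key.trans_eq ?_
  rw [Real.volume_Icc, ← ENNReal.ofReal_mul (by positivity)]
  congr 2
  ring
end

section
/- (Eggleston's theorem) Suppose for every k ≥ 1 we have a set A_k = ⨆_{i=1}^{R_k} I_k(i), a disjoint union of R_k closed intervals of the real line each of length Δ_k > 0. Suppose each interval I_k(i) contains exactly N_{k+1} > 1 pairwise disjoint intervals of length Δ_{k+1} from A_{k+1} (and A_{k+1} consists exactly of these subintervals), so that R_{k+1} = R_k · N_{k+1}. Let 0 < ν₀ ≤ 1 and suppose that for every 0 < ν < ν₀ the series ∑_{k≥2} (Δ_{k-1}/Δ_k) · (R_k · Δ_k^ν)^{-1} converges. Then the set A = ⋂_{k=1}^∞ A_k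 has Hausdorff dimension at least ν₀. -/
open MeasureTheory

open Finset in
/-- At most `(q - p) / δ + 2` pairwise disjoint closed intervals of length `δ` meet `[p, q]`. -/
theorem card_mul_le_of_disjoint_Icc {ι : Type*} (T : Finset ι) (l : ι → ℝ) {δ p q : ℝ}
    (hδ : 0 < δ) (hpq : p ≤ q)
    (hd : (T : Set ι).Pairwise (Function.onFun Disjoint fun i => Set.Icc (l i) (l i + δ)))
    (hT : ∀ i ∈ T, p ≤ l i + δ ∧ l i ≤ q) :
    (T.card : ℝ) * δ ≤ q - p + 2 * δ := by
  have h1 : volume (⋃ i ∈ T, Set.Icc (l i) (l i + δ)) = ∑ i ∈ T, ENNReal.ofReal δ := by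
    rw [measure_biUnion_finset hd fun _ _ => measurableSet_Icc]
    simp
  have h2 : volume (⋃ i ∈ T, Set.Icc (l i) (l i + δ)) ≤ volume (Set.Icc (p - δ) (q + δ)) := by
    refine measure_mono (Set.iUnion₂_subset fun i hi => Set.Icc_subset_Icc ?_ ?_)
    · linarith [(hT i hi).1]
    · linarith [(hT i hi).2]
  rw [h1, Real.volume_Icc, sum_const, nsmul_eq_mul, ← ENNReal.ofReal_natCast,
    ← ENNReal.ofReal_mul (by positivity), ENNReal.ofReal_le_ofReal_iff (by linarith)] at h2
  linarith

/-- In a nested scheme of families of disjoint sets, every set of level `n` lies in a set of level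
`k ≤ n`, and each set of level `k` has `R n / R k` descendants at level `n`. -/
theorem exists_ancestor {X : Type*} (R N : ℕ → ℕ) (I : (k : ℕ) → Fin (R k) → Set X)
    (hne : ∀ k i, (I k i).Nonempty)
    (hdisj : ∀ k, Pairwise (Function.onFun Disjoint (I k)))
    (hR : ∀ k, R (k + 1) = R k * N (k + 1))
    (hnest : ∀ k, ∀ j : Fin (R (k + 1)), ∃ i : Fin (R k), I (k + 1) j ⊆ I k i)
    (hcount : ∀ k, ∀ i : Fin (R k),
      Nat.card {j : Fin (R (k + 1)) // I (k + 1) j ⊆ I k i} = N (k + 1))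
    {k n : ℕ} (hkn : k ≤ n) :
    ∃ a : Fin (R n) → Fin (R k), (∀ j, I n j ⊆ I k (a j)) ∧
      ∀ i, R k * (Finset.univ.filter fun j => a j = i).card = R n := by
  induction n, hkn using Nat.le_induction with
  | base => exact ⟨id, fun _ => le_rfl, fun i => by simp [Finset.filter_eq']⟩
  | succ n hkn ih =>
    obtain ⟨a, ha, hcard⟩ := ih
    choose par hpar using hnest n
    have hfib : ∀ i, (Finset.univ.filter fun j => par j = i).card = N (n + 1) := by
      intro i
      classical
      rw [← hcount n i, Nat.card_eq_fintype_card, Fintype.card_subtype]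
      congr 1
      ext j
      simp only [Finset.mem_filter, Finset.mem_univ, true_and]
      refine ⟨fun h => h ▸ hpar j, fun h => ?_⟩
      by_contra hji
      obtain ⟨x, hx⟩ := hne (n + 1) j
      exact Set.disjoint_left.1 (hdisj n hji) (hpar j hx) (h hx)
    refine ⟨a ∘ par, fun j => (hpar j).trans (ha _), fun i => ?_⟩
    have h : (Finset.univ.filter fun j => (a ∘ par) j = i).card =
        (Finset.univ.filter fun j => a j = i).card * N (n + 1) := by
      rw [Finset.card_eq_sum_card_fiberwise (f := par) (t := Finset.univ.filter fun j => a j = i)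
        (by intro j hj; simpa using hj), Finset.sum_const_nat]
      intro m hm
      rw [← hfib m, Finset.filter_filter]
      congr 1
      ext j
      simp only [Finset.mem_filter, Finset.mem_univ, true_and, Function.comp] at hm ⊢
      exact ⟨fun h => h.2, fun h => ⟨by rw [h, hm], h⟩⟩
    rw [h, ← mul_assoc, hcard, hR]

/-- The number of intervals of level `n` with left end in `[p, q]` is bounded through the
intervals of a coarser level `k`. -/
theorem card_left_mem_Icc_mul_le (R N : ℕ → ℕ) (Δ : ℕ → ℝ) (l : (k : ℕ) → Fin (R k) → ℝ)
    (hΔ : ∀ k, 0 < Δ k)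
    (hdisj : ∀ k, Pairwise (Function.onFun Disjoint fun i => Set.Icc (l k i) (l k i + Δ k)))
    (hR : ∀ k, R (k + 1) = R k * N (k + 1))
    (hnest : ∀ k, ∀ j : Fin (R (k + 1)), ∃ i : Fin (R k),
      Set.Icc (l (k + 1) j) (l (k + 1) j + Δ (k + 1)) ⊆ Set.Icc (l k i) (l k i + Δ k))
    (hcount : ∀ k, ∀ i : Fin (R k), Nat.card {j : Fin (R (k + 1)) //
      Set.Icc (l (k + 1) j) (l (k + 1) j + Δ (k + 1)) ⊆ Set.Icc (l k i) (l k i + Δ k)} =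
        N (k + 1))
    {k n : ℕ} (hkn : k ≤ n) {p q : ℝ} (hpq : Δ k ≤ q - p) :
    ((Finset.univ.filter fun j => l n j ∈ Set.Icc p q).card : ℝ) * (R k * Δ k) ≤
      3 * (q - p) * R n := by
  obtain ⟨a, ha, hcard⟩ := exists_ancestor R N (fun k i => Set.Icc (l k i) (l k i + Δ k))
    (fun k i => Set.nonempty_Icc.2 (by linarith [hΔ k])) hdisj hR hnest hcount hkn
  set S := Finset.univ.filter fun j => l n j ∈ Set.Icc p q
  have hk := hΔ k
  have h1 : (S.image a).card * Δ k ≤ q - p + 2 * Δ k := by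
    refine card_mul_le_of_disjoint_Icc _ (l k) (hΔ k) (by linarith) ((hdisj k).set_pairwise _) ?_
    intro i hi
    obtain ⟨j, hj, rfl⟩ := Finset.mem_image.1 hi
    have hj' : l n j ∈ Set.Icc p q := (Finset.mem_filter.1 hj).2
    have hl := ha j (Set.left_mem_Icc.2 (by linarith [hΔ n]))
    exact ⟨hj'.1.trans hl.2, hl.1.trans hj'.2⟩
  have h2 : S.card * R k ≤ (S.image a).card * R n := by
    rw [Finset.card_eq_sum_card_image a S, Finset.sum_mul, ← smul_eq_mul (a := (S.image a).card)]
    refine Finset.sum_le_card_nsmul _ _ _ fun i _ => ?_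
    refine le_of_le_of_eq ?_ (hcard i)
    rw [mul_comm]
    gcongr
    exact Finset.subset_univ _
  have h2' : (S.card : ℝ) * R k ≤ (S.image a).card * R n := by exact_mod_cast h2
  calc (S.card : ℝ) * (R k * Δ k) = S.card * R k * Δ k := by ring
    _ ≤ (S.image a).card * R n * Δ k := by gcongr
    _ = (S.image a).card * Δ k * R n := by ring
    _ ≤ 3 * (q - p) * R n := mul_le_mul_of_nonneg_right (by linarith) (by positivity)

/-- The Hölder-type mass bound: the proportion of intervals of level `n` with left end in `[p, q]`
is at most a constant times `(q - p) ^ ν`. -/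
theorem exists_card_left_mem_Icc_le (R N : ℕ → ℕ) (Δ : ℕ → ℝ) (l : (k : ℕ) → Fin (R k) → ℝ)
    (hRpos : ∀ k, 0 < R k) (hΔ : ∀ k, 0 < Δ k)
    (hdisj : ∀ k, Pairwise (Function.onFun Disjoint fun i => Set.Icc (l k i) (l k i + Δ k)))
    (hR : ∀ k, R (k + 1) = R k * N (k + 1))
    (hnest : ∀ k, ∀ j : Fin (R (k + 1)), ∃ i : Fin (R k),
      Set.Icc (l (k + 1) j) (l (k + 1) j + Δ (k + 1)) ⊆ Set.Icc (l k i) (l k i + Δ k))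
    (hcount : ∀ k, ∀ i : Fin (R k), Nat.card {j : Fin (R (k + 1)) //
      Set.Icc (l (k + 1) j) (l (k + 1) j + Δ (k + 1)) ⊆ Set.Icc (l k i) (l k i + Δ k)} =
        N (k + 1))
    {ν : ℝ} (hν : 0 < ν) (hν1 : ν ≤ 1)
    (hbdd : BddAbove (Set.range fun k : ℕ =>
      Δ k / Δ (k + 1) * ((R (k + 1) : ℝ) * Δ (k + 1) ^ ν)⁻¹)) :
    ∃ K : ℝ, 0 ≤ K ∧ ∀ n p q, Δ n ≤ q - p →
      ((Finset.univ.filter fun j => l n j ∈ Set.Icc p q).card : ℝ) ≤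
        R n * (K * (q - p) ^ ν) := by
  obtain ⟨C, hC⟩ := hbdd
  have hC' : ∀ k, Δ k / Δ (k + 1) * ((R (k + 1) : ℝ) * Δ (k + 1) ^ ν)⁻¹ ≤ C :=
    fun k => hC ⟨k, rfl⟩
  refine ⟨max ((Δ 0 ^ ν)⁻¹) (3 * C), le_max_of_le_left
    (inv_nonneg.2 (Real.rpow_nonneg (hΔ 0).le _)), fun n p q hn => ?_⟩
  set d := q - p with hd
  have hdpos : 0 < d := (hΔ n).trans_le hn
  have hdν : 0 < d ^ ν := Real.rpow_pos_of_pos hdpos _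
  have hex : ∃ k, Δ k ≤ d := ⟨n, hn⟩
  classical
  rcases hk : Nat.find hex with _ | k
  · have h0 : Δ 0 ≤ d := hk ▸ Nat.find_spec hex
    have h0ν : 0 < Δ 0 ^ ν := Real.rpow_pos_of_pos (hΔ 0) _
    have h1 : 1 ≤ (Δ 0 ^ ν)⁻¹ * d ^ ν := by
      rw [inv_mul_eq_div, one_le_div h0ν]
      exact Real.rpow_le_rpow (hΔ 0).le h0 hν.le
    have h2 : ((Finset.univ.filter fun j => l n j ∈ Set.Icc p q).card : ℝ) ≤ R n := by
      exact_mod_cast (Finset.card_le_univ _).trans_eq (Fintype.card_fin _)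
    calc _ ≤ (R n : ℝ) := h2
      _ ≤ R n * ((Δ 0 ^ ν)⁻¹ * d ^ ν) := le_mul_of_one_le_right (by positivity) h1
      _ ≤ _ := by gcongr; exact le_max_left _ _
  · have h1 : Δ (k + 1) ≤ d := hk ▸ Nat.find_spec hex
    have h2 : d < Δ k := not_le.1 (Nat.find_min hex (by omega))
    have hkn : k + 1 ≤ n := hk ▸ Nat.find_min' hex hn
    have hcard := card_left_mem_Icc_mul_le R N Δ l hΔ hdisj hR hnest hcount hkn h1
    have hk0 := hΔ k
    have hk1 := hΔ (k + 1)
    have hR1 : (0 : ℝ) < R (k + 1) := by exact_mod_cast hRpos (k + 1)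
    have hk1ν : 0 < Δ (k + 1) ^ ν := Real.rpow_pos_of_pos hk1 _
    have hd1 : d * Δ (k + 1) ^ ν ≤ d ^ ν * Δ k := by
      calc d * Δ (k + 1) ^ ν = d ^ ν * (d ^ (1 - ν) * Δ (k + 1) ^ ν) := by
            rw [← mul_assoc, ← Real.rpow_add hdpos]; simp
        _ ≤ d ^ ν * (Δ k ^ (1 - ν) * Δ k ^ ν) := by
            gcongr
            linarith
        _ = d ^ ν * Δ k := by rw [← Real.rpow_add hk0]; simp
    calc _ ≤ 3 * d * R n / (R (k + 1) * Δ (k + 1)) := (le_div_iff₀ (by positivity)).2 hcard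
      _ = R n * (3 * (d * Δ (k + 1) ^ ν / (Δ (k + 1) * (R (k + 1) * Δ (k + 1) ^ ν)))) := by
          field_simp
      _ ≤ R n * (3 * (d ^ ν * Δ k / (Δ (k + 1) * (R (k + 1) * Δ (k + 1) ^ ν)))) := by gcongr
      _ = R n * (3 * (Δ k / Δ (k + 1) * ((R (k + 1) : ℝ) * Δ (k + 1) ^ ν)⁻¹) * d ^ ν) := by
          field_simp
      _ ≤ R n * (3 * C * d ^ ν) := by gcongr; exact hC' k
      _ ≤ _ := by gcongr; exact le_max_right _ _

/-- If the unit interval maps to `A` by a map whose inverse is Hölder of exponent `ν`, then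
`A` has Hausdorff dimension at least `ν`. -/
theorem le_dimH_of_antiHolder {A : Set ℝ} {ν K : ℝ} (hν : 0 < ν) (hK : 0 ≤ K)
    (g : Set.Ico (0 : ℝ) 1 → ℝ) (hg : ∀ t, g t ∈ A)
    (h : ∀ s t : Set.Ico (0 : ℝ) 1, s < t → (t : ℝ) - s ≤ K * |g t - g s| ^ ν) :
    ENNReal.ofReal ν ≤ dimH A := by
  have h' : ∀ s t : Set.Ico (0 : ℝ) 1, |(t : ℝ) - s| ≤ K * |g t - g s| ^ ν := by
    intro s t
    rcases lt_trichotomy s t with hst | rfl | hst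
    · rw [abs_of_pos (sub_pos.2 (Subtype.coe_lt_coe.2 hst))]; exact h s t hst
    · simp [Real.zero_rpow hν.ne']
    · rw [abs_sub_comm, abs_sub_comm (g t), abs_of_pos (sub_pos.2 (Subtype.coe_lt_coe.2 hst))]; exact h t s hst
  have hinj : Function.Injective g := by
    intro s t hst
    have := h' s t
    rw [hst, sub_self, abs_zero, Real.zero_rpow hν.ne', mul_zero, abs_nonpos_iff, sub_eq_zero]
      at this
    exact Subtype.ext this.symm
  have : Nonempty (Set.Ico (0 : ℝ) 1) := ⟨⟨0, by simp⟩⟩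
  set f : ℝ → ℝ := fun x => ((Function.invFun g x : Set.Ico (0 : ℝ) 1) : ℝ)
  have hf : ∀ t, f (g t) = t := fun t => congrArg Subtype.val (Function.leftInverse_invFun hinj t)
  have hhol : HolderOnWith K.toNNReal ν.toNNReal f (Set.range g) := by
    rintro _ ⟨t, rfl⟩ _ ⟨s, rfl⟩
    rw [hf, hf, edist_dist, edist_dist, Real.dist_eq, Real.dist_eq,
      Real.coe_toNNReal ν hν.le, ENNReal.ofReal_rpow_of_nonneg (abs_nonneg _) hν.le]
    change _ ≤ ENNReal.ofReal K * _
    rw [← ENNReal.ofReal_mul hK]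
    exact ENNReal.ofReal_le_ofReal (h' s t)
  have himg : f '' Set.range g = Set.Ico 0 1 := by
    ext x
    constructor
    · rintro ⟨_, ⟨t, rfl⟩, rfl⟩
      rw [hf]; exact t.2
    · intro hx
      exact ⟨_, ⟨⟨x, hx⟩, rfl⟩, hf _⟩
  have h1 : dimH (Set.Ico (0 : ℝ) 1) = 1 := by
    rw [Real.dimH_of_nonempty_interior (by simp [interior_Ico])]
    simp
  have h2 : dimH (f '' Set.range g) ≤ dimH (Set.range g) / ENNReal.ofReal ν :=
    hhol.dimH_image_le (Real.toNNReal_pos.2 hν)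
  rw [himg, h1, ENNReal.le_div_iff_mul_le (by simp [hν]) (by simp), one_mul] at h2
  exact h2.trans (dimH_mono (Set.range_subset_iff.2 hg))



/-- If the points `l n 0 < l n 1 < …` of level `n` satisfy a Hölder-type counting bound and all lie
in `A n`, where `A` is a decreasing sequence of compact sets, then `⋂ n, A n` has Hausdorff
dimension at least `ν`. -/
theorem le_dimH_iInter_of_card_le (R : ℕ → ℕ) (l : (k : ℕ) → Fin (R k) → ℝ) (A : ℕ → Set ℝ)
    (hR : Filter.Tendsto R Filter.atTop Filter.atTop)
    (hl : ∀ k, StrictMono (l k)) (hlA : ∀ k i, l k i ∈ A k)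
    (hA : Antitone A) (hAc : ∀ k, IsCompact (A k)) {ν K : ℝ} (hν : 0 < ν) (hK : 0 ≤ K)
    (hcard : ∀ n i j, i < j →
      ((Finset.univ.filter fun m => l n m ∈ Set.Icc (l n i) (l n j)).card : ℝ) ≤
        R n * (K * (l n j - l n i) ^ ν)) :
    ENNReal.ofReal ν ≤ dimH (⋂ k, A k) := by
  have hbig : ∀ᶠ n in Filter.atTop, 0 < R n := hR.eventually_gt_atTop 0
  have hmem : ∀ n, 0 < R n → ∀ t : Set.Ico (0 : ℝ) 1, ⌊(t : ℝ) * R n⌋₊ < R n := by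
    intro n hn t
    have hn' : (0 : ℝ) < R n := by exact_mod_cast hn
    rw [Nat.floor_lt (mul_nonneg t.2.1 hn'.le)]
    exact mul_lt_of_lt_one_left hn' t.2.2
  set x : Set.Ico (0 : ℝ) 1 → ℕ → ℝ := fun t n =>
    if h : ⌊(t : ℝ) * R n⌋₊ < R n then l n ⟨_, h⟩ else 0 with hx
  have hxA : ∀ t, ∀ m, ∀ᶠ n in Filter.atTop, x t n ∈ A m := by
    intro t m
    filter_upwards [hbig, Filter.eventually_ge_atTop m] with n hn hmn
    simp only [hx, dif_pos (hmem n hn t)]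
    exact hA hmn (hlA _ _)
  have hU : (Filter.hyperfilter ℕ : Filter ℕ) ≤ Filter.atTop := Nat.hyperfilter_le_atTop
  have hlim : ∀ t, ∃ y, Filter.Tendsto (x t) (Filter.hyperfilter ℕ) (nhds y) := by
    intro t
    obtain ⟨y, -, hy⟩ := (hAc 0).ultrafilter_le_nhds ((Filter.hyperfilter ℕ).map (x t))
      (Filter.le_principal_iff.2 (hU (hxA t 0)))
    exact ⟨y, hy⟩
  choose g hg using hlim
  refine le_dimH_of_antiHolder hν hK g (fun t => Set.mem_iInter.2 fun m =>
    (hAc m).isClosed.mem_of_tendsto (hg t) (hU (hxA t m))) fun s t hst => ?_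
  have hst' : (0 : ℝ) < t - s := sub_pos.2 (Subtype.coe_lt_coe.2 hst)
  have hten : Filter.Tendsto (fun n => K * |x t n - x s n| ^ ν) (Filter.hyperfilter ℕ)
      (nhds (K * |g t - g s| ^ ν)) :=
    ((((hg t).sub (hg s)).abs).rpow_const (Or.inr hν.le)).const_mul K
  refine ge_of_tendsto hten (hU ?_)
  have hgap : ∀ᶠ n in Filter.atTop, 1 < (t - s : ℝ) * R n :=
    ((tendsto_natCast_atTop_atTop.comp hR).const_mul_atTop hst').eventually_gt_atTop 1
  filter_upwards [hbig, hgap] with n hn hgn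
  have hn' : (0 : ℝ) < R n := by exact_mod_cast hn
  have hs0 := Nat.floor_le (mul_nonneg s.2.1 hn'.le)
  have ht1 := Nat.lt_floor_add_one ((t : ℝ) * R n)
  simp only [hx, dif_pos (hmem n hn t), dif_pos (hmem n hn s)]
  set i : Fin (R n) := ⟨⌊(s : ℝ) * R n⌋₊, hmem n hn s⟩ with hi
  set j : Fin (R n) := ⟨⌊(t : ℝ) * R n⌋₊, hmem n hn t⟩ with hj
  have hij : i < j := by
    rw [Fin.lt_def, ← Nat.cast_lt (α := ℝ)]
    change ((⌊(s : ℝ) * R n⌋₊ : ℕ) : ℝ) < (⌊(t : ℝ) * R n⌋₊ : ℕ)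
    linarith
  have hc := hcard n i j hij
  have hset : (Finset.univ.filter fun m => l n m ∈ Set.Icc (l n i) (l n j)) =
      Finset.Icc i j := by
    ext m
    simp [(hl n).le_iff_le]
  rw [hset, Fin.card_Icc, Nat.cast_sub (by rw [Fin.lt_def] at hij; omega)] at hc
  push_cast at hc
  rw [abs_of_pos (sub_pos.2 (hl n hij))]
  refine le_of_mul_le_mul_left (le_trans ?_ hc) hn'
  simp only [hi, hj]
  linarith

/-- **Eggleston's theorem.** Let `A k = ⋃ i, I k i` be a disjoint union of `R k` closed
intervals of length `Δ k > 0`, each interval of level `k` containing exactly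
`N (k+1) > 1` pairwise disjoint intervals of level `k+1` (and `A (k+1)` consisting
exactly of these), with `R (k+1) = R k * N (k+1)`. If `0 < ν₀ ≤ 1` and for every
`0 < ν < ν₀` the series `∑_k (Δ_{k-1}/Δ_k) (R_k Δ_k^ν)⁻¹` converges, then
`⋂ k, A k` has Hausdorff dimension at least `ν₀`. (Indices here start at `0` instead
of `1`.) -/
theorem eggleston
    (R N : ℕ → ℕ) (Δ : ℕ → ℝ) (I : (k : ℕ) → Fin (R k) → Set ℝ)
    (ν₀ : ℝ) (hν₀ : 0 < ν₀) (hν₀' : ν₀ ≤ 1)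
    (hR0 : 0 < R 0)
    (hΔ : ∀ k, 0 < Δ k)
    (hI : ∀ k i, ∃ x : ℝ, I k i = Set.Icc x (x + Δ k))
    (hdisj : ∀ k, Pairwise (Function.onFun Disjoint (I k)))
    (hN : ∀ k, 1 < N (k + 1))
    (hR : ∀ k, R (k + 1) = R k * N (k + 1))
    (hnest : ∀ k, ∀ j : Fin (R (k + 1)), ∃ i : Fin (R k), I (k + 1) j ⊆ I k i)
    (hcount : ∀ k, ∀ i : Fin (R k),
      Nat.card {j : Fin (R (k + 1)) // I (k + 1) j ⊆ I k i} = N (k + 1))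
    (hsum : ∀ ν : ℝ, 0 < ν → ν < ν₀ →
      Summable (fun k : ℕ => Δ k / Δ (k + 1) * ((R (k + 1) : ℝ) * Δ (k + 1) ^ ν)⁻¹)) :
    ENNReal.ofReal ν₀ ≤ dimH (⋂ k, ⋃ i, I k i) := by
  have hRpos : ∀ k, 0 < R k := by
    intro k
    induction k with
    | zero => exact hR0
    | succ k ih => rw [hR]; exact Nat.mul_pos ih (by linarith [hN k])
  have hRtop : Filter.Tendsto R Filter.atTop Filter.atTop :=
    (strictMono_nat_of_lt_succ fun k => by
      rw [hR]; exact lt_mul_of_one_lt_right (hRpos k) (hN k)).tendsto_atTop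
  choose l hl using hI
  obtain rfl : I = fun k i => Set.Icc (l k i) (l k i + Δ k) := by
    funext k i; exact hl k i
  have hinj : ∀ k, Function.Injective (l k) := by
    intro k i j hij
    by_contra hne
    have h := hdisj k hne
    simp only [Function.onFun, hij, disjoint_self, Set.bot_eq_empty, Set.Icc_eq_empty_iff] at h
    linarith [hΔ k]
  refine le_of_forall_lt fun c hc => ?_
  obtain ⟨ν, hcν, hνν₀⟩ : ∃ ν : ℝ, c < ENNReal.ofReal ν ∧ ν < ν₀ := by
    obtain ⟨r, hcr, hr⟩ := ENNReal.lt_iff_exists_nnreal_btwn.1 hc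
    refine ⟨r, by simpa using hcr, ?_⟩
    rw [← ENNReal.ofReal_coe_nnreal] at hr
    exact (ENNReal.ofReal_lt_ofReal_iff hν₀).1 hr
  have hν : 0 < ν := ENNReal.ofReal_pos.1 (bot_le.trans_lt hcν)
  refine hcν.trans_le ?_
  obtain ⟨K, hK, hcard⟩ := exists_card_left_mem_Icc_le R N Δ l hRpos hΔ hdisj hR hnest hcount hν
    (hνν₀.le.trans hν₀') (hsum ν hν hνν₀).tendsto_atTop_zero.bddAbove_range
  refine le_dimH_iInter_of_card_le R (fun k => l k ∘ Tuple.sort (l k))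
    (fun k => ⋃ i, Set.Icc (l k i) (l k i + Δ k)) hRtop
    (fun k => (Tuple.monotone_sort (l k)).strictMono_of_injective
      ((hinj k).comp (Tuple.sort (l k)).injective))
    (fun k i => Set.mem_iUnion.2 ⟨Tuple.sort (l k) i, Set.left_mem_Icc.2 (by linarith [hΔ k])⟩)
    (antitone_nat_of_succ_le fun k => Set.iUnion_subset fun j => ?_)
    (fun k => isCompact_iUnion fun i => isCompact_Icc) hν hK fun n i j hij => ?_
  · obtain ⟨i, hi⟩ := hnest k j
    exact hi.trans (Set.subset_iUnion (fun i => Set.Icc (l k i) (l k i + Δ k)) i)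
  · have hlt := ((Tuple.monotone_sort (l n)).strictMono_of_injective
      ((hinj n).comp (Tuple.sort (l n)).injective)) hij
    simp only [Function.comp] at hlt ⊢
    refine le_of_eq_of_le ?_ (hcard n (l n (Tuple.sort (l n) i)) (l n (Tuple.sort (l n) j)) ?_)
    · congr 1
      exact Finset.card_equiv (Tuple.sort (l n)) (by simp)
    · by_contra! h
      have hd : Disjoint (Set.Icc (l n (Tuple.sort (l n) i)) (l n (Tuple.sort (l n) i) + Δ n))
          (Set.Icc (l n (Tuple.sort (l n) j)) (l n (Tuple.sort (l n) j) + Δ n)) :=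
        hdisj n ((hinj n).ne_iff.1 hlt.ne)
      exact Set.disjoint_left.1 hd ⟨hlt.le, by linarith⟩ ⟨le_rfl, by linarith [hΔ n]⟩
end
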